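/- arXiv:1902.02935 — 4 statements merged into one kernel-verified Lean document; each statement's English description precedes it below -/
import Mathlib

section
/- (h-maxmin Perturbation Lemma) Let (r, σ) be a maxmin-utility envy-free allocation for total rent m with piece-wise linear preferences u, and let μ be a maximum-weight perfect matching in F^u(r). Then there exist ε > 0 and a continuous map δ ∈ [0, ε] ↦ (r^δ, μ) such that each (r^δ, μ) is a maxmin-utility envy-free allocation for rent m − δ, (r^0, μ) = (r, μ), and for δ < η each agent's utility is strictly higher at r^η than at r^δ while each room's price strictly decreases: r^δ_a > r^η_a for all a. -/
/-- Envy-freeness for a general utility profile. -/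
def EnvyFree (n : ℕ) (u : Fin n → ℝ → Fin n → ℝ) (r : Fin n → ℝ)
    (σ : Equiv.Perm (Fin n)) : Prop :=
  ∀ i j : Fin n, u i (r (σ j)) (σ j) ≤ u i (r (σ i)) (σ i)

/-- Maxmin-utility envy-free allocation for total rent `m`. -/
def MaxminEF (n : ℕ) (u : Fin n → ℝ → Fin n → ℝ) (m : ℝ) (r : Fin n → ℝ)
    (σ : Equiv.Perm (Fin n)) : Prop :=
  (∑ a, r a = m) ∧ EnvyFree n u r σ ∧
    ∀ (t : Fin n → ℝ) (γ : Equiv.Perm (Fin n)), (∑ a, t a = m) →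
      EnvyFree n u t γ →
      (⨅ i, u i (t (γ i)) (γ i)) ≤ ⨅ i, u i (r (σ i)) (σ i)


open Filter Topology in
lemma aux_exists_pos {p : ℝ → Prop} (h : ∀ᶠ x in 𝓝[>] (0:ℝ), p x) : ∃ x > 0, p x := by
  have := (h.and self_mem_nhdsWithin).exists
  obtain ⟨x, hx, hx'⟩ := this
  exact ⟨x, hx', hx⟩

lemma aux_cl_and {X : Type*} [TopologicalSpace X] {p q : X → Prop} (hp : IsClosed {x | p x})
    (hq : IsClosed {x | q x}) : IsClosed {x | p x ∧ q x} := by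
  have : {x | p x ∧ q x} = {x | p x} ∩ {x | q x} := by ext x; simp
  rw [this]; exact hp.inter hq

lemma aux_cl_all {X : Type*} [TopologicalSpace X] {α : Sort*} {p : α → X → Prop}
    (hp : ∀ a, IsClosed {x | p a x}) : IsClosed {x | ∀ a, p a x} := by
  have : {x | ∀ a, p a x} = ⋂ a, {x | p a x} := by ext x; simp
  rw [this]; exact isClosed_iInter hp

lemma aux_pigeon {ι : Type*} [Fintype ι] (L : ℕ → Finset ι) (hL : ∀ k, L (k+1) ⊆ L k) :
    ∃ k, k ≤ Fintype.card ι ∧ L k = L (k+1) := by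
  by_contra hcon
  push Not at hcon
  have key : ∀ k, k ≤ Fintype.card ι + 1 → (L k).card + k ≤ Fintype.card ι := by
    intro k
    induction k with
    | zero => intro _; simpa using Finset.card_le_univ (L 0)
    | succ k ih =>
      intro hk
      have h1 := ih (by omega)
      have h2 : (L (k+1)).card < (L k).card :=
        Finset.card_lt_card (lt_of_le_of_ne (hL k) (fun h => hcon k (by omega) h.symm))
      omega
  have := key (Fintype.card ι + 1) le_rfl
  omega

open Filter Topology in
lemma aux_raise {ι : Type*} [Fintype ι] [DecidableEq ι] (v : ι → ℝ → ι → ℝ)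
    (hc : ∀ i a, Continuous fun p => v i p a) (ha : ∀ i a, StrictAnti fun p => v i p a) :
    ∀ I : Finset ι, I.Nonempty → ∀ (σ : Equiv.Perm ι) (r : ι → ℝ),
      (∀ i ∈ I, ∀ j ∈ I, v i (r (σ j)) (σ j) ≤ v i (r (σ i)) (σ i)) → ∀ ρ > (0:ℝ),
      ∃ (t : ι → ℝ) (γ : Equiv.Perm ι), (∀ i, i ∉ I → γ i = σ i) ∧
        (∀ i, i ∉ I → t (σ i) = r (σ i)) ∧ (∀ a, r a ≤ t a) ∧ (∀ a, t a ≤ r a + ρ) ∧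
        (∃ a, r a < t a) ∧
        ∀ i ∈ I, ∀ j ∈ I, v i (t (σ j)) (σ j) ≤ v i (t (γ i)) (γ i) := by
  have ha' : ∀ i a p q, p ≤ q → v i q a ≤ v i p a := fun i a p q h => (ha i a).antitone h
  have ha'' : ∀ i a p q, p < q → v i q a < v i p a := fun i a p q h => ha i a h
  intro I
  induction I using Finset.strongInduction with
  | H I IH =>
  intro hI σ r hEF ρ hρ
  obtain ⟨b0, hb0⟩ := hI
  set b := σ b0 with hb
  have hstep : ∀ l : ℝ, 0 < l → ∃ l', 0 < l' ∧ l' < l ∧ ∀ i a a',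
      v i (r a') a' ≤ v i (r a) a → v i (r a' + l) a' < v i (r a + l') a := by
    intro l hl
    have h1 : ∀ᶠ x in 𝓝[>] (0:ℝ), x < l :=
      eventually_nhdsWithin_of_eventually_nhds (gt_mem_nhds hl)
    have h2 : ∀ᶠ x in 𝓝[>] (0:ℝ), ∀ i a a',
      v i (r a') a' ≤ v i (r a) a → v i (r a' + l) a' < v i (r a + x) a := by
      refine eventually_nhdsWithin_of_eventually_nhds ?_
      rw [eventually_all]; intro i
      rw [eventually_all]; intro a
      rw [eventually_all]; intro a'
      by_cases h : v i (r a') a' ≤ v i (r a) a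
      · have hcc : Continuous fun x => v i (r a + x) a :=
          (hc i a).comp (continuous_const.add continuous_id)
        have : v i (r a' + l) a' < v i (r a + 0) a := by
          rw [add_zero]
          exact lt_of_lt_of_le (ha'' _ _ _ _ (by linarith)) h
        have := hcc.continuousAt.eventually (lt_mem_nhds this)
        filter_upwards [this] with x hx _ using hx
      · exact Eventually.of_forall fun x hx => absurd hx h
    obtain ⟨x, hx, hx1, hx2⟩ := aux_exists_pos (h1.and h2)
    exact ⟨x, hx, hx1, hx2⟩
  choose! g hg0 hg1 hg2 using hstep
  set s : ℕ → ℝ := fun k => g^[k] ρ with hs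
  have s0 : s 0 = ρ := rfl
  have ssucc : ∀ k, s (k+1) = g (s k) := fun k => Function.iterate_succ_apply' _ _ _
  have spos : ∀ k, 0 < s k := by
    intro k
    induction k with
    | zero => exact hρ
    | succ k ih => rw [ssucc]; exact hg0 _ ih
  have slt : ∀ k, s (k+1) < s k := fun k => by rw [ssucc]; exact hg1 _ (spos k)
  have santi : StrictAnti s := strictAnti_nat_of_succ_lt slt
  set τ := s (Fintype.card ι + 2) with hτ
  have hτpos : 0 < τ := spos _
  have hτρ : τ ≤ ρ := by rw [← s0]; exact santi.antitone (Nat.zero_le _)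
  let K : Equiv.Perm ι → Set (ι → ℝ) := fun γ => {t | (∀ i, i ∉ I → γ i = σ i) ∧
    (∀ a, r a ≤ t a) ∧ (∀ a, t a ≤ r a + ρ) ∧ (∀ i, i ∉ I → t (σ i) = r (σ i)) ∧
    t b = r b + τ ∧ ∀ i ∈ I, γ i ≠ b → ∀ j ∈ I, v i (t (σ j)) (σ j) ≤ v i (t (γ i)) (γ i)}
  have hKcl : ∀ γ, IsClosed (K γ) := by
    intro γ
    have hvc : ∀ i a, Continuous fun t : ι → ℝ => v i (t a) a :=
      fun i a => (hc i a).comp (continuous_apply a)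
    refine aux_cl_and isClosed_const (aux_cl_and ?_ (aux_cl_and ?_ (aux_cl_and ?_
      (aux_cl_and ?_ ?_))))
    · exact aux_cl_all fun a => isClosed_le continuous_const (continuous_apply a)
    · exact aux_cl_all fun a => isClosed_le (continuous_apply a) continuous_const
    · exact aux_cl_all fun i => aux_cl_all fun _ =>
        isClosed_eq (continuous_apply _) continuous_const
    · exact isClosed_eq (continuous_apply _) continuous_const
    · exact aux_cl_all fun i => aux_cl_all fun _ => aux_cl_all fun _ =>
        aux_cl_all fun j => aux_cl_all fun _ => isClosed_le (hvc _ _) (hvc _ _)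
  have hKco : ∀ γ, IsCompact (K γ) := fun γ =>
    IsCompact.of_isClosed_subset (isCompact_Icc (a := r) (b := fun a => r a + ρ)) (hKcl γ)
      fun t ht => ⟨ht.2.1, ht.2.2.1⟩
  have hQco : IsCompact (⋃ γ, K γ) := isCompact_iUnion hKco
  have hQne : (⋃ γ, K γ).Nonempty := by
    refine ⟨fun a => if a = b then r b + τ else r a, Set.mem_iUnion.2 ⟨σ, fun _ _ => rfl, ?_, ?_, ?_, ?_, ?_⟩⟩
    · intro a; dsimp only; split_ifs with h
      · subst h; linarith
      · exact le_rfl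
    · intro a; dsimp only; split_ifs with h
      · subst h; linarith
      · linarith
    · intro i hi
      have : σ i ≠ b := fun h => hi (by rw [σ.injective h]; exact hb0)
      simp [this]
    · simp
    · intro i hi hib j hj
      dsimp only
      rw [if_neg hib]
      refine le_trans ?_ (hEF i hi j hj)
      apply ha'
      split_ifs with h
      · rw [h]; linarith
      · exact le_rfl
  obtain ⟨t, htQ, htmax⟩ := hQco.exists_isMaxOn hQne
    (f := fun t : ι → ℝ => ∑ a, t a) (by fun_prop)
  obtain ⟨γ, hγoff, htr, htρ, htoff, htb, hdem⟩ := Set.mem_iUnion.1 htQ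
  set k := γ.symm b with hk
  have hγk : γ k = b := γ.apply_symm_apply b
  have hσγ : ∀ i ∈ I, σ.symm (γ i) ∈ I := by
    intro i hi
    by_contra h
    have := hγoff _ h
    rw [σ.apply_symm_apply] at this
    exact h (by rw [γ.injective this]; exact hi)
  have hkI : k ∈ I := by
    by_contra h
    have := hγoff _ h
    rw [hγk, hb] at this
    exact h (by rw [← σ.injective this]; exact hb0)
  have hdem' : ∀ i ∈ I, i ≠ k → ∀ j ∈ I, v i (t (σ j)) (σ j) ≤ v i (t (γ i)) (γ i) :=
    fun i hi hik => hdem i hi fun h => hik (γ.injective (h.trans hγk.symm))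
  let D : ι → Finset ι := fun i => if i ∈ I then
    Finset.univ.filter (fun a => σ.symm a ∈ I ∧ ∀ j ∈ I, v i (t (σ j)) (σ j) ≤ v i (t a) a)
    else {σ i}
  have hD : ∀ i ∈ I, ∀ a, a ∈ D i ↔
      (σ.symm a ∈ I ∧ ∀ j ∈ I, v i (t (σ j)) (σ j) ≤ v i (t a) a) := by
    intro i hi a
    simp [D, hi]
  have hD' : ∀ i, i ∉ I → D i = {σ i} := by
    intro i hi
    simp [D, hi]
  by_cases hHall : ∀ T : Finset ι, T.card ≤ (T.biUnion D).card
  · obtain ⟨f, hf, hfD⟩ := (Finset.all_card_le_biUnion_card_iff_exists_injective D).1 hHall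
    refine ⟨t, Equiv.ofBijective f (Finite.injective_iff_bijective.1 hf), ?_, htoff, htr, htρ,
      ⟨b, by rw [htb]; linarith⟩, ?_⟩
    · intro i hi
      have := hfD i
      rw [hD' i hi] at this
      simpa using this
    · intro i hi j hj
      exact ((hD i hi _).1 (hfD i)).2 j hj
  exfalso
  push Not at hHall
  obtain ⟨T, hT⟩ := hHall
  have hown : ∀ i, i ≠ k → γ i ∈ D i := by
    intro i hik
    by_cases hi : i ∈ I
    · exact (hD i hi _).2 ⟨hσγ i hi, hdem' i hi hik⟩
    · rw [hD' i hi, hγoff i hi]; simp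
  have hsub : (T.erase k).image γ ⊆ T.biUnion D := by
    intro a haT
    obtain ⟨i, hi, rfl⟩ := Finset.mem_image.1 haT
    exact Finset.mem_biUnion.2 ⟨i, Finset.mem_of_mem_erase hi, hown i (Finset.ne_of_mem_erase hi)⟩
  have hcardim : ((T.erase k).image γ).card = (T.erase k).card :=
    Finset.card_image_of_injective _ γ.injective
  have hkT : k ∈ T := by
    by_contra h
    have := Finset.card_le_card hsub
    rw [hcardim, Finset.erase_eq_of_notMem h] at this
    omega
  have hTeq : (T.erase k).image γ = T.biUnion D := by
    refine Finset.eq_of_subset_of_card_le hsub ?_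
    rw [hcardim, Finset.card_erase_of_mem hkT]
    omega
  -- gap
  let L : ℕ → Finset ι := fun q => Finset.univ.filter (fun a => t a < r a + s q)
  have hLmem : ∀ q a, a ∈ L q ↔ t a < r a + s q := by intro q a; simp [L]
  obtain ⟨q, hq, hqL⟩ := aux_pigeon L (by
    intro q a haL
    rw [hLmem] at haL ⊢
    linarith [slt q])
  have hbL : b ∈ L q := by
    rw [hLmem, htb]
    have : τ < s q := santi (by omega)
    linarith
  have hDL : ∀ i ∈ I, σ i ∈ L q → ∀ a ∈ D i, a ∈ L q := by
    intro i hi hiL a haD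
    by_contra haL
    obtain ⟨h1, h2⟩ := (hD i hi a).1 haD
    rw [hLmem] at haL
    rw [hqL, hLmem] at hiL
    push Not at haL
    have e1 := ha' i a _ _ haL
    have e2 := hEF i hi _ h1
    rw [σ.apply_symm_apply] at e2
    have e3 := hg2 (s q) (spos q) i (σ i) a e2
    rw [← ssucc] at e3
    have e4 := ha'' i (σ i) _ _ hiL
    have e5 := h2 i hi
    linarith
  let J : Finset ι := I.filter (fun i => σ i ∈ L q)
  have hJmem : ∀ i, i ∈ J ↔ i ∈ I ∧ σ i ∈ L q := by intro i; simp [J]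
  have hJσ : ∀ a, a ∈ J.image σ ↔ σ.symm a ∈ I ∧ a ∈ L q := by
    intro a
    rw [Finset.mem_image]
    constructor
    · rintro ⟨i, hi, rfl⟩
      rw [σ.symm_apply_apply]; exact (hJmem i).1 hi
    · intro h
      exact ⟨σ.symm a, (hJmem _).2 (by rwa [σ.apply_symm_apply]), σ.apply_symm_apply a⟩
  have hbJ : b ∈ J.image σ := (hJσ b).2 ⟨by rw [hb, σ.symm_apply_apply]; exact hb0, hbL⟩
  have hJs : (J.erase k).image γ ⊆ (J.image σ).erase b := by
    intro a haJ
    obtain ⟨i, hi, rfl⟩ := Finset.mem_image.1 haJ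
    have hik := Finset.ne_of_mem_erase hi
    obtain ⟨hiI, hiL⟩ := (hJmem i).1 (Finset.mem_of_mem_erase hi)
    refine Finset.mem_erase.2 ⟨fun h => hik (γ.injective (h.trans hγk.symm)), ?_⟩
    exact (hJσ _).2 ⟨hσγ i hiI, hDL i hiI hiL _ (hown i hik)⟩
  have hcJσ : (J.image σ).card = J.card := Finset.card_image_of_injective _ σ.injective
  have hcJγ : (J.image γ).card = J.card := Finset.card_image_of_injective _ γ.injective
  have hkJ : k ∈ J := by
    by_contra h
    have h1 := Finset.card_le_card hJs
    have h2 := Finset.card_pos.2 ⟨b, hbJ⟩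
    rw [Finset.card_erase_of_mem hbJ, Finset.card_image_of_injective _ γ.injective,
      Finset.erase_eq_of_notMem h] at h1
    omega
  have hJeq : J.image γ = J.image σ := by
    refine Finset.eq_of_subset_of_card_le ?_ (by omega)
    intro a haJ
    obtain ⟨i, hi, rfl⟩ := Finset.mem_image.1 haJ
    by_cases hik : i = k
    · rw [hik, hγk]; exact hbJ
    · exact Finset.mem_of_mem_erase
        (hJs (Finset.mem_image_of_mem _ (Finset.mem_erase.2 ⟨hik, hi⟩)))
  set T' := (T ∩ J).erase k with hT'
  have hT'mem : ∀ i, i ∈ T' ↔ i ≠ k ∧ i ∈ T ∧ i ∈ J := by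
    intro i; simp [hT', Finset.mem_erase, Finset.mem_inter]
  have hkT' : k ∉ T' := fun h => ((hT'mem k).1 h).1 rfl
  have hDT' : ∀ i ∈ T, i ∈ J → ∀ a ∈ D i, γ.symm a ∈ T' := by
    intro i hiT hiJ a haD
    have h1 : a ∈ (T.erase k).image γ := by
      rw [hTeq]; exact Finset.mem_biUnion.2 ⟨i, hiT, haD⟩
    obtain ⟨i', hi', rfl⟩ := Finset.mem_image.1 h1
    obtain ⟨hiI, hiL⟩ := (hJmem i).1 hiJ
    have h2 : γ i' ∈ J.image γ := by
      rw [hJeq]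
      exact (hJσ _).2 ⟨((hD i hiI _).1 haD).1, hDL i hiI hiL _ haD⟩
    obtain ⟨i'', hi'', he⟩ := Finset.mem_image.1 h2
    have := γ.injective he
    subst this
    rw [γ.symm_apply_apply]
    exact (hT'mem _).2 ⟨Finset.ne_of_mem_erase hi', Finset.mem_of_mem_erase hi', hi''⟩
  have hT'I : ∀ i ∈ T', i ∈ I := fun i hi => ((hJmem i).1 ((hT'mem i).1 hi).2.2).1
  have hT'ss : T' ⊂ I := Finset.ssubset_iff_subset_ne.2 ⟨hT'I, fun h => hkT' (h ▸ hkI)⟩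
  have hT'ne : T'.Nonempty := by
    obtain ⟨j, hj, hjm⟩ := Finset.exists_max_image I (fun j => v k (t (σ j)) (σ j)) ⟨b0, hb0⟩
    exact ⟨_, hDT' k hkT hkJ (σ j) ((hD k hkI _).2 ⟨by rwa [σ.symm_apply_apply], hjm⟩)⟩
  have hEF' : ∀ i ∈ T', ∀ j ∈ T', v i (t (γ j)) (γ j) ≤ v i (t (γ i)) (γ i) := by
    intro i hi j hj
    have := hdem' i (hT'I i hi) ((hT'mem i).1 hi).1 _ (hσγ j (hT'I j hj))
    rwa [σ.apply_symm_apply] at this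
  obtain ⟨ρ', hρ', hcap, hstr⟩ : ∃ ρ' > (0:ℝ), (∀ a, a ∈ L q → t a + ρ' ≤ r a + ρ) ∧
      ∀ i a, v i (t a) a < v i (t (γ i)) (γ i) → v i (t a) a < v i (t (γ i) + ρ') (γ i) := by
    apply aux_exists_pos
    refine eventually_nhdsWithin_of_eventually_nhds (Eventually.and ?_ ?_)
    · rw [eventually_all]; intro a
      by_cases haL : a ∈ L q
      · have h1 := (hLmem q a).1 haL
        have h2 : s q ≤ ρ := by rw [← s0]; exact santi.antitone (Nat.zero_le _)
        have h3 : (0:ℝ) < r a + ρ - t a := by linarith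
        filter_upwards [gt_mem_nhds h3] with x hx _
        linarith
      · exact Eventually.of_forall fun x hx => absurd hx haL
    · rw [eventually_all]; intro i
      rw [eventually_all]; intro a
      by_cases h : v i (t a) a < v i (t (γ i)) (γ i)
      · have hcc : Continuous fun x => v i (t (γ i) + x) (γ i) :=
          (hc i (γ i)).comp (continuous_const.add continuous_id)
        have : v i (t a) a < v i (t (γ i) + 0) (γ i) := by rwa [add_zero]
        have := hcc.continuousAt.eventually (lt_mem_nhds this)
        filter_upwards [this] with x hx _ using hx
      · exact Eventually.of_forall fun x hx => absurd hx h
  obtain ⟨t', γ', h1, h2, h3, h4, h5, h6⟩ := IH T' hT'ss hT'ne γ t hEF' ρ' hρ'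
  have h2' : ∀ a, γ.symm a ∉ T' → t' a = t a := by
    intro a haT
    have := h2 _ haT
    rwa [γ.apply_symm_apply] at this
  have hmem : t' ∈ ⋃ γ, K γ := by
    refine Set.mem_iUnion.2 ⟨γ', ?_, ?_, ?_, ?_, ?_, ?_⟩
    · intro i hi
      rw [h1 i (fun h => hi (hT'I i h)), hγoff i hi]
    · intro a; exact (htr a).trans (h3 a)
    · intro a
      by_cases haT : γ.symm a ∈ T'
      · have : a ∈ J.image σ := by
          rw [← hJeq]
          exact Finset.mem_image.2 ⟨_, ((hT'mem _).1 haT).2.2, γ.apply_symm_apply a⟩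
        exact (h4 a).trans (hcap a ((hJσ a).1 this).2)
      · rw [h2' a haT]; exact htρ a
    · intro i hi
      rw [← htoff i hi, ← hγoff i hi]
      exact h2 i (fun h => hi (hT'I i h))
    · rw [← htb]
      exact h2' b hkT'
    · intro i hi hib j hj
      have hik : i ≠ k := by
        rintro rfl
        exact hib (by rw [h1 _ hkT', hγk])
      by_cases hiT : i ∈ T'
      · by_cases hjT : γ.symm (σ j) ∈ T'
        · have := h6 i hiT _ hjT
          rwa [γ.apply_symm_apply] at this
        · rw [h2' _ hjT]
          have hnD : σ j ∉ D i := fun h =>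
            hjT (hDT' i ((hT'mem i).1 hiT).2.1 ((hT'mem i).1 hiT).2.2 _ h)
          rw [hD i hi] at hnD
          push Not at hnD
          obtain ⟨l, hl, hl'⟩ := hnD (by rwa [σ.symm_apply_apply])
          have e1 := hdem' i hi hik l hl
          have e2 := hstr i (σ j) (lt_of_lt_of_le hl' e1)
          have e3 := ha' i (γ i) _ _ (h4 (γ i))
          have e4 := h6 i hiT i hiT
          linarith
      · rw [h1 i hiT, h2 i hiT]
        exact (ha' _ _ _ _ (h3 _)).trans (hdem' i hi hik j hj)
  have hle : ∑ a, t' a ≤ ∑ a, t a := htmax hmem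
  obtain ⟨a, haa⟩ := h5
  have : ∑ a, t a < ∑ a, t' a :=
    Finset.sum_lt_sum (fun a _ => h3 a) ⟨a, Finset.mem_univ a, haa⟩
  linarith

open Classical in
lemma aux_periodic_perm {ι : Type*} [Finite ι] (f : ι → ι) :
    ∃ γ : Equiv.Perm ι, ∀ i, γ i = if i ∈ Function.periodicPts f then f i else i := by
  have hb := Function.bijOn_periodicPts f
  have hinj : Function.Injective
      (fun i => if i ∈ Function.periodicPts f then f i else i) := by
    intro i j hij
    dsimp only at hij
    split_ifs at hij with h1 h2 h2
    · exact hb.injOn h1 h2 hij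
    · exact absurd (hij ▸ hb.mapsTo h1) h2
    · exact absurd (hij ▸ hb.mapsTo h2) h1
    · exact hij
  exact ⟨Equiv.ofBijective _ (Finite.injective_iff_bijective.1 hinj), fun i => rfl⟩

lemma aux_reach_periodic {ι : Type*} [Fintype ι] (f : ι → ι) (i : ι) :
    ∃ k, k ≤ Fintype.card ι ∧ f^[k] i ∈ Function.periodicPts f := by
  obtain ⟨a, b, hab, he⟩ := Fintype.exists_ne_map_eq_of_card_lt
    (fun k : Fin (Fintype.card ι + 1) => f^[k] i) (by simp)
  wlog hlt : a < b generalizing a b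
  · exact this b a hab.symm he.symm (lt_of_le_of_ne (not_lt.1 hlt) hab.symm)
  refine ⟨a, by omega, ?_⟩
  have hlt' : (a:ℕ) < b := hlt
  refine Function.mk_mem_periodicPts (n := b - a) (by omega) ?_
  show f^[b - a] (f^[a] i) = f^[a] i
  rw [← Function.iterate_add_apply, Nat.sub_add_cancel hlt'.le]
  exact he.symm

lemma aux_disc {ι : Type*} [Fintype ι] [Nonempty ι] (E : ι → ι → Prop) (w : ι → ι → ℝ)
    (hE : ∀ i, E i i) (hw : ∀ i, w i i = 0)
    (hperm : ∀ γ : Equiv.Perm ι, (∀ i, E i (γ i)) → ∑ i, w i (γ i) ≤ 0)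
    (W : ℝ) (hW : ∀ i j, w i j ≤ W) (β : ℝ) (hβ0 : 0 < β) (hβ1 : β < 1) :
    ∃ y : ι → ℝ, (∀ i, 0 ≤ y i) ∧ (∀ i, y i ≤ Fintype.card ι * W) ∧
      ∀ i j, E i j → w i j + β * y j ≤ y i := by
  classical
  have hW0 : 0 ≤ W := by
    have := hW (Classical.arbitrary ι) (Classical.arbitrary ι)
    rwa [hw] at this
  set B := W / (1 - β) with hB
  have hB0 : 0 ≤ B := div_nonneg hW0 (by linarith)
  have hBe : W + β * B = B := by
    have : (1 - β) ≠ 0 := by linarith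
    rw [hB]; field_simp; ring
  let K : Set (ι → ℝ) := {y | (∀ i, 0 ≤ y i) ∧ (∀ i, y i ≤ B) ∧
    ∀ i j, E i j → w i j + β * y j ≤ y i}
  have hKcl : IsClosed K := by
    refine aux_cl_and ?_ (aux_cl_and ?_ ?_)
    · exact aux_cl_all fun a => isClosed_le continuous_const (continuous_apply a)
    · exact aux_cl_all fun a => isClosed_le (continuous_apply a) continuous_const
    · exact aux_cl_all fun i => aux_cl_all fun j => aux_cl_all fun _ =>
        isClosed_le (by fun_prop) (by fun_prop)
  have hKco : IsCompact K := IsCompact.of_isClosed_subset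
    (isCompact_Icc (a := fun _ => 0) (b := fun _ => B)) hKcl fun y hy => ⟨hy.1, hy.2.1⟩
  have hKne : K.Nonempty := ⟨fun _ => B, fun _ => hB0, fun _ => le_rfl, fun i j _ => by
    dsimp only
    linarith [hW i j]⟩
  obtain ⟨y, hyK, hymin⟩ := hKco.exists_isMinOn hKne
    (f := fun y : ι → ℝ => ∑ a, y a) (by fun_prop)
  obtain ⟨hy0, hyB, hyE⟩ := hyK
  let N : ι → Finset ι := fun i => Finset.univ.filter (E i)
  have hN : ∀ i, (N i).Nonempty := fun i => ⟨i, by simp [N, hE]⟩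
  let F : ι → ℝ := fun i => (N i).sup' (hN i) (fun j => w i j + β * y j)
  have hFge : ∀ i j, E i j → w i j + β * y j ≤ F i := fun i j h =>
    Finset.le_sup' (fun j => w i j + β * y j) (by simp [N, h])
  have hFle : ∀ i, F i ≤ y i := fun i => Finset.sup'_le _ _ fun j hj =>
    hyE i j (by simpa [N] using hj)
  have hFK : F ∈ K := by
    refine ⟨fun i => ?_, fun i => (hFle i).trans (hyB i), fun i j h => ?_⟩
    · have := hFge i i (hE i)
      rw [hw] at this
      nlinarith [hy0 i]
    · have := hFge i j h
      have := mul_le_mul_of_nonneg_left (hFle j) hβ0.le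
      linarith
  have hFy : ∀ i, F i = y i := by
    by_contra hcon
    push Not at hcon
    obtain ⟨i, hi⟩ := hcon
    have h1 : ∑ a, F a < ∑ a, y a := Finset.sum_lt_sum (fun a _ => hFle a)
      ⟨i, Finset.mem_univ i, lt_of_le_of_ne (hFle i) hi⟩
    have h2 : ∑ a, y a ≤ ∑ a, F a := hymin hFK
    linarith
  have hpol : ∀ i, ∃ j, E i j ∧ y i = w i j + β * y j := by
    intro i
    obtain ⟨j, hj, he⟩ := Finset.exists_mem_eq_sup' (hN i) (fun j => w i j + β * y j)
    exact ⟨j, by simpa [N] using hj, by rw [← hFy i]; exact he⟩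
  choose f hfE hfy using hpol
  obtain ⟨γ, hγ⟩ := aux_periodic_perm f
  have hsum := hperm γ (fun i => by rw [hγ]; split_ifs; exacts [hfE i, hE i])
  have hterm : ∀ i, w i (γ i) = (if i ∈ Function.periodicPts f then y i else 0) -
      β * (if γ i ∈ Function.periodicPts f then y (γ i) else 0) := by
    intro i
    rw [hγ]
    by_cases h : i ∈ Function.periodicPts f
    · have h' : f i ∈ Function.periodicPts f := (Function.bijOn_periodicPts f).mapsTo h
      simp only [h, h', if_true]
      linarith [hfy i]
    · simp [h, hw]
  have hsum2 : ∑ i, w i (γ i) =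
      (1 - β) * ∑ i, (if i ∈ Function.periodicPts f then y i else 0) := by
    rw [Finset.sum_congr rfl fun i _ => hterm i, Finset.sum_sub_distrib, ← Finset.mul_sum,
      Equiv.sum_comp γ (fun i => if i ∈ Function.periodicPts f then y i else 0)]
    ring
  have hnn : ∀ i ∈ Finset.univ, 0 ≤ (if i ∈ Function.periodicPts f then y i else 0) := by
    intro i _; split_ifs; exacts [hy0 i, le_rfl]
  have hz : ∑ i, (if i ∈ Function.periodicPts f then y i else 0) = 0 := by
    have := Finset.sum_nonneg hnn
    rw [hsum2] at hsum
    nlinarith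
  have hper : ∀ i ∈ Function.periodicPts f, y i = 0 := by
    intro i hi
    have := (Finset.sum_eq_zero_iff_of_nonneg hnn).1 hz i (Finset.mem_univ i)
    simpa [hi] using this
  have hiter : ∀ k i, y i ≤ k * W + y (f^[k] i) := by
    intro k
    induction k with
    | zero => intro i; simp
    | succ k ih =>
      intro i
      have h1 := ih (f i)
      have h2 := hfy i
      rw [Function.iterate_succ_apply]
      push_cast
      have h3 : β * y (f i) ≤ y (f i) := by nlinarith [hy0 (f i)]
      linarith [hW i (f i)]
  refine ⟨y, hy0, fun i => ?_, hyE⟩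
  obtain ⟨k, hk, hkp⟩ := aux_reach_periodic f i
  have h1 := hiter k i
  rw [hper _ hkp] at h1
  have h2 : (k:ℝ) ≤ Fintype.card ι := by exact_mod_cast hk
  nlinarith

open Filter Topology in
lemma aux_pot {ι : Type*} [Fintype ι] [Nonempty ι] (E : ι → ι → Prop) (w : ι → ι → ℝ)
    (hE : ∀ i, E i i) (hw : ∀ i, w i i = 0)
    (hperm : ∀ γ : Equiv.Perm ι, (∀ i, E i (γ i)) → ∑ i, w i (γ i) ≤ 0) :
    ∃ y : ι → ℝ, ∀ i j, E i j → w i j + y j ≤ y i := by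
  obtain ⟨W, hW⟩ : ∃ W, ∀ i j, w i j ≤ W := by
    obtain ⟨W, hW⟩ := (Set.finite_range (fun p : ι × ι => w p.1 p.2)).bddAbove
    exact ⟨W, fun i j => hW ⟨(i, j), rfl⟩⟩
  have hβ : ∀ k : ℕ, 0 < 1 - 1 / ((k:ℝ) + 2) ∧ 1 - 1 / ((k:ℝ) + 2) < 1 := by
    intro k
    have h0 : (0:ℝ) ≤ k := Nat.cast_nonneg k
    have h1 : 1 / ((k:ℝ) + 2) < 1 := by rw [div_lt_one (by linarith)]; linarith
    have h2 : 0 < 1 / ((k:ℝ) + 2) := by positivity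
    constructor <;> linarith
  have := fun k : ℕ => aux_disc E w hE hw hperm W hW (1 - 1 / ((k:ℝ) + 2)) (hβ k).1 (hβ k).2
  choose y hy0 hyB hyE using this
  obtain ⟨z, _, φ, hφ, hz⟩ := (isCompact_Icc (a := fun _ : ι => (0:ℝ))
    (b := fun _ => Fintype.card ι * W)).tendsto_subseq (x := y) (fun k => ⟨hy0 k, hyB k⟩)
  have hlim : Tendsto (fun k : ℕ => 1 - 1 / ((k:ℝ) + 2)) atTop (𝓝 1) := by
    have h1 : Tendsto (fun k : ℕ => ((k:ℝ) + 2)) atTop atTop :=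
      tendsto_atTop_add_const_right _ _ tendsto_natCast_atTop_atTop
    have h2 := (tendsto_const_nhds (x := (1:ℝ))).sub (h1.const_div_atTop 1)
    simpa using h2
  have hlim' := hlim.comp hφ.tendsto_atTop
  refine ⟨z, fun i j hij => ?_⟩
  have hzi : ∀ i, Tendsto (fun k => y (φ k) i) atTop (𝓝 (z i)) :=
    fun i => (tendsto_pi_nhds.1 hz) i
  have h3 := (tendsto_const_nhds (x := w i j)).add (hlim'.mul (hzi j))
  rw [one_mul] at h3
  exact le_of_tendsto_of_tendsto' h3 (hzi i) fun k => hyE (φ k) i j hij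

lemma aux_converse (n : ℕ) (hn : 0 < n) (v : Fin n → ℝ → Fin n → ℝ)
    (ha : ∀ i a, StrictAnti fun p => v i p a) (m : ℝ) (r : Fin n → ℝ) (hsum : ∑ a, r a = m)
    (hEF : ∀ i j, v i (r j) j ≤ v i (r i) i)
    (hreach : ∀ i, ∃ k, (∀ j, v k (r k) k ≤ v j (r j) j) ∧
      Relation.ReflTransGen (fun i j => v i (r j) j = v i (r i) i) i k) :
    MaxminEF n v m r (Equiv.refl _) := by
  classical
  have : Nonempty (Fin n) := ⟨⟨0, hn⟩⟩
  refine ⟨hsum, fun i j => hEF i j, fun t γ ht hEFt => ?_⟩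
  by_contra hcon
  push Not at hcon
  simp only [Equiv.refl_apply] at hcon
  have hEFt' : ∀ i a, v i (t a) a ≤ v i (t (γ i)) (γ i) := by
    intro i a
    have := hEFt i (γ.symm a)
    rwa [γ.apply_symm_apply] at this
  let P : Finset (Fin n) := Finset.univ.filter fun i => v i (r i) i < v i (t (γ i)) (γ i)
  let A : Finset (Fin n) := Finset.univ.filter fun a => t a < r a
  have hP : ∀ i, i ∈ P ↔ v i (r i) i < v i (t (γ i)) (γ i) := by intro i; simp [P]
  have hA : ∀ i, i ∈ A ↔ t i < r i := by intro i; simp [A]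
  have hAP : A ⊆ P := by
    intro a haA
    rw [hA] at haA
    rw [hP]
    exact lt_of_lt_of_le (ha a a haA) (hEFt' a a)
  have hPA : P.image γ ⊆ A := by
    intro a haP
    obtain ⟨i, hi, rfl⟩ := Finset.mem_image.1 haP
    rw [hP] at hi
    rw [hA]
    by_contra h
    have h1 := (ha i (γ i)).antitone (not_lt.1 h)
    have h2 := hEF i (γ i)
    linarith
  have hcard := Finset.card_le_card hPA
  rw [Finset.card_image_of_injective _ γ.injective] at hcard
  have hAPe : A = P := Finset.eq_of_subset_of_card_le hAP hcard
  have hall : ∀ i, i ∈ P := by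
    intro i
    obtain ⟨k, hk, hik⟩ := hreach i
    induction hik using Relation.ReflTransGen.head_induction_on with
    | refl =>
      rw [hP]
      have h1 : v k (r k) k ≤ ⨅ i, v i (r i) i := le_ciInf hk
      have h2 : (⨅ i, v i (t (γ i)) (γ i)) ≤ v k (t (γ k)) (γ k) :=
        ciInf_le (Set.finite_range _).bddBelow k
      linarith
    | head hij htl ih =>
      rename_i i j
      rw [← hAPe, hA] at ih
      rw [hP, ← hij]
      exact lt_of_lt_of_le (ha i j ih) (hEFt' i j)
  have : ∑ a, t a < ∑ a, r a := by
    refine Finset.sum_lt_sum_of_nonempty Finset.univ_nonempty fun a _ => ?_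
    rw [← hA, hAPe]; exact hall a
  linarith

open Filter Topology in
lemma aux_local {ι : Type*} [Fintype ι] (v : ι → ℝ → ι → ℝ)
    (r : ι → ℝ) (lam : ι → ι → ℝ)
    (hlam : ∀ i a, ∃ ε > (0:ℝ), ∀ q ∈ Set.Icc (r a - ε) (r a),
      v i q a = v i (r a) a + lam i a * (r a - q)) (x : ι → ℝ) (hx : ∀ i, 0 ≤ x i) :
    ∀ᶠ s in 𝓝[≥] (0:ℝ), ∀ i j, v i (r j - s * x j) j = v i (r j) j + s * (lam i j * x j) := by
  rw [eventually_all]; intro i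
  rw [eventually_all]; intro j
  obtain ⟨ε, hε, h⟩ := hlam i j
  have hcc : Continuous fun s : ℝ => s * x j := by fun_prop
  have h1 : ∀ᶠ s in 𝓝 (0:ℝ), s * x j < ε :=
    hcc.continuousAt.eventually (gt_mem_nhds (by simpa using hε))
  filter_upwards [eventually_nhdsWithin_of_eventually_nhds h1, self_mem_nhdsWithin] with s hs hs0
  have hs0' : (0:ℝ) ≤ s := hs0
  have := mul_nonneg hs0' (hx j)
  rw [h _ ⟨by linarith, by linarith⟩]
  ring

open Filter Topology in
lemma aux_localEF {ι : Type*} [Fintype ι] (v : ι → ℝ → ι → ℝ)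
    (hc : ∀ i a, Continuous fun p => v i p a)
    (r : ι → ℝ) (lam : ι → ι → ℝ)
    (hlam : ∀ i a, ∃ ε > (0:ℝ), ∀ q ∈ Set.Icc (r a - ε) (r a),
      v i q a = v i (r a) a + lam i a * (r a - q)) (x : ι → ℝ) (hx : ∀ i, 0 ≤ x i)
    (hEF : ∀ i j, v i (r j) j ≤ v i (r i) i)
    (hxE : ∀ i j, v i (r j) j = v i (r i) i → lam i j * x j ≤ lam i i * x i) :
    ∀ᶠ s in 𝓝[≥] (0:ℝ), ∀ i j, v i (r j - s * x j) j ≤ v i (r i - s * x i) i := by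
  have hl := aux_local v r lam hlam x hx
  have : ∀ᶠ s in 𝓝[≥] (0:ℝ), ∀ i j, v i (r j) j < v i (r i) i →
      v i (r j - s * x j) j < v i (r i - s * x i) i := by
    refine eventually_nhdsWithin_of_eventually_nhds ?_
    rw [eventually_all]; intro i
    rw [eventually_all]; intro j
    by_cases h : v i (r j) j < v i (r i) i
    · have hcc : ∀ j, Continuous fun s : ℝ => v i (r j - s * x j) j :=
        fun j => (hc i j).comp (by fun_prop : Continuous fun s : ℝ => r j - s * x j)
      have := ((hcc j).continuousAt (x := 0)).eventually_lt ((hcc i).continuousAt (x := 0))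
        (by simpa using h)
      filter_upwards [this] with s hs _ using hs
    · exact Eventually.of_forall fun s hs => absurd hs h
  filter_upwards [hl, this, self_mem_nhdsWithin] with s h1 h2 h0 i j
  have h0' : (0:ℝ) ≤ s := h0
  rcases (hEF i j).lt_or_eq with h | h
  · exact (h2 i j h).le
  · rw [h1, h1, h]
    have := mul_le_mul_of_nonneg_left (hxE i j h) h0'
    linarith

open Filter Topology in
lemma aux_reach (n : ℕ) (hn : 0 < n) (v : Fin n → ℝ → Fin n → ℝ)
    (hc : ∀ i a, Continuous fun p => v i p a)
    (ha : ∀ i a, StrictAnti fun p => v i p a) (m : ℝ) (r : Fin n → ℝ)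
    (hmm : MaxminEF n v m r (Equiv.refl _)) (lam : Fin n → Fin n → ℝ)
    (hlam : ∀ i a, ∃ ε > (0:ℝ), ∀ q ∈ Set.Icc (r a - ε) (r a),
      v i q a = v i (r a) a + lam i a * (r a - q)) (x : Fin n → ℝ) (hx : ∀ i, 0 < x i)
    (hxE : ∀ i j, v i (r j) j = v i (r i) i → lam i j * x j ≤ lam i i * x i) :
    ∀ i, ∃ k, (∀ j, v k (r k) k ≤ v j (r j) j) ∧
      Relation.ReflTransGen (fun i j => v i (r j) j = v i (r i) i) i k := by
  classical
  have : Nonempty (Fin n) := ⟨⟨0, hn⟩⟩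
  obtain ⟨hsum, hEF0, hopt⟩ := hmm
  have hEF : ∀ i j, v i (r j) j ≤ v i (r i) i := fun i j => hEF0 i j
  have ha' : ∀ i a p q, p ≤ q → v i q a ≤ v i p a := fun i a p q h => (ha i a).antitone h
  by_contra hcon
  let Rch : Fin n → Prop := fun i => ∃ k, (∀ j, v k (r k) k ≤ v j (r j) j) ∧
      Relation.ReflTransGen (fun i j => v i (r j) j = v i (r i) i) i k
  let C : Finset (Fin n) := Finset.univ.filter fun i => ¬ Rch i
  have hC : ∀ i, i ∈ C ↔ ¬ Rch i := by intro i; simp [C]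
  have hCne : C.Nonempty := by
    push Not at hcon
    obtain ⟨i, hi⟩ := hcon
    refine ⟨i, (hC i).2 ?_⟩
    rintro ⟨k, hk, hk'⟩
    exact hi k hk hk'
  obtain ⟨k0, hk0⟩ := Finite.exists_min (fun j => v j (r j) j)
  have hk0C : k0 ∉ C := fun h => (hC k0).1 h ⟨k0, hk0, Relation.ReflTransGen.refl⟩
  have hCS : ∀ i ∈ C, ∀ j, j ∉ C → v i (r j) j < v i (r i) i := by
    intro i hi j hj
    refine lt_of_le_of_ne (hEF i j) fun h => ?_
    rw [hC] at hi hj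
    push Not at hj
    obtain ⟨k, hk, hk'⟩ := hj
    exact hi ⟨k, hk, Relation.ReflTransGen.head h hk'⟩
  have hCm : ∀ i ∈ C, v k0 (r k0) k0 < v i (r i) i := by
    intro i hi
    refine lt_of_le_of_ne (hk0 i) fun h => ?_
    exact (hC i).1 hi ⟨i, fun j => by rw [← h]; exact hk0 j, Relation.ReflTransGen.refl⟩
  let x' : Fin n → ℝ := fun i => if i ∈ C then 0 else x i
  have hx'0 : ∀ i, 0 ≤ x' i := by
    intro i; dsimp only [x']; split_ifs; exacts [le_rfl, (hx i).le]
  set X := ∑ i, x' i with hX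
  have hXpos : 0 < X := by
    refine Finset.sum_pos' (fun i _ => hx'0 i) ⟨k0, Finset.mem_univ _, ?_⟩
    simp only [x', hk0C, if_false]; exact hx k0
  have hloc := aux_localEF v hc r lam hlam x (fun i => (hx i).le) hEF hxE
  obtain ⟨s0, hs0, hs0EF⟩ := mem_nhdsGE_iff_exists_Icc_subset.1 hloc
  have hs0pos : (0:ℝ) < s0 := hs0
  obtain ⟨ρ, hρ, h1, h2, h3⟩ : ∃ ρ > (0:ℝ), (n * ρ / X < s0) ∧
      (∀ i j, v i (r j) j < v i (r i) i → v i (r j - (n * ρ / X) * x j) j < v i (r i + ρ) i) ∧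
      (∀ i, v k0 (r k0) k0 < v i (r i) i → v k0 (r k0) k0 < v i (r i + ρ) i) := by
    apply aux_exists_pos
    have hcc : ∀ i, Continuous fun ρ : ℝ => v i (r i + ρ) i :=
      fun i => (hc i i).comp (by fun_prop : Continuous fun ρ : ℝ => r i + ρ)
    refine eventually_nhdsWithin_of_eventually_nhds (Eventually.and ?_ (Eventually.and ?_ ?_))
    · have hq : Continuous fun ρ : ℝ => n * ρ / X := by fun_prop
      exact hq.continuousAt.eventually (gt_mem_nhds (by simpa using hs0pos))
    · rw [eventually_all]; intro i
      rw [eventually_all]; intro j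
      by_cases h : v i (r j) j < v i (r i) i
      · have hcj : Continuous fun ρ : ℝ => v i (r j - (n * ρ / X) * x j) j :=
          (hc i j).comp (by fun_prop : Continuous fun ρ : ℝ => r j - (n * ρ / X) * x j)
        have := (hcj.continuousAt (x := 0)).eventually_lt ((hcc i).continuousAt (x := 0))
          (by simpa using h)
        filter_upwards [this] with s hs _ using hs
      · exact Eventually.of_forall fun s hs => absurd hs h
    · rw [eventually_all]; intro i
      by_cases h : v k0 (r k0) k0 < v i (r i) i
      · have := (hcc i).continuousAt.eventually (lt_mem_nhds (a := v k0 (r k0) k0) (b := v i (r i + 0) i) (by simpa using h))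
        filter_upwards [this] with s hs _ using hs
      · exact Eventually.of_forall fun s hs => absurd hs h
  obtain ⟨t, γ, e1, e2, e3, e4, ⟨a0, e5⟩, e6⟩ := aux_raise v hc ha C hCne (Equiv.refl _) r
    (fun i _ j _ => hEF i j) ρ hρ
  simp only [Equiv.refl_apply] at e1 e2 e6
  set d := ∑ a, t a - ∑ a, r a with hd
  have hdpos : 0 < d := by
    have : ∑ a, r a < ∑ a, t a := Finset.sum_lt_sum (fun a _ => e3 a) ⟨a0, Finset.mem_univ _, e5⟩
    linarith
  have hdle : d ≤ n * ρ := by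
    have : ∑ a, t a ≤ ∑ a, (r a + ρ) := Finset.sum_le_sum fun a _ => e4 a
    rw [Finset.sum_add_distrib] at this
    simp at this
    linarith
  set s := d / X with hs
  have hspos : 0 < s := div_pos hdpos hXpos
  have hsle : s ≤ n * ρ / X := div_le_div_of_nonneg_right hdle hXpos.le
  have hsEF := hs0EF (show s ∈ Set.Icc 0 s0 from ⟨hspos.le, by linarith⟩)
  let T : Fin n → ℝ := fun a => t a - s * x' a
  have hTS : ∀ a, a ∉ C → T a = r a - s * x a := by
    intro a haC
    simp only [T, x', haC, if_false, e2 a haC]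
  have hTC : ∀ a, a ∈ C → T a = t a := by
    intro a haC
    simp [T, x', haC]
  have hγC : ∀ i, i ∈ C → γ i ∈ C := by
    intro i hi
    by_contra h
    have := γ.injective (e1 _ h)
    exact h (by rw [this]; exact hi)
  have hTsum : ∑ a, T a = m := by
    simp only [T]
    rw [Finset.sum_sub_distrib, ← Finset.mul_sum, ← hX, hs, div_mul_cancel₀ _ hXpos.ne']
    linarith
  have hCval : ∀ i ∈ C, v i (r i + ρ) i ≤ v i (T (γ i)) (γ i) := by
    intro i hi
    rw [hTC _ (hγC i hi)]
    exact (ha' _ _ _ _ (e4 i)).trans (e6 i hi i hi)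
  have hSval : ∀ i, i ∉ C → v i (r i) i < v i (T (γ i)) (γ i) := by
    intro i hi
    rw [e1 i hi, hTS i hi]
    apply ha i i
    have := mul_pos hspos (hx i)
    linarith
  have hTEF : ∀ i a, v i (T a) a ≤ v i (T (γ i)) (γ i) := by
    intro i a
    by_cases hi : i ∈ C
    · by_cases haC : a ∈ C
      · rw [hTC _ (hγC i hi), hTC a haC]
        exact e6 i hi a haC
      · refine le_trans ?_ (hCval i hi)
        rw [hTS a haC]
        refine le_trans ?_ (h2 i a (hCS i hi a haC)).le
        apply ha'
        have := mul_le_mul_of_nonneg_right hsle (hx a).le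
        linarith
    · by_cases haC : a ∈ C
      · rw [hTC a haC]
        exact ((ha' _ _ _ _ (e3 a)).trans (hEF i a)).trans (hSval i hi).le
      · rw [e1 i hi, hTS a haC, hTS i hi]
        exact hsEF i a
  have hle := hopt T γ hTsum (fun i j => hTEF i (γ j))
  simp only [Equiv.refl_apply] at hle
  obtain ⟨i, hi⟩ := exists_eq_ciInf_of_finite (f := fun i => v i (T (γ i)) (γ i))
  rw [← hi] at hle
  have hk : (⨅ i, v i (r i) i) ≤ v k0 (r k0) k0 :=
    ciInf_le (Set.finite_range _).bddBelow k0
  by_cases hiC : i ∈ C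
  · have := h3 i (hCm i hiC)
    have := hCval i hiC
    linarith
  · have := hSval i hiC
    have := hk0 i
    linarith

open Filter Topology in
lemma aux_tight {ι : Type*} [Fintype ι] (E : ι → ι → Prop) (M : ι → Prop) (lam : ι → ι → ℝ)
    (hlp : ∀ i j, 0 < lam i j) (x0 : ι → ℝ) (hx0 : ∀ i, 0 < x0 i)
    (hx0E : ∀ i j, E i j → lam i j * x0 j ≤ lam i i * x0 i)
    (hreach : ∀ i, ∃ k, M k ∧ Relation.ReflTransGen E i k) :
    ∃ x : ι → ℝ, (∀ i, 0 < x i) ∧ (∀ i j, E i j → lam i j * x j ≤ lam i i * x i) ∧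
      (∀ k, M k → 1 ≤ lam k k * x k) ∧
      ∀ i, ∃ k, M k ∧ lam k k * x k = 1 ∧
        Relation.ReflTransGen (fun i j => E i j ∧ lam i j * x j = lam i i * x i) i k := by
  classical
  obtain ⟨c, hc0, hc⟩ : ∃ c : ℝ, 0 < c ∧ ∀ k, 1 ≤ c * (lam k k * x0 k) := by
    obtain ⟨B, hB⟩ := (Set.finite_range (fun k => (lam k k * x0 k)⁻¹)).bddAbove
    refine ⟨max B 1, by positivity, fun k => ?_⟩
    have hp : 0 < lam k k * x0 k := mul_pos (hlp k k) (hx0 k)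
    have h1 : (lam k k * x0 k)⁻¹ ≤ max B 1 := (hB ⟨k, rfl⟩).trans (le_max_left _ _)
    rwa [inv_le_iff_one_le_mul₀ hp] at h1
  let K : Set (ι → ℝ) := {x | (∀ i, 0 ≤ x i) ∧ (∀ i, x i ≤ c * x0 i) ∧
    (∀ i j, E i j → lam i j * x j ≤ lam i i * x i) ∧ ∀ k, M k → 1 ≤ lam k k * x k}
  have hKcl : IsClosed K := by
    refine aux_cl_and ?_ (aux_cl_and ?_ (aux_cl_and ?_ ?_))
    · exact aux_cl_all fun a => isClosed_le continuous_const (continuous_apply a)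
    · exact aux_cl_all fun a => isClosed_le (continuous_apply a) continuous_const
    · exact aux_cl_all fun i => aux_cl_all fun j => aux_cl_all fun _ =>
        isClosed_le (by fun_prop) (by fun_prop)
    · exact aux_cl_all fun i => aux_cl_all fun _ =>
        isClosed_le (by fun_prop) (by fun_prop)
  have hKco : IsCompact K := IsCompact.of_isClosed_subset
    (isCompact_Icc (a := fun _ => 0) (b := fun i => c * x0 i)) hKcl fun y hy => ⟨hy.1, hy.2.1⟩
  have hKne : K.Nonempty := by
    refine ⟨fun i => c * x0 i, fun i => (mul_pos hc0 (hx0 i)).le, fun _ => le_rfl, ?_, ?_⟩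
    · intro i j h
      have := mul_le_mul_of_nonneg_left (hx0E i j h) hc0.le
      dsimp only
      linarith
    · intro k _
      have := hc k
      dsimp only
      linarith
  obtain ⟨x, ⟨hx0', hxB, hxE, hxM⟩, hmin⟩ := hKco.exists_isMinOn hKne
    (f := fun y : ι → ℝ => ∑ a, y a) (by fun_prop)
  have hxpos : ∀ i, 0 < x i := by
    intro i
    obtain ⟨k, hk, hik⟩ := hreach i
    induction hik using Relation.ReflTransGen.head_induction_on with
    | refl =>
      have h1 := hxM k hk
      exact pos_of_mul_pos_right (by linarith) (hlp k k).le
    | head hij htl ih =>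
      rename_i i j
      have h1 := hxE i j hij
      have h2 := mul_pos (hlp i j) ih
      exact pos_of_mul_pos_right (by linarith) (hlp i i).le
  refine ⟨x, hxpos, hxE, hxM, ?_⟩
  by_contra hcon
  let good : ι → Prop := fun i => ∃ k, M k ∧ lam k k * x k = 1 ∧
        Relation.ReflTransGen (fun i j => E i j ∧ lam i j * x j = lam i i * x i) i k
  have hbad : ∃ i, ¬ good i := by
    by_contra h; push Not at h; exact hcon h
  obtain ⟨i0, hi0⟩ := hbad
  have hslackE : ∀ i j, E i j → ¬ good i → good j → lam i j * x j < lam i i * x i := by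
    intro i j hij hi hj
    refine lt_of_le_of_ne (hxE i j hij) fun h => hi ?_
    obtain ⟨k, h1, h2, h3⟩ := hj
    exact ⟨k, h1, h2, Relation.ReflTransGen.head ⟨hij, h⟩ h3⟩
  have hslackM : ∀ k, M k → ¬ good k → 1 < lam k k * x k := by
    intro k hk hg
    refine lt_of_le_of_ne (hxM k hk) fun h => hg ⟨k, hk, h.symm, Relation.ReflTransGen.refl⟩
  obtain ⟨η, hη, hη1, h1, h2⟩ : ∃ η > (0:ℝ), η < 1 ∧
      (∀ i j, lam i j * x j < lam i i * x i → lam i j * x j < lam i i * ((1 - η) * x i)) ∧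
      (∀ k, 1 < lam k k * x k → 1 < lam k k * ((1 - η) * x k)) := by
    apply aux_exists_pos
    have hcc : ∀ i, Continuous fun η : ℝ => lam i i * ((1 - η) * x i) := fun i => by fun_prop
    refine eventually_nhdsWithin_of_eventually_nhds (Eventually.and ?_ (Eventually.and ?_ ?_))
    · exact gt_mem_nhds one_pos
    · rw [eventually_all]; intro i
      rw [eventually_all]; intro j
      by_cases h : lam i j * x j < lam i i * x i
      · have := (hcc i).continuousAt.eventually (lt_mem_nhds (a := lam i j * x j)
          (b := lam i i * ((1 - 0) * x i)) (by simpa using h))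
        filter_upwards [this] with s hs _ using hs
      · exact Eventually.of_forall fun s hs => absurd hs h
    · rw [eventually_all]; intro i
      by_cases h : 1 < lam i i * x i
      · have := (hcc i).continuousAt.eventually (lt_mem_nhds (a := 1)
          (b := lam i i * ((1 - 0) * x i)) (by simpa using h))
        filter_upwards [this] with s hs _ using hs
      · exact Eventually.of_forall fun s hs => absurd hs h
  let z : ι → ℝ := fun i => if good i then x i else (1 - η) * x i
  have hzg : ∀ i, good i → z i = x i := fun i h => by simp [z, h]
  have hzb : ∀ i, ¬ good i → z i = (1 - η) * x i := fun i h => by simp [z, h]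
  have hzle : ∀ i, z i ≤ x i := by
    intro i
    by_cases h : good i
    · rw [hzg i h]
    · rw [hzb i h]; nlinarith [hxpos i]
  have hzK : z ∈ K := by
    refine ⟨fun i => ?_, fun i => (hzle i).trans (hxB i), fun i j hij => ?_, fun k hk => ?_⟩
    · by_cases h : good i
      · rw [hzg i h]; exact hx0' i
      · rw [hzb i h]; exact mul_nonneg (by linarith) (hx0' i)
    · have hzj := mul_le_mul_of_nonneg_left (hzle j) (hlp i j).le
      by_cases hi : good i
      · rw [hzg i hi]
        exact hzj.trans (hxE i j hij)
      · by_cases hj : good j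
        · rw [hzb i hi, hzg j hj]
          exact (h1 i j (hslackE i j hij hi hj)).le
        · rw [hzb i hi, hzb j hj]
          have := mul_le_mul_of_nonneg_left (hxE i j hij) (by linarith : (0:ℝ) ≤ 1 - η)
          linarith
    · by_cases h : good k
      · rw [hzg k h]; exact hxM k hk
      · rw [hzb k h]; exact (h2 k (hslackM k hk h)).le
  have hlt : ∑ a, z a < ∑ a, x a := by
    refine Finset.sum_lt_sum (fun a _ => hzle a) ⟨i0, Finset.mem_univ _, ?_⟩
    rw [hzb i0 hi0]
    nlinarith [hxpos i0]
  have hle : ∑ a, x a ≤ ∑ a, z a := hmin hzK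
  linarith

open Filter Topology in
lemma aux_core (n : ℕ) (hn : 0 < n) (v : Fin n → ℝ → Fin n → ℝ)
    (hc : ∀ i a, Continuous fun p => v i p a)
    (ha : ∀ i a, StrictAnti fun p => v i p a) (m : ℝ) (r : Fin n → ℝ)
    (hmm : MaxminEF n v m r (Equiv.refl _)) (lam : Fin n → Fin n → ℝ)
    (hlam : ∀ i a, ∃ ε > (0:ℝ), ∀ q ∈ Set.Icc (r a - ε) (r a),
      v i q a = v i (r a) a + lam i a * (r a - q))
    (hmax : ∀ γ : Equiv.Perm (Fin n), (∀ i, v i (r (γ i)) (γ i) = v i (r i) i) →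
      ∑ i, Real.log (lam i (γ i)) ≤ ∑ i, Real.log (lam i i)) :
    ∃ ε > (0:ℝ), ∃ x : Fin n → ℝ, (∀ i, 0 < x i) ∧
      ∀ δ ∈ Set.Icc (0:ℝ) ε, MaxminEF n v (m - δ) (fun a => r a - δ * x a) (Equiv.refl _) := by
  classical
  have : Nonempty (Fin n) := ⟨⟨0, hn⟩⟩
  have hEF : ∀ i j, v i (r j) j ≤ v i (r i) i := fun i j => hmm.2.1 i j
  have hlp : ∀ i j, 0 < lam i j := by
    intro i j
    obtain ⟨ε, hε, h⟩ := hlam i j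
    have h1 := h (r j - ε) ⟨le_rfl, by linarith⟩
    have h2 := ha i j (show r j - ε < r j by linarith)
    dsimp only at h2
    have h3 : 0 < lam i j * ε := by
      have : r j - (r j - ε) = ε := by ring
      rw [this] at h1
      linarith
    exact pos_of_mul_pos_left h3 hε.le
  obtain ⟨y, hy⟩ := aux_pot (fun i j => v i (r j) j = v i (r i) i)
    (fun i j => Real.log (lam i j) - Real.log (lam i i)) (fun i => rfl) (fun i => sub_self _)
    (fun γ hγ => by
      rw [Finset.sum_sub_distrib]
      linarith [hmax γ hγ])
  have hexpE : ∀ i j, v i (r j) j = v i (r i) i →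
      lam i j * Real.exp (y j) ≤ lam i i * Real.exp (y i) := by
    intro i j hij
    have h1 := hy i j hij
    have h2 : Real.log (lam i j) + y j ≤ Real.log (lam i i) + y i := by linarith
    have h3 := Real.exp_le_exp.2 h2
    rwa [Real.exp_add, Real.exp_add, Real.exp_log (hlp _ _), Real.exp_log (hlp _ _)] at h3
  have hreach := aux_reach n hn v hc ha m r hmm lam hlam (fun i => Real.exp (y i))
    (fun i => Real.exp_pos _) hexpE
  obtain ⟨x, hxpos, hxE, hxM, hxt⟩ := aux_tight (fun i j => v i (r j) j = v i (r i) i)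
    (fun k => ∀ j, v k (r k) k ≤ v j (r j) j) lam hlp (fun i => Real.exp (y i))
    (fun i => Real.exp_pos _) hexpE hreach
  have hl := aux_local v r lam hlam x (fun i => (hxpos i).le)
  have hle := aux_localEF v hc r lam hlam x (fun i => (hxpos i).le) hEF hxE
  have hgap : ∀ᶠ s in 𝓝[≥] (0:ℝ), ∀ k i, v k (r k) k < v i (r i) i →
      v k (r k) k + s < v i (r i - s * x i) i := by
    refine eventually_nhdsWithin_of_eventually_nhds ?_
    rw [eventually_all]; intro k
    rw [eventually_all]; intro i
    by_cases h : v k (r k) k < v i (r i) i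
    · have hcc : Continuous fun s : ℝ => v i (r i - s * x i) i :=
        (hc i i).comp (by fun_prop : Continuous fun s : ℝ => r i - s * x i)
      have hc2 : Continuous fun s : ℝ => v k (r k) k + s := by fun_prop
      have := (hc2.continuousAt (x := 0)).eventually_lt (hcc.continuousAt (x := 0))
        (by simpa using h)
      filter_upwards [this] with s hs _ using hs
    · exact Eventually.of_forall fun s hs => absurd hs h
  obtain ⟨s0, hs0, hs⟩ := mem_nhdsGE_iff_exists_Icc_subset.1 (hl.and (hle.and hgap))
  have hs0pos : (0:ℝ) < s0 := hs0
  set X := ∑ i, x i with hX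
  have hXpos : 0 < X := Finset.sum_pos (fun i _ => hxpos i) Finset.univ_nonempty
  refine ⟨s0 * X, mul_pos hs0pos hXpos, fun i => x i / X, fun i => div_pos (hxpos i) hXpos, ?_⟩
  intro δ hδ
  set s := δ / X with hsd
  have hs1 : 0 ≤ s := div_nonneg hδ.1 hXpos.le
  have hs2 : s ≤ s0 := by rw [hsd, div_le_iff₀ hXpos]; exact hδ.2
  obtain ⟨g1, g2, g3⟩ := hs (show s ∈ Set.Icc 0 s0 from ⟨hs1, hs2⟩)
  have hre : (fun a => r a - δ * (x a / X)) = fun a => r a - s * x a := by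
    funext a; rw [hsd]; ring
  rw [hre]
  refine aux_converse n hn v ha (m - δ) _ ?_ (fun i j => g2 i j) ?_
  · rw [Finset.sum_sub_distrib, ← Finset.mul_sum, ← hX, hsd, div_mul_cancel₀ _ hXpos.ne', hmm.1]
  · intro i
    obtain ⟨k, hkM, hk1, hik⟩ := hxt i
    refine ⟨k, fun j => ?_, ?_⟩
    · rw [g1 k k, hk1, mul_one]
      rcases (hkM j).lt_or_eq with h | h
      · exact (g3 k j h).le
      · rw [g1 j j, h]
        have hjM : ∀ l, v j (r j) j ≤ v l (r l) l := fun l => by rw [← h]; exact hkM l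
        have := mul_le_mul_of_nonneg_left (hxM j hjM) hs1
        linarith
    · refine Relation.ReflTransGen.mono ?_ _ _ hik
      rintro a b ⟨hab, hab'⟩
      rw [g1, g1, hab, hab']

lemma aux_relabel (n : ℕ) (u : Fin n → ℝ → Fin n → ℝ) (μ : Equiv.Perm (Fin n)) (m : ℝ)
    (r : Fin n → ℝ) :
    MaxminEF n u m r μ ↔
      MaxminEF n (fun i q j => u i q (μ j)) m (fun j => r (μ j)) (Equiv.refl _) := by
  unfold MaxminEF EnvyFree
  simp only [Equiv.refl_apply, Equiv.sum_comp μ r]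
  refine and_congr_right fun _ => and_congr_right fun _ => ?_
  constructor
  · intro h t γ ht hEF
    have := h (fun a => t (μ.symm a)) (γ.trans μ)
      (by rw [Equiv.sum_comp μ.symm t]; exact ht) (by simpa using hEF)
    simpa using this
  · intro h t γ ht hEF
    have := h (fun a => t (μ a)) (γ.trans μ.symm)
      (by rw [Equiv.sum_comp μ t]; exact ht) (by simpa using hEF)
    simpa using this

/-- h-maxmin Perturbation Lemma: from a maxmin-utility envy-free
allocation `(r, σ)` for rent `m` with piece-wise linear preferences, and a
maximum-weight perfect matching `μ` in `F^u(r)`, there is `ε > 0` and a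
continuous path `δ ↦ r^δ` on `[0, ε]` of maxmin-utility envy-free price vectors
for rent `m - δ` with assignment `μ`, starting at `r`, along which every
agent's utility strictly increases and every room's price strictly falls. -/
theorem stmt_6 (n : ℕ) (hn : 0 < n) (u : Fin n → ℝ → Fin n → ℝ) (m : ℝ)
    (hcont : ∀ i a, Continuous fun p => u i p a)
    (hmono : ∀ i a, StrictAnti fun p => u i p a)
    (hpwl : ∀ i a p, ∃ ε > (0:ℝ), ∃ ν lamv : ℝ, 0 < lamv ∧
      ∀ q ∈ Set.Icc (p - ε) p, u i q a = ν - lamv * q)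
    (r : Fin n → ℝ) (σ : Equiv.Perm (Fin n))
    (hmaxmin : MaxminEF n u m r σ)
    (lam : Fin n → Fin n → ℝ)
    (hlam : ∀ i a, ∃ ε > (0:ℝ), ∀ q ∈ Set.Icc (r a - ε) (r a),
      u i q a = u i (r a) a + lam i a * (r a - q))
    (μ : Equiv.Perm (Fin n))
    (hμmatch : ∀ i, u i (r (μ i)) (μ i) = u i (r (σ i)) (σ i))
    (hμmax : ∀ γ : Equiv.Perm (Fin n),
      (∀ i, u i (r (γ i)) (γ i) = u i (r (σ i)) (σ i)) →
      ∑ i, Real.log (lam i (γ i)) ≤ ∑ i, Real.log (lam i (μ i))) :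
    ∃ ε > (0:ℝ), ∃ R : ℝ → Fin n → ℝ,
      ContinuousOn R (Set.Icc 0 ε) ∧ R 0 = r ∧
      (∀ δ ∈ Set.Icc (0:ℝ) ε, MaxminEF n u (m - δ) (R δ) μ) ∧
      ∀ δ η : ℝ, δ ∈ Set.Icc (0:ℝ) ε → η ∈ Set.Icc (0:ℝ) ε → δ < η →
        (∀ i, u i (R δ (μ i)) (μ i) < u i (R η (μ i)) (μ i)) ∧
        ∀ a, R η a < R δ a := by
  have hmμ : MaxminEF n u m r μ := by
    obtain ⟨h1, h2, h3⟩ := hmaxmin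
    refine ⟨h1, fun i j => ?_, fun t γ ht hEF => ?_⟩
    · rw [hμmatch i]
      have := h2 i (σ.symm (μ j))
      rwa [σ.apply_symm_apply] at this
    · simp only [hμmatch]
      exact h3 t γ ht hEF
  rw [aux_relabel] at hmμ
  obtain ⟨ε, hε, x, hx, hR⟩ := aux_core n hn (fun i q j => u i q (μ j)) (fun i a => hcont i (μ a))
    (fun i a => hmono i (μ a)) m (fun j => r (μ j)) hmμ (fun i j => lam i (μ j))
    (fun i a => hlam i (μ a)) (by
      intro γ hγ
      exact hμmax (γ.trans μ) (fun i => by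
        rw [← hμmatch i]; exact hγ i))
  refine ⟨ε, hε, fun δ a => r a - δ * x (μ.symm a), ?_, ?_, ?_, ?_⟩
  · exact Continuous.continuousOn (by fun_prop)
  · funext a; simp
  · intro δ hδ
    rw [aux_relabel]
    simpa using hR δ hδ
  · intro δ η _ _ hδη
    have hlt : ∀ a, r a - η * x (μ.symm a) < r a - δ * x (μ.symm a) := by
      intro a
      have := mul_lt_mul_of_pos_right hδη (hx (μ.symm a))
      linarith
    exact ⟨fun i => hmono i (μ i) (hlt (μ i)), hlt⟩
end

section
/- Let u ∈ B^N, (r, σ) a maxmin-utility envy-free allocation for rent m, μ a maximum-weight perfect matching in F^u(r), and define ε* = sup{ε > 0 : for all δ ∈ [0, ε] there exists r^δ with (r^δ, μ) maxmin-utility envy-free for rent m − δ}. Then ε* > 0; and if ε* < ∞ then the supremum is attained, and for the limiting allocation (r^{ε*}, μ), μ is not a maximum-weight perfect matching in F^u(r^{ε*}). -/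
/-- `μ'` is a maximum-weight perfect matching in the indifference graph
`F^u(s)` of the envy-free allocation `(s, μ)`, with weights `log λ_{ia}(u, s)`
where the local slope of `u_i` just below `s_a` is `1 + ρ_i` above budget and
`1` below. -/
def MaxWeightMatching (n : ℕ) (u : Fin n → ℝ → Fin n → ℝ) (b ρ : Fin n → ℝ)
    (s : Fin n → ℝ) (μ μ' : Equiv.Perm (Fin n)) : Prop :=
  (∀ i, u i (s (μ' i)) (μ' i) = u i (s (μ i)) (μ i)) ∧
    ∀ γ : Equiv.Perm (Fin n),
      (∀ i, u i (s (γ i)) (γ i) = u i (s (μ i)) (μ i)) →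
      (∑ i, Real.log (if b i < s (γ i) then 1 + ρ i else 1)) ≤
        ∑ i, Real.log (if b i < s (μ' i) then 1 + ρ i else 1)


open Filter Topology

def pw8 {ι : Type*} (c : ι → ι → ℝ) : List ι → ℝ
  | [] => 0
  | [_] => 0
  | a :: b :: l => c a b + pw8 c (b :: l)

lemma pw8_append {ι : Type*} (c : ι → ι → ℝ) (l1 : List ι) (a i : ι) (l2 : List ι) :
    pw8 c (a :: l1 ++ i :: l2) =
      pw8 c (a :: l1) + c ((a :: l1).getLast (by simp)) i + pw8 c (i :: l2) := by
  induction l1 generalizing a with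
  | nil => simp [pw8]
  | cons b l ih =>
    have := ih b
    simp only [List.cons_append, pw8] at this ⊢
    rw [this, List.getLast_cons (List.cons_ne_nil b l)]
    ring

lemma formPerm_sum8 {ι : Type*} [Fintype ι] [DecidableEq ι] (c : ι → ι → ℝ) (h0 : ∀ i, c i i = 0)
    (l : List ι) (a : ι) (hnd : (a :: l).Nodup) :
    ∑ i, c i ((a :: l).formPerm i) = pw8 c (a :: l) + c ((a :: l).getLast (by simp)) a := by
  induction l generalizing a with
  | nil => simp [pw8, h0]
  | cons b l ih =>
    have hnd' : (b :: l).Nodup := (List.nodup_cons.1 hnd).2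
    have ha : a ∉ b :: l := (List.nodup_cons.1 hnd).1
    have ih := ih b hnd'
    set F := (b :: l).formPerm with hF
    set z := (b :: l).getLast (by simp) with hz
    have hzm : z ∈ b :: l := List.getLast_mem _
    have hza : z ≠ a := fun h => ha (h ▸ hzm)
    have hab : a ≠ b := fun h => ha (by simp [h])
    have hFz : F z = b := List.formPerm_apply_getLast b l
    have hFa : F a = a := List.formPerm_apply_of_notMem ha
    have key : ∀ i, c i ((a :: b :: l).formPerm i) =
        c i (F i) + (if i = a then c a b else 0) + (if i = z then c z a - c z b else 0) := by
      intro i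
      rw [List.formPerm_cons_cons, Equiv.Perm.mul_apply, ← hF]
      by_cases h1 : i = a
      · subst h1
        simp [hFa, h0, hza.symm]
      · by_cases h2 : i = z
        · rw [h2, hFz]; simp [hza]
        · have e1 : F i ≠ a := fun h => h1 (F.injective (h.trans hFa.symm))
          have e2 : F i ≠ b := fun h => h2 (F.injective (h.trans hFz.symm))
          rw [Equiv.swap_apply_of_ne_of_ne e1 e2]; simp [h1, h2]
    rw [Finset.sum_congr rfl (fun i _ => key i), Finset.sum_add_distrib, Finset.sum_add_distrib, ih,
      List.getLast_cons (by simp)]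
    simp [pw8, ← hz]
    ring

lemma pot8 {ι : Type*} [Fintype ι] [DecidableEq ι] (c : ι → ι → ℝ) (h0 : ∀ i, c i i = 0)
    (hp : ∀ γ : Equiv.Perm ι, ∑ i, c i (γ i) ≤ 0) :
    ∃ y : ι → ℝ, ∀ i j, c i j + y j ≤ y i := by
  classical
  have hex : ∀ i : ι, ∃ l : List ι, (i :: l).Nodup ∧
      ∀ l' : List ι, (i :: l').Nodup → pw8 c (i :: l') ≤ pw8 c (i :: l) := by
    intro i
    obtain ⟨l, hl, hmax⟩ := Finset.exists_max_image
      (Finset.univ.filter (fun l : {l : List ι // l.Nodup} => (i :: l.1).Nodup))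
      (fun l => pw8 c (i :: l.1)) ⟨⟨[], by simp⟩, by simp⟩
    refine ⟨l.1, (Finset.mem_filter.1 hl).2, fun l' hl' => ?_⟩
    exact hmax ⟨l', (List.nodup_cons.1 hl').2⟩ (by simpa using hl')
  choose f hf hmax using hex
  refine ⟨fun i => pw8 c (i :: f i), fun i j => ?_⟩
  by_cases hi : i ∈ j :: f j
  · obtain ⟨s, t, hst⟩ := List.append_of_mem hi
    have hnd := hf j
    rw [hst] at hnd
    have hnd2 : (i :: t).Nodup := (List.nodup_append.1 hnd).2.1
    have h2 := hmax i t hnd2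
    cases s with
    | nil =>
      simp only [List.nil_append, List.cons.injEq] at hst
      obtain ⟨rfl, _⟩ := hst
      simp [h0]
    | cons k s =>
      have hk : k = j := by
        simp only [List.cons_append, List.cons.injEq] at hst; exact hst.1.symm
      subst hk
      have hnd3 : (i :: k :: s).Nodup := by
        have := List.nodup_middle.1 hnd
        rw [← List.cons_append] at this
        exact (List.nodup_append.1 this).1
      have e1 := formPerm_sum8 c h0 (k :: s) i hnd3
      have e2 := hp (i :: k :: s).formPerm
      rw [e1, List.getLast_cons (by simp)] at e2
      simp only [pw8] at e2
      simp only
      rw [hst, pw8_append]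
      linarith
  · have := hmax i (j :: f j) (List.nodup_cons.2 ⟨hi, hf j⟩)
    simpa [pw8] using this

lemma potT8 {ι : Type*} [Fintype ι] [DecidableEq ι] (T : ι → ι → Prop) (L : ι → ι → ℝ)
    (hT : ∀ i, T i i)
    (hp : ∀ γ : Equiv.Perm ι, (∀ i, T i (γ i)) → ∑ i, L i (γ i) ≤ ∑ i, L i i) :
    ∃ y : ι → ℝ, ∀ i j, T i j → L i j + y j ≤ L i i + y i := by
  classical
  set M : ℝ := ∑ i, ∑ j, |L i j - L i i| with hM
  have hle : ∀ i j, |L i j - L i i| ≤ ∑ j, |L i j - L i i| := fun i j =>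
    Finset.single_le_sum (f := fun j => |L i j - L i i|) (fun _ _ => abs_nonneg _) (Finset.mem_univ j)
  obtain ⟨y, hy⟩ := pot8 (fun i j => if T i j then L i j - L i i else -M)
    (fun i => by simp [hT]) (by
      intro γ
      by_cases h : ∀ i, T i (γ i)
      · have := hp γ h
        simp only [h, if_true, Finset.sum_sub_distrib]
        linarith
      · push Not at h
        obtain ⟨i0, hi0⟩ := h
        have hb : ∀ i, (if T i (γ i) then L i (γ i) - L i i else -M) ≤
            (∑ j, |L i j - L i i|) + (if i = i0 then -M else 0) := by
          intro i
          by_cases hi : i = i0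
          · subst hi
            simp only [hi0, if_false, if_true]
            have : 0 ≤ ∑ j, |L i j - L i i| := Finset.sum_nonneg (fun _ _ => abs_nonneg _)
            linarith
          · simp only [hi, if_false, add_zero]
            have h1 := hle i (γ i)
            have h3 : 0 ≤ M := Finset.sum_nonneg (fun _ _ => Finset.sum_nonneg (fun _ _ => abs_nonneg _))
            split_ifs
            · exact (le_abs_self _).trans h1
            · have := abs_nonneg (L i (γ i) - L i i)
              linarith
        refine (Finset.sum_le_sum (fun i _ => hb i)).trans ?_
        rw [Finset.sum_add_distrib, ← hM]
        simp)
  refine ⟨y, fun i j hij => ?_⟩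
  have := hy i j
  simp only [hij, if_true] at this
  linarith

lemma potM8 {n : ℕ} (T : Fin n → Fin n → Prop) (Λ : Fin n → Fin n → ℝ) (hΛ : ∀ i a, 0 < Λ i a)
    (μ : Equiv.Perm (Fin n)) (hT : ∀ i, T i (μ i))
    (hp : ∀ γ : Equiv.Perm (Fin n), (∀ i, T i (γ i)) →
      ∑ i, Real.log (Λ i (γ i)) ≤ ∑ i, Real.log (Λ i (μ i))) :
    ∃ x : Fin n → ℝ, (∀ a, 0 < x a) ∧ ∀ i a, T i a → Λ i a * x a ≤ Λ i (μ i) * x (μ i) := by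
  obtain ⟨y, hy⟩ := potT8 (fun i j => T i (μ j)) (fun i j => Real.log (Λ i (μ j))) hT
    (fun γ h => hp (γ.trans μ) h)
  refine ⟨fun a => Real.exp (y (μ.symm a)), fun a => Real.exp_pos _, fun i a hia => ?_⟩
  have := hy i (μ.symm a) (by simpa using hia)
  have := Real.exp_le_exp.2 this
  simpa [Real.exp_add, Real.exp_log (hΛ _ _)] using this
/-- slope just below -/
noncomputable def lm8 {n : ℕ} (b ρ : Fin n → ℝ) (i : Fin n) (p : ℝ) : ℝ := if b i < p then 1 + ρ i else 1
/-- slope just above -/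
noncomputable def lp8 {n : ℕ} (b ρ : Fin n → ℝ) (i : Fin n) (p : ℝ) : ℝ := if b i ≤ p then 1 + ρ i else 1

def Good8 (n : ℕ) (u : Fin n → ℝ → Fin n → ℝ) (b ρ : Fin n → ℝ) : Prop :=
  (∀ i, 0 ≤ ρ i) ∧ ∀ i, ∃ v : Fin n → ℝ, ∀ p a, u i p a = v a - p - ρ i * max 0 (p - b i)

noncomputable def mn8 (n : ℕ) (u : Fin n → ℝ → Fin n → ℝ) (r : Fin n → ℝ) (σ : Equiv.Perm (Fin n)) : ℝ :=
  ⨅ i, u i (r (σ i)) (σ i)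

def Reach8 (n : ℕ) (u : Fin n → ℝ → Fin n → ℝ) (r : Fin n → ℝ) (σ : Equiv.Perm (Fin n)) : Prop :=
  ∀ A : Set (Fin n), (∀ i, u i (r (σ i)) (σ i) = mn8 n u r σ → i ∈ A) →
    (∀ i j, j ∈ A → u i (r (σ j)) (σ j) = u i (r (σ i)) (σ i) → i ∈ A) → ∀ i, i ∈ A

section
variable {n : ℕ} {u : Fin n → ℝ → Fin n → ℝ} {b ρ : Fin n → ℝ}

lemma lm8_pos (h : Good8 n u b ρ) (i : Fin n) (p : ℝ) : 0 < lm8 b ρ i p := by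
  have := h.1 i
  unfold lm8; split_ifs <;> linarith

lemma lp8_pos (h : Good8 n u b ρ) (i : Fin n) (p : ℝ) : 0 < lp8 b ρ i p := by
  have := h.1 i
  unfold lp8; split_ifs <;> linarith

lemma anti8 (h : Good8 n u b ρ) (i a : Fin n) : StrictAnti (fun p => u i p a) := by
  intro p q hpq
  obtain ⟨v, hv⟩ := h.2 i
  simp only [hv]
  have h1 : max 0 (p - b i) ≤ max 0 (q - b i) := max_le_max le_rfl (by linarith)
  have := mul_le_mul_of_nonneg_left h1 (h.1 i)
  linarith

lemma ule8 (h : Good8 n u b ρ) {i a : Fin n} {p q : ℝ} : u i p a ≤ u i q a ↔ q ≤ p :=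
  (anti8 h i a).le_iff_ge

lemma ult8 (h : Good8 n u b ρ) {i a : Fin n} {p q : ℝ} : u i p a < u i q a ↔ q < p :=
  (anti8 h i a).lt_iff_gt

lemma cont8 (h : Good8 n u b ρ) (i a : Fin n) : Continuous (fun p => u i p a) := by
  obtain ⟨v, hv⟩ := h.2 i
  simp only [hv]
  fun_prop

lemma left8 (h : Good8 n u b ρ) (i a : Fin n) (p D : ℝ) (hD : 0 ≤ D) :
    ∀ᶠ t in 𝓝[>] (0:ℝ), u i (p - t * D) a = u i p a + t * (lm8 b ρ i p * D) := by
  obtain ⟨v, hv⟩ := h.2 i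
  simp only [hv, lm8]
  by_cases hb : b i < p
  · have h1 : ∀ᶠ t in 𝓝[>] (0:ℝ), b i < p - t * D := by
      have : Tendsto (fun t : ℝ => p - t * D) (𝓝[>] 0) (𝓝 (p - 0 * D)) :=
        (Continuous.tendsto (by fun_prop) 0).mono_left nhdsWithin_le_nhds
      exact this.eventually (lt_mem_nhds (by simpa using hb))
    filter_upwards [h1] with t ht
    rw [max_eq_right (by linarith), max_eq_right (by linarith), if_pos hb]
    ring
  · filter_upwards [self_mem_nhdsWithin] with t ht
    have : 0 ≤ t * D := mul_nonneg (le_of_lt ht) hD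
    rw [max_eq_left (by linarith), max_eq_left (by linarith), if_neg hb]
    ring

lemma right8 (h : Good8 n u b ρ) (i a : Fin n) (p D : ℝ) (hD : 0 ≤ D) :
    ∀ᶠ t in 𝓝[>] (0:ℝ), u i (p + t * D) a = u i p a - t * (lp8 b ρ i p * D) := by
  obtain ⟨v, hv⟩ := h.2 i
  simp only [hv, lp8]
  by_cases hb : b i ≤ p
  · filter_upwards [self_mem_nhdsWithin] with t ht
    have : 0 ≤ t * D := mul_nonneg (le_of_lt ht) hD
    rw [max_eq_right (by linarith), max_eq_right (by linarith), if_pos hb]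
    ring
  · have h1 : ∀ᶠ t in 𝓝[>] (0:ℝ), p + t * D < b i := by
      have : Tendsto (fun t : ℝ => p + t * D) (𝓝[>] 0) (𝓝 (p + 0 * D)) :=
        (Continuous.tendsto (by fun_prop) 0).mono_left nhdsWithin_le_nhds
      exact this.eventually (gt_mem_nhds (by simpa using hb))
    filter_upwards [h1] with t ht
    rw [max_eq_left (by linarith), max_eq_left (by linarith), if_neg hb]
    ring

/-- strict preferences persist along linear price paths -/
lemma pert8 (h : Good8 n u b ρ) (i a j c : Fin n) (p q D E : ℝ) (hlt : u i p a < u j q c) :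
    ∀ᶠ t in 𝓝[>] (0:ℝ), u i (p + t * D) a < u j (q + t * E) c := by
  have h1 : Tendsto (fun t : ℝ => u i (p + t * D) a) (𝓝[>] 0) (𝓝 (u i (p + 0 * D) a)) :=
    (((cont8 h i a).comp (by fun_prop : Continuous (fun t : ℝ => p + t * D))).tendsto 0).mono_left
      nhdsWithin_le_nhds
  have h2 : Tendsto (fun t : ℝ => u j (q + t * E) c) (𝓝[>] 0) (𝓝 (u j (q + 0 * E) c)) :=
    (((cont8 h j c).comp (by fun_prop : Continuous (fun t : ℝ => q + t * E))).tendsto 0).mono_left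
      nhdsWithin_le_nhds
  exact h1.eventually_lt h2 (by simpa using hlt)

lemma mn8_le (r : Fin n → ℝ) (σ : Equiv.Perm (Fin n)) (i : Fin n) :
    mn8 n u r σ ≤ u i (r (σ i)) (σ i) :=
  ciInf_le (Set.finite_range _).bddBelow i

lemma mn8_att (hn : 0 < n) (r : Fin n → ℝ) (σ : Equiv.Perm (Fin n)) :
    ∃ i, u i (r (σ i)) (σ i) = mn8 n u r σ := by
  have : Nonempty (Fin n) := ⟨⟨0, hn⟩⟩
  exact exists_eq_ciInf_of_finite

lemma ef8 {r : Fin n → ℝ} {σ : Equiv.Perm (Fin n)} (h : EnvyFree n u r σ) (i a : Fin n) :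
    u i (r a) a ≤ u i (r (σ i)) (σ i) := by
  simpa using h i (σ.symm a)

lemma cmp8 (h : Good8 n u b ρ) {r t : Fin n → ℝ} {σ γ : Equiv.Perm (Fin n)}
    (hr : EnvyFree n u r σ) (hR : Reach8 n u r σ) (ht : EnvyFree n u t γ)
    (hm : mn8 n u r σ ≤ mn8 n u t γ) : ∀ a, t a ≤ r a := by
  have hmaps : ∀ j, t (σ j) ≤ r (σ j) → t (γ j) ≤ r (γ j) := fun j hj => by
    rw [← ule8 h (i := j) (a := γ j)]
    exact (ef8 hr j _).trans (((ule8 h).2 hj).trans (ef8 ht j _))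
  have hback : ∀ j, t (γ j) ≤ r (γ j) → t (σ j) ≤ r (σ j) := by
    have e : (Finset.univ.filter (fun j => t (σ j) ≤ r (σ j))) =
        Finset.univ.filter (fun j => t (γ j) ≤ r (γ j)) := by
      apply Finset.eq_of_subset_of_card_le
      · intro j; simpa using hmaps j
      · have c1 : ∀ π : Equiv.Perm (Fin n), (Finset.univ.filter (fun j => t (π j) ≤ r (π j))).card =
            (Finset.univ.filter (fun a => t a ≤ r a)).card := by
          intro π
          apply Finset.card_bij (fun j _ => π j)
          · intro j hj; simpa using hj
          · intro j _ k _ hjk; exact π.injective hjk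
          · intro a ha; exact ⟨π.symm a, by simpa using ha, by simp⟩
        rw [c1, c1]
    intro j hj
    have : j ∈ Finset.univ.filter (fun j => t (σ j) ≤ r (σ j)) := by rw [e]; simpa using hj
    simpa using this
  have key := hR {j | t (σ j) ≤ r (σ j)} (by
      intro i hi
      apply hback
      rw [← ule8 h (i := i) (a := γ i)]
      calc _ ≤ _ := ef8 hr i _
        _ = _ := hi
        _ ≤ _ := hm
        _ ≤ _ := mn8_le t γ i) (by
      intro i j hj hij
      apply hback
      rw [← ule8 h (i := i) (a := γ i)]
      calc _ ≤ _ := ef8 hr i _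
        _ = _ := hij.symm
        _ ≤ u i (t (σ j)) (σ j) := (ule8 h).2 hj
        _ ≤ _ := ef8 ht i _)
  intro a
  simpa using key (σ.symm a)

lemma eq8 {r t : Fin n → ℝ} (h : ∀ a, t a ≤ r a) (hs : ∑ a, t a = ∑ a, r a) : t = r := by
  funext a
  exact (Finset.sum_eq_sum_iff_of_le (fun a _ => h a)).1 hs a (Finset.mem_univ a)

lemma maxmin_of_reach8 (hn : 0 < n) (h : Good8 n u b ρ) {m : ℝ} {r : Fin n → ℝ}
    {σ : Equiv.Perm (Fin n)} (hs : ∑ a, r a = m) (hr : EnvyFree n u r σ) (hR : Reach8 n u r σ) :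
    MaxminEF n u m r σ := by
  refine ⟨hs, hr, fun t γ hts ht => ?_⟩
  change mn8 n u t γ ≤ mn8 n u r σ
  by_contra hcon
  push Not at hcon
  have := eq8 (cmp8 h hr hR ht hcon.le) (hts.trans hs.symm)
  subst this
  obtain ⟨i, hi⟩ := mn8_att (u := u) hn t σ
  have := mn8_le (u := u) t γ i
  have := ef8 hr i (γ i)
  linarith

lemma reach_of_maxmin8 (hn : 0 < n) (h : Good8 n u b ρ) {m : ℝ} {r : Fin n → ℝ}
    {σ : Equiv.Perm (Fin n)} (hM : MaxminEF n u m r σ) : Reach8 n u r σ := by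
  classical
  obtain ⟨hs, hr, hmax⟩ := hM
  intro A hA hcl
  by_contra! hcon
  obtain ⟨i0, hi0⟩ := hcon
  obtain ⟨k0, hk0⟩ := mn8_att (u := u) hn r σ
  have hk0A := hA k0 hk0
  set B : Fin n → Prop := fun a => σ.symm a ∈ A with hB
  set Λ : Fin n → Fin n → ℝ := fun i a => if B a then lm8 b ρ i (r a) else (lp8 b ρ i (r a))⁻¹ with hΛ
  have hΛpos : ∀ i a, 0 < Λ i a := by
    intro i a
    simp only [hΛ]
    split_ifs
    · exact lm8_pos h _ _
    · exact inv_pos.2 (lp8_pos h _ _)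
  set T : Fin n → Fin n → Prop :=
    fun i a => u i (r a) a = u i (r (σ i)) (σ i) ∧ (i ∈ A ↔ B a) with hT
  obtain ⟨μ, hμT, hμmax⟩ := Finset.exists_max_image
    (Finset.univ.filter (fun γ : Equiv.Perm (Fin n) => ∀ i, T i (γ i)))
    (fun γ => ∑ i, Real.log (Λ i (γ i))) ⟨σ, by simp [hT, hB]⟩
  have hμT : ∀ i, T i (μ i) := (Finset.mem_filter.1 hμT).2
  obtain ⟨x, hx, hxT⟩ := potM8 T Λ hΛpos μ hμT (fun γ hγ => hμmax γ (by simpa using hγ))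
  set SA : ℝ := ∑ a, if B a then x a else 0 with hSA
  set SB : ℝ := ∑ a, if B a then 0 else (x a)⁻¹ with hSB
  have hSApos : 0 < SA := by
    refine Finset.sum_pos' (fun a _ => ?_) ⟨σ k0, Finset.mem_univ _, ?_⟩
    · split_ifs
      · exact (hx a).le
      · exact le_rfl
    · simp [hB, hk0A, hx]
  have hSBpos : 0 < SB := by
    refine Finset.sum_pos' (fun a _ => ?_) ⟨σ i0, Finset.mem_univ _, ?_⟩
    · split_ifs
      · exact le_rfl
      · exact (inv_pos.2 (hx a)).le
    · simp [hB, hi0, hx]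
  set E : Fin n → ℝ := fun a => (x a)⁻¹ * (SA / SB) with hE
  have hEpos : ∀ a, 0 < E a := fun a => mul_pos (inv_pos.2 (hx a)) (div_pos hSApos hSBpos)
  set V : Fin n → ℝ := fun a => if B a then - x a else E a with hV
  have hVsum : ∑ a, V a = 0 := by
    have : ∀ a, V a = -(if B a then x a else 0) + (if B a then 0 else (x a)⁻¹) * (SA / SB) := by
      intro a
      simp only [hV, hE]
      split_ifs <;> simp
    rw [Finset.sum_congr rfl (fun a _ => this a), Finset.sum_add_distrib, ← Finset.sum_mul,
      Finset.sum_neg_distrib, ← hSA, ← hSB]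
    field_simp
    ring
  have ev1 : ∀ᶠ t in 𝓝[>] (0:ℝ), ∀ i a, u i (r a - t * x a) a =
      u i (r a) a + t * (lm8 b ρ i (r a) * x a) :=
    eventually_all.2 fun i => eventually_all.2 fun a => left8 h i a _ _ (hx a).le
  have ev2 : ∀ᶠ t in 𝓝[>] (0:ℝ), ∀ i a, u i (r a + t * E a) a =
      u i (r a) a - t * (lp8 b ρ i (r a) * E a) :=
    eventually_all.2 fun i => eventually_all.2 fun a => right8 h i a _ _ (hEpos a).le
  have ev3 : ∀ᶠ t in 𝓝[>] (0:ℝ), ∀ i j a c, u i (r a) a < u j (r c) c →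
      u i (r a + t * V a) a < u j (r c + t * V c) c :=
    eventually_all.2 fun i => eventually_all.2 fun j => eventually_all.2 fun a =>
      eventually_all.2 fun c => eventually_imp_distrib_left.2 (pert8 h i a j c _ _ _ _)
  have ev4 : ∀ᶠ t in 𝓝[>] (0:ℝ), ∀ i a, mn8 n u r σ < u i (r a) a →
      mn8 n u r σ < u i (r a + t * V a) a := by
    refine eventually_all.2 fun i => eventually_all.2 fun a => eventually_imp_distrib_left.2 fun hlt => ?_
    rw [← hk0] at hlt ⊢
    simpa using pert8 h k0 (σ k0) i a (r (σ k0)) (r a) 0 (V a) hlt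
  obtain ⟨t, ht1, ht2, ht3, ht4, ht0⟩ :=
    (ev1.and (ev2.and (ev3.and (ev4.and self_mem_nhdsWithin)))).exists
  have ht0 : 0 < t := ht0
  set p : Fin n → ℝ := fun a => r a + t * V a with hp
  have hpB : ∀ a i, B a → u i (p a) a = u i (r a) a + t * (lm8 b ρ i (r a) * x a) := by
    intro a i ha
    rw [← ht1]
    simp only [hp, hV, ha, if_true]
    congr 1; ring
  have hpN : ∀ a i, ¬ B a → u i (p a) a = u i (r a) a - t * (lp8 b ρ i (r a) * E a) := by
    intro a i ha
    rw [← ht2]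
    simp only [hp, hV, ha, if_false]
  have hpsum : ∑ a, p a = m := by
    simp only [hp]
    rw [Finset.sum_add_distrib, ← Finset.mul_sum, hVsum, hs]; ring
  have hEF : EnvyFree n u p μ := by
    suffices H : ∀ i a, u i (p a) a ≤ u i (p (μ i)) (μ i) from fun i j => H i (μ j)
    intro i a
    have hti := (hμT i).1
    by_cases htight : u i (r a) a = u i (r (σ i)) (σ i)
    · by_cases hiA : i ∈ A
      · have hBi : B (μ i) := (hμT i).2.1 hiA
        rw [hpB (μ i) i hBi]
        have hpos := mul_pos ht0 (mul_pos (lm8_pos h i (r (μ i))) (hx (μ i)))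
        by_cases ha : B a
        · rw [hpB a i ha]
          have := hxT i a ⟨htight, by simp [hiA, ha]⟩
          simp only [hΛ, ha, hBi, if_true] at this
          have := mul_le_mul_of_nonneg_left this ht0.le
          linarith
        · rw [hpN a i ha]
          have := mul_pos ht0 (mul_pos (lp8_pos h i (r a)) (hEpos a))
          linarith
      · have hBi : ¬ B (μ i) := fun hh => hiA ((hμT i).2.2 hh)
        have ha : ¬ B a := fun hh => hiA (hcl i (σ.symm a) hh (by simpa using htight))
        rw [hpN (μ i) i hBi, hpN a i ha]
        have := hxT i a ⟨htight, by simp [hiA, ha]⟩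
        simp only [hΛ, ha, hBi, if_false] at this
        have h3 := inv_anti₀ (mul_pos (inv_pos.2 (lp8_pos h i (r a))) (hx a)) this
        rw [mul_inv, mul_inv, inv_inv, inv_inv] at h3
        have h4 := mul_le_mul_of_nonneg_left (mul_le_mul_of_nonneg_right h3
          (div_pos hSApos hSBpos).le) ht0.le
        simp only [hE]
        rw [← mul_assoc, ← mul_assoc] at *
        linarith
    · refine (ht3 i i a (μ i) ?_).le
      rw [hti]
      exact lt_of_le_of_ne (ef8 hr i a) htight
  have hfin : mn8 n u p μ ≤ mn8 n u r σ := hmax p μ hpsum hEF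
  obtain ⟨i, hi⟩ := mn8_att (u := u) hn p μ
  rw [← hi] at hfin
  by_cases hiA : i ∈ A
  · rw [hpB (μ i) i ((hμT i).2.1 hiA), (hμT i).1] at hfin
    have hpos := mul_pos ht0 (mul_pos (lm8_pos h i (r (μ i))) (hx (μ i)))
    have := mn8_le (u := u) r σ i
    linarith
  · have h1 : mn8 n u r σ < u i (r (μ i)) (μ i) := by
      rw [(hμT i).1]
      exact lt_of_le_of_ne (mn8_le r σ i) (fun hh => hiA (hA i hh.symm))
    exact absurd (ht4 i (μ i) h1) (not_lt.2 hfin)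
end

section
variable {n : ℕ} {u : Fin n → ℝ → Fin n → ℝ} {b ρ : Fin n → ℝ}

lemma switch8 {m : ℝ} {r : Fin n → ℝ} {σ μ : Equiv.Perm (Fin n)} (hM : MaxminEF n u m r σ)
    (hμ : ∀ i, u i (r (μ i)) (μ i) = u i (r (σ i)) (σ i)) : MaxminEF n u m r μ := by
  obtain ⟨hs, hr, hmax⟩ := hM
  refine ⟨hs, fun i j => ?_, fun t γ h1 h2 => ?_⟩
  · rw [hμ i]; exact ef8 hr i _
  · simp only [hμ]; exact hmax t γ h1 h2

lemma step8 (hn : 0 < n) (h : Good8 n u b ρ) {m : ℝ} {r : Fin n → ℝ}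
    {σ μ : Equiv.Perm (Fin n)} (hM0 : MaxminEF n u m r σ) (hW : MaxWeightMatching n u b ρ r σ μ) :
    ∃ ε > (0:ℝ), ∀ δ ∈ Set.Icc (0:ℝ) ε, ∃ rδ : Fin n → ℝ, MaxminEF n u (m - δ) rδ μ := by
  classical
  have hM := switch8 hM0 hW.1
  have hR := reach_of_maxmin8 hn h hM
  have hs := hM.1
  have hr := hM.2.1
  set Λ : Fin n → Fin n → ℝ := fun i a => lm8 b ρ i (r a) with hΛ
  have hΛpos : ∀ i a, 0 < Λ i a := fun i a => lm8_pos h _ _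
  set T : Fin n → Fin n → Prop := fun i a => u i (r a) a = u i (r (μ i)) (μ i) with hT
  obtain ⟨x, hx, hxT⟩ := potM8 T Λ hΛpos μ (fun i => rfl) (fun γ hγ =>
    hW.2 γ (fun i => (hγ i).trans (hW.1 i)))
  set c := mn8 n u r μ with hc
  set s : ℝ := ∑ i, (Λ i (μ i) * x (μ i))⁻¹ with hsdef
  have hsle : ∀ i, (Λ i (μ i) * x (μ i))⁻¹ ≤ s := fun i =>
    Finset.single_le_sum (f := fun i => (Λ i (μ i) * x (μ i))⁻¹)
      (fun i _ => (inv_pos.2 (mul_pos (hΛpos _ _) (hx _))).le) (Finset.mem_univ i)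
  have hs0 : 0 ≤ s := Finset.sum_nonneg
    (fun i _ => (inv_pos.2 (mul_pos (hΛpos _ _) (hx _))).le)
  set F : Set (Fin n → ℝ) := {D | (∀ i a, T i a → Λ i a * D a ≤ Λ i (μ i) * D (μ i)) ∧
    ∀ i, u i (r (μ i)) (μ i) = c → 1 ≤ Λ i (μ i) * D (μ i)} with hF
  have hFcl : IsClosed F := by
    have e : F = (⋂ i, ⋂ a, ⋂ (_ : T i a), {D : Fin n → ℝ | Λ i a * D a ≤ Λ i (μ i) * D (μ i)}) ∩
      ⋂ i, ⋂ (_ : u i (r (μ i)) (μ i) = c), {D : Fin n → ℝ | 1 ≤ Λ i (μ i) * D (μ i)} := by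
      ext D; simp [hF]
    rw [e]
    refine IsClosed.inter ?_ ?_
    · exact isClosed_iInter fun i => isClosed_iInter fun a => isClosed_iInter fun _ =>
        isClosed_le (by fun_prop) (by fun_prop)
    · exact isClosed_iInter fun i => isClosed_iInter fun _ =>
        isClosed_le (by fun_prop) (by fun_prop)
  have hsx : (fun a => s * x a) ∈ F := by
    refine ⟨fun i a hia => ?_, fun i _ => ?_⟩
    · have := mul_le_mul_of_nonneg_left (hxT i a hia) hs0
      linarith
    · have hp := mul_pos (hΛpos i (μ i)) (hx (μ i))
      have := mul_le_mul_of_nonneg_right (hsle i) hp.le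
      rw [inv_mul_cancel₀ hp.ne'] at this
      linarith
  obtain ⟨D, ⟨hDF, hDI⟩, hDmin⟩ := (IsCompact.inter_left
      (isCompact_Icc (a := (0 : Fin n → ℝ)) (b := fun a => s * x a)) hFcl).exists_isMinOn
    ⟨fun a => s * x a, hsx, ⟨fun a => mul_nonneg hs0 (hx a).le, le_rfl⟩⟩
    (f := fun D : Fin n → ℝ => ∑ a, D a) (by fun_prop)
  have hD0 : ∀ a, 0 ≤ D a := fun a => hDI.1 a
  have hDpos : ∀ a, 0 < D a := by
    have := hR {i | 0 < D (μ i)} (fun i hi => by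
        have := hDF.2 i hi
        exact pos_of_mul_pos_right (lt_of_lt_of_le one_pos this) (hΛpos _ _).le) (fun i j hj hij => by
        have h1 := hDF.1 i (μ j) hij
        have h2 := mul_pos (hΛpos i (μ j)) hj
        exact pos_of_mul_pos_right (lt_of_lt_of_le h2 h1) (hΛpos _ _).le)
    intro a
    simpa using this (μ.symm a)
  -- minimality in set form
  have hDA : ∀ A : Set (Fin n),
      (∀ i, u i (r (μ i)) (μ i) = c → Λ i (μ i) * D (μ i) = 1 → i ∈ A) →
      (∀ i j, j ∈ A → T i (μ j) → Λ i (μ j) * D (μ j) = Λ i (μ i) * D (μ i) → i ∈ A) →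
      ∀ i, i ∈ A := by
    intro A hA1 hA2
    by_contra! hcon
    obtain ⟨i0, hi0⟩ := hcon
    have evt : ∀ x y : ℝ, x < y → ∀ᶠ t in 𝓝[>] (0:ℝ), x ≤ (1 - t) * y := by
      intro x y hxy
      have : Tendsto (fun t : ℝ => (1 - t) * y) (𝓝[>] 0) (𝓝 ((1 - 0) * y)) :=
        (Continuous.tendsto (by fun_prop) 0).mono_left nhdsWithin_le_nhds
      exact (this.eventually (lt_mem_nhds (by simpa using hxy))).mono fun _ => le_of_lt
    have ev1 : ∀ᶠ t in 𝓝[>] (0:ℝ), ∀ i, 1 < Λ i (μ i) * D (μ i) →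
        1 ≤ (1 - t) * (Λ i (μ i) * D (μ i)) :=
      eventually_all.2 fun i => eventually_imp_distrib_left.2 (evt _ _)
    have ev2 : ∀ᶠ t in 𝓝[>] (0:ℝ), ∀ i a, Λ i a * D a < Λ i (μ i) * D (μ i) →
        Λ i a * D a ≤ (1 - t) * (Λ i (μ i) * D (μ i)) :=
      eventually_all.2 fun i => eventually_all.2 fun a => eventually_imp_distrib_left.2 (evt _ _)
    have ev3 : ∀ᶠ t in 𝓝[>] (0:ℝ), t < 1 := nhdsWithin_le_nhds (gt_mem_nhds one_pos)
    obtain ⟨t, ht1, ht2, ht3, ht0⟩ := (ev1.and (ev2.and (ev3.and self_mem_nhdsWithin))).exists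
    have ht0 : 0 < t := ht0
    set D' : Fin n → ℝ := fun a => if μ.symm a ∈ A then D a else (1 - t) * D a with hD'
    have hD'le : ∀ a, D' a ≤ D a := by
      intro a
      simp only [hD']
      split_ifs
      · exact le_rfl
      · nlinarith [hD0 a]
    have hD'0 : ∀ a, 0 ≤ D' a := by
      intro a
      simp only [hD']
      split_ifs
      · exact hD0 a
      · exact mul_nonneg (by linarith) (hD0 a)
    have hyes : ∀ i, i ∈ A → D' (μ i) = D (μ i) := fun i hi => by simp [hD', hi]
    have hno : ∀ i, i ∉ A → D' (μ i) = (1 - t) * D (μ i) := fun i hi => by simp [hD', hi]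
    have hD'F : D' ∈ F := by
      refine ⟨fun i a hia => ?_, fun i hi => ?_⟩
      · have h1 := hDF.1 i a hia
        have h2 := mul_le_mul_of_nonneg_left (hD'le a) (hΛpos i a).le
        by_cases hiA : i ∈ A
        · rw [hyes i hiA]; linarith
        · rw [hno i hiA]
          obtain ⟨j, rfl⟩ := μ.surjective a
          by_cases hjA : j ∈ A
          · have hlt := lt_of_le_of_ne h1 (fun hh => hiA (hA2 i j hjA hia hh))
            have := ht2 i (μ j) hlt
            linarith
          · rw [hno j hjA]
            have := mul_le_mul_of_nonneg_left h1 (by linarith : 0 ≤ 1 - t)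
            linarith
      · by_cases hiA : i ∈ A
        · rw [hyes i hiA]; exact hDF.2 i hi
        · rw [hno i hiA]
          have hlt := lt_of_le_of_ne (hDF.2 i hi) (fun hh => hiA (hA1 i hi hh.symm))
          have := ht1 i hlt
          linarith
    have hle : ∑ a, D a ≤ ∑ a, D' a :=
      hDmin ⟨hD'F, ⟨fun a => hD'0 a, fun a => (hD'le a).trans (hDI.2 a)⟩⟩
    have hlt : ∑ a, D' a < ∑ a, D a := by
      refine Finset.sum_lt_sum (fun a _ => hD'le a) ⟨μ i0, Finset.mem_univ _, ?_⟩
      rw [hno i0 hi0]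
      nlinarith [hDpos (μ i0)]
    linarith
  have ev1 : ∀ᶠ t in 𝓝[>] (0:ℝ), ∀ i a, u i (r a - t * D a) a =
      u i (r a) a + t * (Λ i a * D a) :=
    eventually_all.2 fun i => eventually_all.2 fun a => left8 h i a _ _ (hD0 a)
  have ev2 : ∀ᶠ t in 𝓝[>] (0:ℝ), ∀ i j a d, u i (r a) a < u j (r d) d →
      u i (r a - t * D a) a < u j (r d - t * D d) d :=
    eventually_all.2 fun i => eventually_all.2 fun j => eventually_all.2 fun a =>
      eventually_all.2 fun d => eventually_imp_distrib_left.2 (fun hlt => by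
        simpa [sub_eq_add_neg] using pert8 h i a j d _ _ (-D a) (-D d) hlt)
  have ev3 : ∀ᶠ t in 𝓝[>] (0:ℝ), ∀ i, c < u i (r (μ i)) (μ i) → c + t < u i (r (μ i)) (μ i) := by
    refine eventually_all.2 fun i => eventually_imp_distrib_left.2 fun hlt => ?_
    have : Tendsto (fun t : ℝ => c + t) (𝓝[>] 0) (𝓝 (c + 0)) :=
      (Continuous.tendsto (by fun_prop) 0).mono_left nhdsWithin_le_nhds
    exact this.eventually (gt_mem_nhds (by simpa using hlt))
  obtain ⟨t0, ht0, hIoc⟩ := (mem_nhdsGT_iff_exists_Ioc_subset.1 (ev1.and (ev2.and ev3)))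
  have ht0 : 0 < t0 := ht0
  set SD : ℝ := ∑ a, D a with hSD
  have hSDpos : 0 < SD := Finset.sum_pos (fun a _ => hDpos a) ⟨⟨0, hn⟩, Finset.mem_univ _⟩
  refine ⟨t0 * SD, mul_pos ht0 hSDpos, fun δ hδ => ?_⟩
  rcases hδ.1.eq_or_lt with h0 | hδ0
  · subst h0; exact ⟨r, by simpa using hM⟩
  set t := δ / SD with ht
  have htpos : 0 < t := div_pos hδ0 hSDpos
  have htSD : t * SD = δ := div_mul_cancel₀ _ hSDpos.ne'
  obtain ⟨e1, e2, e3⟩ := hIoc ⟨htpos, (div_le_iff₀ hSDpos).2 hδ.2⟩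
  set p : Fin n → ℝ := fun a => r a - t * D a with hp
  have hpu : ∀ i a, u i (p a) a = u i (r a) a + t * (Λ i a * D a) := e1
  refine ⟨p, maxmin_of_reach8 hn h ?_ ?_ ?_⟩
  · simp only [hp]
    rw [Finset.sum_sub_distrib, ← Finset.mul_sum, hs, htSD]
  · suffices H : ∀ i a, u i (p a) a ≤ u i (p (μ i)) (μ i) from fun i j => H i (μ j)
    intro i a
    by_cases hti : T i a
    · rw [hpu, hpu]
      have := mul_le_mul_of_nonneg_left (hDF.1 i a hti) htpos.le
      have : u i (r a) a = u i (r (μ i)) (μ i) := hti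
      linarith
    · exact (e2 i i a (μ i) (lt_of_le_of_ne (ef8 hr i a) hti)).le
  · have hge : ∀ i, c + t ≤ u i (p (μ i)) (μ i) := by
      intro i
      rw [hpu]
      by_cases hi : u i (r (μ i)) (μ i) = c
      · have := mul_le_mul_of_nonneg_left (hDF.2 i hi) htpos.le
        linarith
      · have := e3 i (lt_of_le_of_ne (mn8_le r μ i) (Ne.symm hi))
        have := mul_nonneg htpos.le (mul_nonneg (hΛpos i (μ i)).le (hD0 (μ i)))
        linarith
    intro A hA1 hA2
    refine hDA A (fun i hi hi1 => hA1 i ?_) (fun i j hj hij hij1 => hA2 i j hj ?_)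
    · apply le_antisymm _ (mn8_le p μ i)
      obtain ⟨k, hk⟩ := mn8_att (u := u) hn p μ
      rw [← hk, hpu, hi, hi1, mul_one]
      exact hge k
    · rw [hpu, hpu, hij1]
      have : u i (r (μ j)) (μ j) = u i (r (μ i)) (μ i) := hij
      rw [this]

lemma mono8 (hn : 0 < n) (h : Good8 n u b ρ) {m m' : ℝ} {r t : Fin n → ℝ}
    {σ γ : Equiv.Perm (Fin n)} (hM : MaxminEF n u m r σ) (hM' : MaxminEF n u m' t γ)
    (hmm : m' < m) : ∀ a, t a ≤ r a := by
  refine cmp8 h hM.2.1 (reach_of_maxmin8 hn h hM) hM'.2.1 ?_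
  by_contra! hcon
  have := cmp8 h hM'.2.1 (reach_of_maxmin8 hn h hM') hM.2.1 hcon.le
  have := Finset.sum_le_sum (fun a (_ : a ∈ Finset.univ) => this a)
  rw [hM.1, hM'.1] at this
  linarith

lemma limit8 (hn : 0 < n) (h : Good8 n u b ρ) {m e : ℝ} (he : 0 < e) {μ : Equiv.Perm (Fin n)}
    (hex : ∀ δ, 0 ≤ δ → δ < e → ∃ rδ : Fin n → ℝ, MaxminEF n u (m - δ) rδ μ) :
    ∃ q : Fin n → ℝ, MaxminEF n u (m - e) q μ := by
  obtain ⟨r, hr⟩ := hex 0 le_rfl he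
  have hd : ∀ k : ℕ, 0 < e / ((k:ℝ) + 2) ∧ e / ((k:ℝ) + 2) < e := fun k => by
    have hk : (0:ℝ) ≤ k := Nat.cast_nonneg k
    exact ⟨by positivity, div_lt_self he (by linarith)⟩
  choose R hRm using fun k : ℕ => hex (e - e / ((k:ℝ) + 2)) (by linarith [(hd k).2]) (by linarith [(hd k).1])
  have hup : ∀ k a, R k a ≤ r a := fun k =>
    mono8 hn h hr (hRm k) (by linarith [(hd k).2])
  have hlow : ∀ k a, m - e - ∑ c, r c + r a ≤ R k a := by
    intro k a
    have h1 := (hRm k).1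
    have h2 : r a - R k a ≤ ∑ c, (r c - R k c) :=
      Finset.single_le_sum (f := fun c => r c - R k c) (fun c _ => by linarith [hup k c]) (Finset.mem_univ a)
    rw [Finset.sum_sub_distrib, h1] at h2
    linarith [(hd k).1]
  obtain ⟨q, -, φ, hφ, hq⟩ := (isCompact_Icc (a := fun a => m - e - ∑ c, r c + r a) (b := r)).tendsto_subseq
    (x := R) (fun k => ⟨hlow k, hup k⟩)
  have hqa : ∀ a, Tendsto (fun k => R (φ k) a) atTop (𝓝 (q a)) := fun a => (tendsto_pi_nhds.1 hq) a
  have hqu : ∀ i a, Tendsto (fun k => u i (R (φ k) a) a) atTop (𝓝 (u i (q a) a)) := fun i a =>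
    ((cont8 h i a).tendsto _).comp (hqa a)
  have hqs : ∑ a, q a = m - e := by
    have h1 : Tendsto (fun k => ∑ a, R (φ k) a) atTop (𝓝 (∑ a, q a)) :=
      tendsto_finsetSum _ (fun a _ => hqa a)
    have h2 : Tendsto (fun k : ℕ => m - (e - e / ((k:ℝ) + 2))) atTop (𝓝 (m - (e - 0))) := by
      refine tendsto_const_nhds.sub (tendsto_const_nhds.sub ?_)
      exact tendsto_const_nhds.div_atTop (tendsto_atTop_add_const_right _ _ tendsto_natCast_atTop_atTop)
    have h3 : Tendsto (fun k => ∑ a, R (φ k) a) atTop (𝓝 (m - (e - 0))) := by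
      simp only [fun k => (hRm k).1]
      exact h2.comp hφ.tendsto_atTop
    rw [tendsto_nhds_unique h1 h3]; ring
  have hqE : EnvyFree n u q μ := fun i j =>
    le_of_tendsto_of_tendsto' (hqu i (μ j)) (hqu i (μ i)) (fun k => (hRm (φ k)).2.1 i j)
  refine ⟨q, hqs, hqE, fun t γ hts ht => ?_⟩
  change mn8 n u t γ ≤ mn8 n u q μ
  by_contra! hcon
  obtain ⟨i, hi⟩ := mn8_att (u := u) hn q μ
  have hev : ∀ᶠ k in atTop, u i (R (φ k) (μ i)) (μ i) < mn8 n u t γ :=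
    (hqu i (μ i)).eventually (gt_mem_nhds (by rw [hi]; exact hcon))
  have hle : ∀ a, t a ≤ q a := fun a => by
    refine ge_of_tendsto (hqa a) (hev.mono fun k hk => ?_)
    exact cmp8 h (hRm (φ k)).2.1 (reach_of_maxmin8 hn h (hRm (φ k))) ht
      ((mn8_le _ _ i).trans hk.le) a
  have := eq8 hle (hts.trans hqs.symm)
  subst this
  have := mn8_le (u := u) t γ i
  have := ef8 hqE i (γ i)
  linarith
end

/-- for a maxmin-utility envy-free allocation `(r, σ)` in the
budget-constrained domain and a maximum-weight perfect matching `μ` in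
`F^u(r)`, the set `S` of `ε > 0` such that maxmin-utility envy-free allocations
with assignment `μ` exist for all rents `m - δ`, `δ ∈ [0, ε]`, is nonempty;
and if `S` is bounded above then its supremum `ε*` is attained and `μ` fails to
be a maximum-weight perfect matching at the limiting prices `r^{ε*}`. -/
theorem stmt_8 (n : ℕ) (hn : 0 < n) (v : Fin n → Fin n → ℝ) (b ρ : Fin n → ℝ)
    (hb : ∀ i, 0 ≤ b i) (hρ : ∀ i, 0 ≤ ρ i)
    (u : Fin n → ℝ → Fin n → ℝ)
    (hu : ∀ i p a, u i p a = v i a - p - ρ i * max 0 (p - b i))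
    (m : ℝ) (r : Fin n → ℝ) (σ μ : Equiv.Perm (Fin n))
    (hmaxmin : MaxminEF n u m r σ)
    (hμ : MaxWeightMatching n u b ρ r σ μ) :
    (∃ ε > (0:ℝ), ε ∈ {ε : ℝ | 0 < ε ∧ ∀ δ ∈ Set.Icc (0:ℝ) ε,
        ∃ rδ : Fin n → ℝ, MaxminEF n u (m - δ) rδ μ}) ∧
    (BddAbove {ε : ℝ | 0 < ε ∧ ∀ δ ∈ Set.Icc (0:ℝ) ε,
        ∃ rδ : Fin n → ℝ, MaxminEF n u (m - δ) rδ μ} →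
      (sSup {ε : ℝ | 0 < ε ∧ ∀ δ ∈ Set.Icc (0:ℝ) ε,
          ∃ rδ : Fin n → ℝ, MaxminEF n u (m - δ) rδ μ} ∈
        {ε : ℝ | 0 < ε ∧ ∀ δ ∈ Set.Icc (0:ℝ) ε,
          ∃ rδ : Fin n → ℝ, MaxminEF n u (m - δ) rδ μ}) ∧
      ∀ rε : Fin n → ℝ,
        MaxminEF n u
          (m - sSup {ε : ℝ | 0 < ε ∧ ∀ δ ∈ Set.Icc (0:ℝ) ε,
            ∃ rδ : Fin n → ℝ, MaxminEF n u (m - δ) rδ μ}) rε μ →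
        ¬ MaxWeightMatching n u b ρ rε μ μ) := by
  have h : Good8 n u b ρ := ⟨hρ, fun i => ⟨v i, hu i⟩⟩
  obtain ⟨ε0, hε0, hε0'⟩ := step8 hn h hmaxmin hμ
  refine ⟨⟨ε0, hε0, hε0, hε0'⟩, fun hbdd => ?_⟩
  set S : Set ℝ := {ε : ℝ | 0 < ε ∧ ∀ δ ∈ Set.Icc (0:ℝ) ε,
    ∃ rδ : Fin n → ℝ, MaxminEF n u (m - δ) rδ μ} with hS
  have hmem : ε0 ∈ S := ⟨hε0, hε0'⟩
  have hpos : 0 < sSup S := lt_of_lt_of_le hε0 (le_csSup hbdd hmem)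
  have hlt : ∀ δ, 0 ≤ δ → δ < sSup S → ∃ rδ : Fin n → ℝ, MaxminEF n u (m - δ) rδ μ := by
    intro δ h0 h1
    obtain ⟨s, hs, hδs⟩ := exists_lt_of_lt_csSup ⟨ε0, hmem⟩ h1
    exact hs.2 δ ⟨h0, hδs.le⟩
  have hle : ∀ δ, 0 ≤ δ → δ ≤ sSup S → ∃ rδ : Fin n → ℝ, MaxminEF n u (m - δ) rδ μ := by
    intro δ h0 h1
    rcases h1.eq_or_lt with h2 | h2
    · rw [h2]; exact limit8 hn h hpos hlt
    · exact hlt δ h0 h2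
  refine ⟨⟨hpos, fun δ hδ => hle δ hδ.1 hδ.2⟩, fun rε hrε hW => ?_⟩
  obtain ⟨ε1, hε1, hε1'⟩ := step8 hn h hrε hW
  have : sSup S + ε1 ∈ S := by
    refine ⟨by linarith, fun δ hδ => ?_⟩
    rcases le_total δ (sSup S) with h1 | h1
    · exact hle δ hδ.1 h1
    · obtain ⟨q, hq⟩ := hε1' (δ - sSup S) ⟨by linarith, by linarith [hδ.2]⟩
      refine ⟨q, ?_⟩
      have e : m - sSup S - (δ - sSup S) = m - δ := by ring
      rwa [e] at hq
  have := le_csSup hbdd this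
  linarith
end

section
/- For budget-constrained quasi-linear preferences (profile u ∈ B^N) and any envy-free allocation z = (r, μ), if agent i weakly envies along a path — u_i(z_i) = u_i(z_j), u_j(z_j) = u_j(z_k), etc. — ending at agent i (path j → i in the envy-free graph), then for each δ > 0 there is a quasi-linear report v'_i such that at every envy-free allocation (t, σ) of the profile (u_{-i}, v'_i), agent i receives room μ(j) at price t_{μ(j)} ≤ r_{μ(j)} + δ. -/
inductive SPath {ι : Type} [DecidableEq ι] (R : ι → ι → Prop) (G : ι → ι → ℝ) :
    ι → ι → Finset ι → ℝ → Prop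
  | nil (a : ι) : SPath R G a a {a} 0
  | cons (a b c : ι) (s : Finset ι) (x : ℝ) (hR : R a b) (ha : a ∉ s) (h : SPath R G b c s x) :
      SPath R G a c (insert a s) (G a b + x)

lemma SPath.mem_last {ι : Type} [DecidableEq ι] {R : ι → ι → Prop} {G : ι → ι → ℝ}
    {a c : ι} {s : Finset ι} {x : ℝ} (h : SPath R G a c s x) : c ∈ s := by
  induction h with
  | nil a => simp
  | cons a b c s x hR ha h ih => simp [ih]

lemma SPath.mem_head {ι : Type} [DecidableEq ι] {R : ι → ι → Prop} {G : ι → ι → ℝ}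
    {a c : ι} {s : Finset ι} {x : ℝ} (h : SPath R G a c s x) : a ∈ s := by
  cases h <;> simp

lemma SPath.split {ι : Type} [DecidableEq ι] {R : ι → ι → Prop} {G : ι → ι → ℝ}
    {b c : ι} {s : Finset ι} {x : ℝ} (h : SPath R G b c s x) :
    ∀ a ∈ s, ∃ s1 x1 s2 x2, SPath R G b a s1 x1 ∧ SPath R G a c s2 x2 ∧ x = x1 + x2 ∧ s1 ⊆ s := by
  induction h with
  | nil b =>
    intro a ha
    have : a = b := by simpa using ha
    subst this
    exact ⟨_, _, _, _, .nil a, .nil a, by simp, subset_rfl⟩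
  | cons b b' c s x hR hb h ih =>
    intro a ha
    by_cases hab : a = b
    · subst hab
      exact ⟨_, _, _, _, .nil a, .cons a b' c s x hR hb h, by simp, by simp⟩
    · have ha' : a ∈ s := by
        rcases Finset.mem_insert.1 ha with h | h
        · exact absurd h hab
        · exact h
      obtain ⟨s1, x1, s2, x2, h1, h2, hx, hs⟩ := ih a ha'
      exact ⟨_, _, _, _, .cons b b' a s1 x1 hR (fun h => hb (hs h)) h1, h2, by rw [hx]; ring,
        Finset.insert_subset_insert _ hs⟩

lemma SPath.bound {ι : Type} [DecidableEq ι] {R : ι → ι → Prop} {G : ι → ι → ℝ} {M : ℝ}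
    (hM0 : 0 ≤ M) (hM : ∀ a b, G a b ≤ M)
    {b c : ι} {s : Finset ι} {x : ℝ} (h : SPath R G b c s x) : x ≤ s.card * M := by
  induction h with
  | nil b => simpa using hM0
  | cons b b' c s x hR hb h ih =>
    rw [Finset.card_insert_of_notMem hb]
    push_cast
    have := hM b b'
    linarith

lemma SPath.perm {ι : Type} [Fintype ι] [DecidableEq ι] {R : ι → ι → Prop} {G : ι → ι → ℝ}
    (hrefl : ∀ k, R k k) (hG : ∀ k, G k k = 0)
    {b c : ι} {s : Finset ι} {x : ℝ} (h : SPath R G b c s x) :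
    ∃ π : Equiv.Perm ι, π c = b ∧ (∀ k, k ≠ c → R k (π k)) ∧ (∀ k, k ∉ s → π k = k) ∧
      ∑ k ∈ Finset.univ.erase c, G k (π k) = x := by
  induction h with
  | nil b => exact ⟨1, by simp, by simp [hrefl], by simp, by simp [hG]⟩
  | cons a b c s x hR ha h ih =>
    obtain ⟨π, h1, h2, h3, h4⟩ := ih
    have hac : a ≠ c := fun h' => ha (h' ▸ h.mem_last)
    have hπa := h3 a ha
    have key : ∀ k, k ≠ c → k ≠ a → (Equiv.swap a b * π) k = π k := by
      intro k hk hka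
      rw [Equiv.Perm.mul_apply]
      apply Equiv.swap_apply_of_ne_of_ne
      · intro h'; exact hka (π.injective (h'.trans hπa.symm))
      · intro h'; exact hk (π.injective (h'.trans h1.symm))
    have keya : (Equiv.swap a b * π) a = b := by simp [hπa]
    refine ⟨Equiv.swap a b * π, by simp [h1], ?_, ?_, ?_⟩
    · intro k hk
      by_cases hka : k = a
      · subst hka; rw [keya]; exact hR
      · rw [key k hk hka]; exact h2 k hk
    · intro k hk
      simp only [Finset.mem_insert, not_or] at hk
      rw [key k (fun h' => hk.2 (h' ▸ h.mem_last)) hk.1]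
      exact h3 k hk.2
    · have hm : a ∈ Finset.univ.erase c := by simp [hac]
      rw [← Finset.add_sum_erase _ _ hm] at h4 ⊢
      rw [keya]
      rw [hπa, hG, zero_add] at h4
      rw [← h4]
      congr 1
      apply Finset.sum_congr rfl
      intro k hk
      simp only [Finset.mem_erase, Finset.mem_univ, and_true] at hk
      rw [key k hk.2 hk.1]

lemma SPath.of_path {ι : Type} [DecidableEq ι] {R : ι → ι → Prop} (G : ι → ι → ℝ) {j i : ι}
    (h : Relation.ReflTransGen R j i) : ∃ s x, SPath R G j i s x := by
  induction h using Relation.ReflTransGen.head_induction_on with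
  | refl => exact ⟨_, _, .nil i⟩
  | head hab _ ih =>
    rename_i a b _
    obtain ⟨s, x, h⟩ := ih
    by_cases ha : a ∈ s
    · obtain ⟨_, _, s2, x2, _, h2, _⟩ := h.split a ha
      exact ⟨s2, x2, h2⟩
    · exact ⟨_, _, .cons a b i s x hab ha h⟩

lemma exists_potential {ι : Type} [Fintype ι] [DecidableEq ι] {R : ι → ι → Prop} {G : ι → ι → ℝ}
    (hrefl : ∀ k, R k k) (hG : ∀ k, G k k = 0)
    (hopt : ∀ π : Equiv.Perm ι, (∀ k, R k (π k)) → ∑ k, G k (π k) ≤ 0) :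
    ∃ z : ι → ℝ, ∀ k l, R k l → G k l + z l ≤ z k := by
  let A : ι → Set ℝ := fun k => {x | ∃ c s, SPath R G k c s x}
  obtain ⟨M, hM0, hM⟩ : ∃ M : ℝ, 0 ≤ M ∧ ∀ a b, G a b ≤ M := by
    refine ⟨∑ a, ∑ b, |G a b|, by positivity, fun a b => ?_⟩
    calc G a b ≤ |G a b| := le_abs_self _
      _ ≤ ∑ b, |G a b| := Finset.single_le_sum (f := fun b => |G a b|)
          (fun _ _ => abs_nonneg _) (Finset.mem_univ b)
      _ ≤ _ := Finset.single_le_sum (f := fun a => ∑ b, |G a b|)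
          (fun _ _ => by positivity) (Finset.mem_univ a)
  have hbdd : ∀ k, BddAbove (A k) := by
    intro k
    refine ⟨Fintype.card ι * M, ?_⟩
    rintro x ⟨c, s, h⟩
    refine (h.bound hM0 hM).trans ?_
    gcongr
    exact Finset.card_le_univ s
  refine ⟨fun k => sSup (A k), fun k l hkl => ?_⟩
  suffices sSup (A l) ≤ sSup (A k) - G k l by linarith
  have hne : (A l).Nonempty := ⟨0, l, _, .nil l⟩
  apply csSup_le hne
  rintro x ⟨c, s, h⟩
  by_cases hk : k ∈ s
  · obtain ⟨s1, x1, s2, x2, h1, h2, hx, _⟩ := h.split k hk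
    have h2' : x2 ≤ sSup (A k) := le_csSup (hbdd k) ⟨c, s2, h2⟩
    obtain ⟨π, hπ, hπR, _, hsum⟩ := h1.perm hrefl hG
    have := hopt π (by
      intro m
      by_cases hm : m = k
      · subst hm; rw [hπ]; exact hkl
      · exact hπR m hm)
    rw [← Finset.add_sum_erase _ _ (Finset.mem_univ k), hsum, hπ] at this
    linarith
  · have := le_csSup (hbdd k) ⟨c, _, .cons k l c s x hkl hk h⟩
    linarith

lemma exists_dual {ι : Type} [Fintype ι] [DecidableEq ι] (E : ι → ι → Prop) (w : ι → ι → ℝ)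
    (hE : ∀ k, E k k) :
    ∃ (σ : Equiv.Perm ι) (y : ι → ℝ), ∀ k, E k (σ k) ∧
      ∀ a, E k a → w k a + y a ≤ w k (σ k) + y (σ k) := by
  classical
  obtain ⟨σ, hσ, hmax⟩ := Finset.exists_max_image
    (Finset.univ.filter fun σ : Equiv.Perm ι => ∀ k, E k (σ k)) (fun σ => ∑ k, w k (σ k))
    ⟨1, by simpa using hE⟩
  simp only [Finset.mem_filter, Finset.mem_univ, true_and] at hσ hmax
  obtain ⟨z, hz⟩ := exists_potential (R := fun k l => E k (σ l))
    (G := fun k l => w k (σ l) - w k (σ k)) hσ (by simp) (by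
      intro π hπ
      have := hmax (σ * π) hπ
      rw [Finset.sum_sub_distrib]
      simpa using this)
  refine ⟨σ, fun a => z (σ.symm a), fun k => ⟨hσ k, fun a ha => ?_⟩⟩
  have := hz k (σ.symm a) (by simpa using ha)
  simp only [Equiv.apply_symm_apply, Equiv.symm_apply_apply] at this ⊢
  linarith

def cost (b ρ x : ℝ) : ℝ := x + ρ * max 0 (x - b)

lemma cost_continuous (b ρ : ℝ) : Continuous (cost b ρ) := by
  unfold cost; fun_prop

lemma cost_strictMono {b ρ : ℝ} (hρ : 0 ≤ ρ) : StrictMono (cost b ρ) := by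
  intro x y hxy
  unfold cost
  have : max 0 (x - b) ≤ max 0 (y - b) := max_le_max le_rfl (by linarith)
  have := mul_le_mul_of_nonneg_left this hρ
  linarith

lemma le_cost {b ρ : ℝ} (hρ : 0 ≤ ρ) (x : ℝ) : x ≤ cost b ρ x := by
  unfold cost
  have := mul_nonneg hρ (le_max_left 0 (x - b))
  linarith

open Filter Topology in
lemma cost_deriv (b ρ x z : ℝ) :
    ∀ᶠ ε in 𝓝[>] (0:ℝ), cost b ρ (x + ε * z) = cost b ρ x +
      ε * (z * (if b < x ∨ (b = x ∧ 0 < z) then 1 + ρ else 1)) := by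
  have hc : Tendsto (fun ε : ℝ => x + ε * z) (𝓝[>] 0) (𝓝 x) := by
    have : Continuous (fun ε : ℝ => x + ε * z) := by fun_prop
    have := this.tendsto 0
    simp only [zero_mul, add_zero] at this
    exact this.mono_left nhdsWithin_le_nhds
  unfold cost
  rcases lt_trichotomy b x with h | h | h
  · filter_upwards [hc.eventually (lt_mem_nhds h)] with ε hε
    rw [if_pos (Or.inl h), max_eq_right (by linarith), max_eq_right (by linarith)]; ring
  · subst h
    filter_upwards [self_mem_nhdsWithin] with ε hε
    have hε : 0 < ε := hε
    by_cases hz : 0 < z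
    · rw [if_pos (Or.inr ⟨rfl, hz⟩), max_eq_right (by nlinarith), max_eq_right (by linarith)]; ring
    · rw [if_neg (by simp [hz]), max_eq_left (by nlinarith), max_eq_right (by linarith)]; ring
  · filter_upwards [hc.eventually (gt_mem_nhds h)] with ε hε
    rw [if_neg (by rintro (h' | h'); exacts [by linarith, by linarith [h'.1]]),
      max_eq_left (by linarith), max_eq_left (by linarith)]; ring

open Filter Topology in
lemma perturb {ι : Type} [Fintype ι] [DecidableEq ι] (v : ι → ι → ℝ) (b ρ : ι → ℝ)
    (hρ : ∀ k, 0 ≤ ρ k) (i : ι) (p : ι → ℝ)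
    (hEF : ∀ k, k ≠ i → ∀ h, v k h - cost (b k) (ρ k) (p h) ≤ v k k - cost (b k) (ρ k) (p k))
    (S : Finset ι) (hi : i ∈ S) (o : ι) (ho : o ∉ S)
    (hstrict : ∀ k, k ∉ S → ∀ h, h ∈ S →
      v k h - cost (b k) (ρ k) (p h) ≠ v k k - cost (b k) (ρ k) (p k)) :
    ∃ (p' : ι → ℝ) (σ : Equiv.Perm ι), σ i = i ∧ ∑ a, p' a = ∑ a, p a ∧ p' i < p i ∧
      ∀ k, k ≠ i → ∀ h, v k h - cost (b k) (ρ k) (p' h) ≤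
        v k (σ k) - cost (b k) (ρ k) (p' (σ k)) := by
  classical
  let T : ι → ι → Prop := fun k h =>
    v k h - cost (b k) (ρ k) (p h) = v k k - cost (b k) (ρ k) (p k)
  let E : ι → ι → Prop := fun k h => if k = i then h = i else ((k ∈ S ↔ h ∈ S) ∧ T k h)
  let c : ι → ι → ℝ := fun k h =>
    if b k < p h ∨ (b k = p h ∧ h ∉ S) then 1 + ρ k else 1
  have hc : ∀ k h, 0 < c k h := by
    intro k h; have := hρ k; dsimp only [c]; split_ifs <;> linarith
  let w : ι → ι → ℝ := fun k h => if h ∈ S then Real.log (c k h) else - Real.log (c k h)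
  obtain ⟨σ, y, hσ⟩ := exists_dual E w (by
    intro k; dsimp only [E, T]; split_ifs <;> simp_all)
  have hσi : σ i = i := by
    have := (hσ i).1
    simpa [E] using this
  let XS : ℝ := ∑ h ∈ S, Real.exp (y h)
  let XW : ℝ := ∑ h ∈ Sᶜ, Real.exp (- y h)
  have hXS : 0 < XS := Finset.sum_pos (fun _ _ => Real.exp_pos _) ⟨i, hi⟩
  have hXW : 0 < XW := Finset.sum_pos (fun _ _ => Real.exp_pos _) ⟨o, by simpa using ho⟩
  let z : ι → ℝ := fun h => if h ∈ S then - (Real.exp (y h) / XS) else Real.exp (- y h) / XW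
  have hzS : ∀ h ∈ S, z h = - (Real.exp (y h) / XS) := fun h hh => if_pos hh
  have hzW : ∀ h, h ∉ S → z h = Real.exp (- y h) / XW := fun h hh => if_neg hh
  have hzneg : ∀ h ∈ S, z h < 0 := fun h hh => by
    rw [hzS h hh]; have := div_pos (Real.exp_pos (y h)) hXS; linarith
  have hzpos : ∀ h, h ∉ S → 0 < z h := fun h hh => by
    rw [hzW h hh]; exact div_pos (Real.exp_pos _) hXW
  have hzsum : ∑ h, z h = 0 := by
    rw [← Finset.sum_add_sum_compl S, Finset.sum_congr rfl hzS,
      Finset.sum_congr rfl (fun h hh => hzW h (by simpa using hh)), Finset.sum_neg_distrib,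
      ← Finset.sum_div, ← Finset.sum_div]
    change - (XS / XS) + XW / XW = 0
    rw [div_self hXS.ne', div_self hXW.ne']; ring
  have hderiv : ∀ k h, ∀ᶠ ε in 𝓝[>] (0:ℝ), cost (b k) (ρ k) (p h + ε * z h) =
      cost (b k) (ρ k) (p h) + ε * (z h * c k h) := by
    intro k h
    have := cost_deriv (b k) (ρ k) (p h) (z h)
    have hcc : (if b k < p h ∨ (b k = p h ∧ 0 < z h) then 1 + ρ k else 1) = c k h := by
      dsimp only [c]
      have : 0 < z h ↔ h ∉ S :=
        ⟨fun h1 h2 => by linarith [hzneg h h2], hzpos h⟩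
      simp only [this]
    rwa [hcc] at this
  have hmain : ∀ k h, ∀ᶠ ε in 𝓝[>] (0:ℝ), k ≠ i →
      v k h - cost (b k) (ρ k) (p h + ε * z h) ≤
        v k (σ k) - cost (b k) (ρ k) (p (σ k) + ε * z (σ k)) := by
    intro k h
    by_cases hki : k = i
    · exact Eventually.of_forall fun _ h => absurd hki h
    have h1 := hσ k
    simp only [E, if_neg hki] at h1
    obtain ⟨⟨hcl, hT⟩, hopt⟩ := h1
    by_cases hTh : T k h
    · have hD : z (σ k) * c k (σ k) ≤ z h * c k h := by
        by_cases hkS : k ∈ S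
        · have hsS := hcl.1 hkS
          by_cases hhS : h ∈ S
          · have := hopt h ⟨by simp [hkS, hhS], hTh⟩
            simp only [w, if_pos hsS, if_pos hhS] at this
            have := Real.exp_le_exp.2 this
            rw [Real.exp_add, Real.exp_add, Real.exp_log (hc _ _), Real.exp_log (hc _ _)] at this
            rw [hzS _ hsS, hzS _ hhS]
            have := div_le_div_of_nonneg_right this hXS.le
            have e1 : -(Real.exp (y (σ k)) / XS) * c k (σ k)
              = - (c k (σ k) * Real.exp (y (σ k)) / XS) := by ring
            have e2 : -(Real.exp (y h) / XS) * c k h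
              = - (c k h * Real.exp (y h) / XS) := by ring
            rw [e1, e2]; linarith
          · have a1 := mul_neg_of_neg_of_pos (hzneg _ hsS) (hc k (σ k))
            have a2 := mul_pos (hzpos _ hhS) (hc k h)
            linarith
        · have hsS : σ k ∉ S := fun h' => hkS (hcl.2 h')
          by_cases hhS : h ∈ S
          · exact absurd hTh (hstrict k hkS h hhS)
          · have := hopt h ⟨by simp [hkS, hhS], hTh⟩
            simp only [w, if_neg hsS, if_neg hhS] at this
            have : Real.log (c k (σ k)) + - y (σ k) ≤ Real.log (c k h) + - y h := by linarith
            have := Real.exp_le_exp.2 this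
            rw [Real.exp_add, Real.exp_add, Real.exp_log (hc _ _), Real.exp_log (hc _ _)] at this
            rw [hzW _ hsS, hzW _ hhS]
            have := div_le_div_of_nonneg_right this hXW.le
            have e1 : (Real.exp (-y (σ k)) / XW) * c k (σ k)
              = (c k (σ k) * Real.exp (-y (σ k)) / XW) := by ring
            have e2 : (Real.exp (-y h) / XW) * c k h
              = (c k h * Real.exp (-y h) / XW) := by ring
            rw [e1, e2]; linarith
      filter_upwards [hderiv k h, hderiv k (σ k), self_mem_nhdsWithin] with ε e1 e2 hε _
      have hε : 0 < ε := hε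
      rw [e1, e2]
      have := mul_le_mul_of_nonneg_left hD hε.le
      have hT' : v k (σ k) - cost (b k) (ρ k) (p (σ k)) = v k k - cost (b k) (ρ k) (p k) := hT
      have hTh' : v k h - cost (b k) (ρ k) (p h) = v k k - cost (b k) (ρ k) (p k) := hTh
      linarith
    · have hlt : v k h - cost (b k) (ρ k) (p h) < v k (σ k) - cost (b k) (ρ k) (p (σ k)) := by
        have hT' : v k (σ k) - cost (b k) (ρ k) (p (σ k)) = v k k - cost (b k) (ρ k) (p k) := hT
        rw [hT']
        exact lt_of_le_of_ne (hEF k hki h) hTh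
      have hcont : ∀ a, Tendsto (fun ε : ℝ => v k a - cost (b k) (ρ k) (p a + ε * z a))
          (𝓝[>] 0) (𝓝 (v k a - cost (b k) (ρ k) (p a))) := by
        intro a
        have h1 := cost_continuous (b k) (ρ k)
        have : Continuous (fun ε : ℝ => v k a - cost (b k) (ρ k) (p a + ε * z a)) := by fun_prop
        have := this.tendsto 0
        simp only [zero_mul, add_zero] at this
        exact this.mono_left nhdsWithin_le_nhds
      filter_upwards [(hcont h).eventually_lt (hcont (σ k)) hlt] with ε hε _
      exact hε.le
  have hall : ∀ᶠ ε in 𝓝[>] (0:ℝ), 0 < ε ∧ ∀ k h, k ≠ i →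
      v k h - cost (b k) (ρ k) (p h + ε * z h) ≤
        v k (σ k) - cost (b k) (ρ k) (p (σ k) + ε * z (σ k)) := by
    refine Eventually.and self_mem_nhdsWithin ?_
    rw [eventually_all]; intro k
    rw [eventually_all]; intro h
    exact hmain k h
  obtain ⟨ε, hε, hE⟩ := hall.exists
  refine ⟨fun a => p a + ε * z a, σ, hσi, ?_, ?_, fun k hk h => hE k h hk⟩
  · rw [Finset.sum_add_distrib, ← Finset.mul_sum, hzsum]; simp
  · have := mul_neg_of_pos_of_neg hε (hzneg i hi)
    dsimp only; linarith

/-- with budget-constrained preferences and an envy-free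
allocation `z = (r, μ)`, if there is a path `j → i` in the envy-free graph
(edges are indifferences `u_k(z_k) = u_k(z_h)`), then for each `δ > 0` agent
`i` has a quasi-linear report `v'` such that at every envy-free allocation of
the profile `(u_{-i}, v')` she receives room `μ(j)` at a price at most
`r_{μ(j)} + δ`. -/
theorem stmt_10 (n : ℕ) (v : Fin n → Fin n → ℝ) (b ρ : Fin n → ℝ)
    (hb : ∀ k, 0 ≤ b k) (hρ : ∀ k, 0 ≤ ρ k)
    (u : Fin n → ℝ → Fin n → ℝ)
    (hu : ∀ k p a, u k p a = v k a - p - ρ k * max 0 (p - b k))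
    (m : ℝ) (r : Fin n → ℝ) (μ : Equiv.Perm (Fin n)) (hsum : ∑ a, r a = m)
    (hEF : ∀ k l : Fin n, u k (r (μ l)) (μ l) ≤ u k (r (μ k)) (μ k))
    (i j : Fin n)
    (hpath : Relation.ReflTransGen
      (fun k h : Fin n => u k (r (μ k)) (μ k) = u k (r (μ h)) (μ h)) j i)
    (δ : ℝ) (hδ : 0 < δ) :
    ∃ v' : Fin n → ℝ, ∀ (t : Fin n → ℝ) (σ : Equiv.Perm (Fin n)),
      (∑ a, t a = m) →
      (∀ k l : Fin n,
        (if k = i then v' (σ l) - t (σ l) else u k (t (σ l)) (σ l)) ≤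
          (if k = i then v' (σ k) - t (σ k) else u k (t (σ k)) (σ k))) →
      σ i = μ j ∧ t (μ j) ≤ r (μ j) + δ := by
  classical
  have hu' : ∀ k p a, u k p a = v k a - cost (b k) (ρ k) p := by
    intro k p a; rw [hu, cost]; ring
  have humono : ∀ k a, ∀ x y : ℝ, x < y → u k y a < u k x a := by
    intro k a x y hxy
    rw [hu', hu']; have := cost_strictMono (b := b k) (hρ k) hxy; linarith
  -- the compact set of candidate prices
  let K : Set (Fin n → ℝ) := ⋃ τ : Equiv.Perm (Fin n), {p | τ i = μ j ∧ ∑ a, p a = m ∧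
    p (μ j) ≤ r (μ j) ∧ ∀ k l : Fin n, k ≠ i → u k (p (τ l)) (τ l) ≤ u k (p (τ k)) (τ k)}
  have hKmem : ∀ p, p ∈ K ↔ ∃ τ : Equiv.Perm (Fin n), τ i = μ j ∧ ∑ a, p a = m ∧
    p (μ j) ≤ r (μ j) ∧ ∀ k l : Fin n, k ≠ i → u k (p (τ l)) (τ l) ≤ u k (p (τ k)) (τ k) := by
    intro p; simp [K]
  have hKclosed : IsClosed K := by
    refine isClosed_iUnion_of_finite fun τ => ?_
    have hcu : ∀ k a, Continuous (fun p : Fin n → ℝ => u k (p a) a) := by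
      intro k a
      simp only [hu']
      have := cost_continuous (b k) (ρ k)
      fun_prop
    have hset : {p : Fin n → ℝ | τ i = μ j ∧ ∑ a, p a = m ∧
        p (μ j) ≤ r (μ j) ∧ ∀ k l : Fin n, k ≠ i → u k (p (τ l)) (τ l) ≤ u k (p (τ k)) (τ k)} =
        {_p : Fin n → ℝ | τ i = μ j} ∩ ({p : Fin n → ℝ | ∑ a, p a = m} ∩
        ({p : Fin n → ℝ | p (μ j) ≤ r (μ j)} ∩ ⋂ k, ⋂ l, ⋂ _ : k ≠ i,
          {p : Fin n → ℝ | u k (p (τ l)) (τ l) ≤ u k (p (τ k)) (τ k)})) := by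
      ext p; simp
    rw [hset]
    refine isClosed_const.inter (IsClosed.inter ?_ (IsClosed.inter ?_ ?_))
    · exact isClosed_eq (by fun_prop) continuous_const
    · exact isClosed_le (by fun_prop) continuous_const
    · refine isClosed_iInter fun k => isClosed_iInter fun l => isClosed_iInter fun _ => ?_
      exact isClosed_le (hcu _ _) (hcu _ _)
  have hKne : r ∈ K := by
    rw [hKmem]
    obtain ⟨s, x, hs⟩ := SPath.of_path (fun _ _ => (0:ℝ)) hpath
    obtain ⟨π, h1, h2, -, -⟩ := SPath.perm (R := fun k h : Fin n => u k (r (μ k)) (μ k) = u k (r (μ h)) (μ h))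
      (fun _ => rfl) (fun _ => rfl) hs
    refine ⟨μ * π, by simp [h1], hsum, le_rfl, fun k l hk => ?_⟩
    simp only [Equiv.Perm.mul_apply]
    rw [← h2 k hk]
    exact hEF k (π l)
  obtain ⟨B, hB⟩ : ∃ B : ℝ, ∀ p ∈ K, ∀ a, p a ≤ B := by
    obtain ⟨B, hB⟩ : ∃ B : ℝ, ∀ k a, v k a - v k (μ j) + cost (b k) (ρ k) (r (μ j)) ≤ B := by
      obtain ⟨B, hB⟩ := (Set.finite_range (fun q : Fin n × Fin n =>
        v q.1 q.2 - v q.1 (μ j) + cost (b q.1) (ρ q.1) (r (μ j)))).bddAbove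
      exact ⟨B, fun k a => hB ⟨(k, a), rfl⟩⟩
    refine ⟨max B (r (μ j)), fun p hp a => ?_⟩
    obtain ⟨τ, h1, h2, h3, h4⟩ := (hKmem p).1 hp
    obtain ⟨k, rfl⟩ := τ.surjective a
    by_cases hk : k = i
    · subst hk; rw [h1]; exact h3.trans (le_max_right _ _)
    · refine le_trans ?_ (le_max_left _ _)
      have e1 := h4 k i hk
      rw [h1, hu', hu'] at e1
      have e2 := le_cost (b := b k) (hρ k) (p (τ k))
      have e3 := (cost_strictMono (b := b k) (hρ k)).monotone h3
      have e4 := hB k (τ k)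
      linarith
  have hKcomp : IsCompact K := by
    refine IsCompact.of_isClosed_subset
      (isCompact_Icc (a := fun _ : Fin n => m - ((Finset.univ.erase i).card : ℝ) * B)
        (b := fun _ => B)) hKclosed ?_
    intro p hp
    refine ⟨fun a => ?_, fun a => hB p hp a⟩
    obtain ⟨τ, h1, h2, h3, h4⟩ := (hKmem p).1 hp
    rw [← Finset.add_sum_erase _ _ (Finset.mem_univ a)] at h2
    have e := Finset.sum_le_card_nsmul (Finset.univ.erase a) p B (fun x _ => hB p hp x)
    rw [nsmul_eq_mul] at e
    have hcard : (Finset.univ.erase i).card = (Finset.univ.erase a).card := by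
      rw [Finset.card_erase_of_mem (Finset.mem_univ _), Finset.card_erase_of_mem (Finset.mem_univ _)]
    dsimp only
    rw [hcard]
    linarith
  obtain ⟨p, hpK, hpmin⟩ := hKcomp.exists_isMinOn ⟨r, hKne⟩
    (f := fun p => p (μ j)) (by fun_prop)
  obtain ⟨τ, hτi, hpsum, hpr, hpEF⟩ := (hKmem p).1 hpK
  have hreach : ∀ S : Finset (Fin n), i ∈ S → ∀ o, o ∉ S → ∃ k, k ∉ S ∧ ∃ h, h ∈ S ∧
      u k (p (τ h)) (τ h) = u k (p (τ k)) (τ k) := by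
    intro S hi o ho
    by_contra hcon
    push Not at hcon
    obtain ⟨q, σ, hσi, hqs, hqi, hqEF⟩ := perturb (fun k h => v k (τ h)) b ρ hρ i
      (fun h => p (τ h))
      (fun k hk h => by have := hpEF k h hk; rwa [hu', hu'] at this) S hi o ho
      (fun k hk h hh => by have := hcon k hk h hh; rwa [hu', hu'] at this)
    have hq : (fun a => q (τ.symm a)) ∈ K := by
      rw [hKmem]
      refine ⟨τ * σ, by simp [hσi, hτi], ?_, ?_, ?_⟩
      · rw [Equiv.sum_comp τ.symm q, hqs, Equiv.sum_comp τ p, hpsum]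
      · rw [← hτi, Equiv.symm_apply_apply]; rw [← hτi] at hpr; linarith
      · intro k l hk
        simp only [Equiv.Perm.mul_apply, Equiv.symm_apply_apply]
        rw [hu', hu']
        exact hqEF k hk (σ l)
    have := hpmin hq
    simp only [Set.mem_ofPred_eq] at this
    rw [← hτi, Equiv.symm_apply_apply] at this
    linarith
  refine ⟨fun a => p a + if a = μ j then δ else 0, fun t σ htsum htEF => ?_⟩
  have hi1 : ∀ a, (p a + if a = μ j then δ else 0) - t a ≤
      (p (σ i) + if σ i = μ j then δ else 0) - t (σ i) := by
    intro a
    have := htEF i (σ.symm a)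
    simpa only [if_true, Equiv.apply_symm_apply] using this
  have hk1 : ∀ k, k ≠ i → ∀ a, u k (t a) a ≤ u k (t (σ k)) (σ k) := by
    intro k hk a
    have := htEF k (σ.symm a)
    simpa only [if_neg hk, Equiv.apply_symm_apply] using this
  have hk2 : ∀ k, k ≠ i → ∀ a, u k (p a) a ≤ u k (p (τ k)) (τ k) := by
    intro k hk a
    have := hpEF k (τ.symm a) hk
    simpa only [Equiv.apply_symm_apply] using this
  have hstep : ∀ k, t (τ k) < p (τ k) → t (σ k) < p (σ k) := by
    intro k hk
    by_cases hki : k = i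
    · subst hki
      have := hi1 (τ k)
      rw [if_pos hτi] at this
      split_ifs at this <;> linarith
    · by_contra hcon
      push Not at hcon
      have e1 := hk1 k hki (τ k)
      have e2 := hk2 k hki (σ k)
      have e3 := humono k (τ k) _ _ hk
      have e4 : u k (t (σ k)) (σ k) ≤ u k (p (σ k)) (σ k) := by
        rcases hcon.lt_or_eq with h | h
        · exact (humono k (σ k) _ _ h).le
        · rw [h]
      linarith
  have hset : (Finset.univ.filter fun k => t (τ k) < p (τ k)) =
      (Finset.univ.filter fun k => t (σ k) < p (σ k)) := by
    apply Finset.eq_of_subset_of_card_le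
    · intro k hk
      simp only [Finset.mem_filter, Finset.mem_univ, true_and] at hk ⊢
      exact hstep k hk
    · have hc : ∀ π : Equiv.Perm (Fin n), (Finset.univ.filter fun k => t (π k) < p (π k)).card =
          (Finset.univ.filter fun a => t a < p a).card := by
        intro π
        refine Finset.card_equiv π ?_
        intro k; simp
      rw [hc, hc]
  have hiff : ∀ k, t (τ k) < p (τ k) ↔ t (σ k) < p (σ k) := by
    intro k
    have := Finset.ext_iff.1 hset k
    simpa using this
  have hexists : ∀ a, t a < p a → ∃ o, p o ≤ t o := by
    intro a ha
    by_contra hcon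
    push Not at hcon
    have := Finset.sum_lt_sum (s := Finset.univ) (f := t) (g := p) (fun x _ => (hcon x).le)
      ⟨a, Finset.mem_univ _, ha⟩
    linarith
  have hJ : p (μ j) ≤ t (μ j) := by
    by_contra hcon
    push Not at hcon
    obtain ⟨o, ho⟩ := hexists _ hcon
    obtain ⟨k, hk, h, hh, htight⟩ := hreach (Finset.univ.filter fun k => t (τ k) < p (τ k))
      (by simpa [hτi] using hcon) (τ.symm o) (by simpa using ho)
    simp only [Finset.mem_filter, Finset.mem_univ, true_and] at hk hh
    have hki : k ≠ i := by
      rintro rfl; rw [hτi] at hk; exact hk hcon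
    have hks : p (σ k) ≤ t (σ k) := by
      have := (hiff k).not.1 hk
      linarith
    have e1 := hk1 k hki (τ h)
    have e2 := humono k (τ h) _ _ hh
    have e3 := hk2 k hki (σ k)
    have e4 : u k (t (σ k)) (σ k) ≤ u k (p (σ k)) (σ k) := by
      rcases hks.lt_or_eq with h | h
      · exact (humono k (σ k) _ _ h).le
      · rw [h]
    linarith
  have hσJ : σ i = μ j := by
    by_contra hne
    have hd : p (σ i) ≤ t (σ i) := by
      have := (hiff i).not.1 (by rw [hτi]; linarith)
      linarith
    have hle : ∀ a, p a ≤ t a := by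
      intro a
      have := hi1 a
      rw [if_neg hne] at this
      split_ifs at this <;> linarith
    have hlt : p (μ j) < t (μ j) := by
      have := hi1 (μ j)
      rw [if_neg hne, if_pos rfl] at this
      linarith
    have := Finset.sum_lt_sum (s := Finset.univ) (f := p) (g := t) (fun x _ => hle x)
      ⟨_, Finset.mem_univ _, hlt⟩
    linarith
  refine ⟨hσJ, ?_⟩
  by_contra hcon
  push Not at hcon
  have hlt : ∀ a, p a < t a := by
    intro a
    have := hi1 a
    rw [if_pos hσJ, hσJ] at this
    split_ifs at this <;> linarith
  have := Finset.sum_lt_sum (s := Finset.univ) (f := p) (g := t) (fun x _ => (hlt x).le)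
    ⟨i, Finset.mem_univ _, hlt i⟩
  linarith
end

section
/- (Strong Manipulation Theorem, special case) There exist ω₁, ω₂ ∈ (0, 1), depending only on n and ρ̄, such that: for every profile v ∈ B^N, every envy-free allocation z = (r, μ) for v, every agent i with true continuous money-monotone preference u_i, and every agent j with u_i(z_j) > u_i(z_i), there exists a quasi-linear report v'_i such that at every envy-free allocation s of (v_{-i}, v'_i), u_i(s_i) ≥ min{ u_i(r_{μ(i)} − ω₁η, μ(i)), u_i(r_{μ(j)} + ω₂η, μ(j)) }, where η > 0 is defined by u_i(r_{μ(j)} + η, μ(j)) = u_i(z_i). -/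
open Filter Topology in
theorem ql_exists {n : ℕ} (hn : 0 < n) (W : Fin n → Fin n → ℝ) :
    ∃ (σ : Equiv.Perm (Fin n)) (y : Fin n → ℝ),
      ∀ k c, W k (σ k) + y (σ k) ≤ W k c + y c := by
  have : Nonempty (Fin n) := ⟨⟨0, hn⟩⟩
  have hne : (Finset.univ : Finset (Fin n)).Nonempty := Finset.univ_nonempty
  set M : (Fin n → ℝ) → Fin n → ℝ := fun y k => Finset.univ.inf' hne (fun c => W k c + y c) with hM
  have hMle : ∀ y k c, M y k ≤ W k c + y c := fun y k c =>
    Finset.inf'_le (fun c => W k c + y c) (Finset.mem_univ c)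
  have hMge : ∀ y k z, (∀ c, z ≤ W k c + y c) → z ≤ M y k := fun y k z h =>
    Finset.le_inf' hne _ (fun c _ => h c)
  have hMex : ∀ y k, ∃ c, M y k = W k c + y c := fun y k => by
    obtain ⟨c, -, hc⟩ := Finset.exists_mem_eq_inf' hne (fun c => W k c + y c)
    exact ⟨c, hc⟩
  set G : (Fin n → ℝ) → ℝ := fun y => ∑ k, M y k - ∑ c, y c with hG
  have hGcont : Continuous G := by
    have : ∀ k, Continuous fun y => M y k := fun k => by
      apply Continuous.finset_inf'_apply
      intro c _
      fun_prop
    fun_prop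
  obtain ⟨C, hC⟩ : ∃ C : ℝ, ∀ k c, |W k c| ≤ C := by
    refine ⟨∑ k, ∑ c, |W k c|, fun k c => ?_⟩
    calc |W k c| ≤ ∑ c, |W k c| :=
          Finset.single_le_sum (f := fun c => |W k c|) (fun _ _ => abs_nonneg _) (Finset.mem_univ c)
      _ ≤ _ := Finset.single_le_sum (f := fun k => ∑ c, |W k c|)
          (fun _ _ => Finset.sum_nonneg fun _ _ => abs_nonneg _) (Finset.mem_univ k)
  have hC0 : 0 ≤ C := (abs_nonneg _).trans (hC ⟨0, hn⟩ ⟨0, hn⟩)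
  have hn0 : (0:ℝ) ≤ n := Nat.cast_nonneg n
  have hR0 : 0 ≤ 2 * n * C := by positivity
  have hcomp : IsCompact (Set.Icc (fun _ : Fin n => (0:ℝ)) (fun _ => 2 * n * C)) := isCompact_Icc
  obtain ⟨y, hyB, hymax⟩ := hcomp.exists_isMaxOn
    ⟨fun _ => 0, Set.mem_Icc.2 ⟨le_refl _, fun _ => hR0⟩⟩ hGcont.continuousOn
  have hG0 : -(n * C) ≤ G (fun _ => 0) := by
    have : ∀ k ∈ (Finset.univ : Finset (Fin n)), -C ≤ M (fun _ => 0) k := fun k _ =>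
      hMge _ _ _ fun c => by have := (abs_le.1 (hC k c)).1; linarith
    have := Finset.sum_le_sum this
    simp at this
    simp only [hG]; simp; linarith
  have hglob : ∀ y', G y' ≤ G y := by
    intro y'
    obtain ⟨c0, -, hc0⟩ := Finset.exists_min_image Finset.univ y' hne
    set y2 : Fin n → ℝ := fun c => y' c - y' c0 with hy2
    have hGe : G y' ≤ G y2 := by
      have h1 : ∀ k ∈ (Finset.univ : Finset (Fin n)), M y' k - y' c0 ≤ M y2 k := fun k _ =>
        hMge _ _ _ fun c => by have := hMle y' k c; simp only [hy2]; linarith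
      have h2 := Finset.sum_le_sum h1
      simp only [hG, hy2, Finset.sum_sub_distrib, Finset.sum_const, Finset.card_univ,
        Fintype.card_fin, nsmul_eq_mul] at h2 ⊢
      linarith
    have hy20 : ∀ c, 0 ≤ y2 c := fun c => by
      have := hc0 c (Finset.mem_univ c); simp only [hy2]; linarith
    by_cases hb : ∀ c, y2 c ≤ 2 * n * C
    · exact hGe.trans (hymax (Set.mem_Icc.2 ⟨hy20, hb⟩))
    · push Not at hb
      obtain ⟨c, hc⟩ := hb
      have h1 : ∀ k ∈ (Finset.univ : Finset (Fin n)), M y2 k ≤ C := fun k _ => by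
        have := hMle y2 k c0
        have h3 := (abs_le.1 (hC k c0)).2
        have : y2 c0 = 0 := by simp [hy2]
        linarith
      have h2 := Finset.sum_le_sum h1
      have h3 : y2 c ≤ ∑ c, y2 c := Finset.single_le_sum (fun c _ => hy20 c) (Finset.mem_univ c)
      have h4 : G (fun _ => 0) ≤ G y := hymax (Set.mem_Icc.2 ⟨le_refl _, fun _ => hR0⟩)
      simp at h2
      have : G y2 = ∑ k, M y2 k - ∑ c, y2 c := rfl
      linarith
  classical
  set D : Fin n → Finset (Fin n) := fun k => Finset.univ.filter (fun c => W k c + y c = M y k) with hD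
  have hall : ∀ S : Finset (Fin n), S.card ≤ (S.biUnion D).card := by
    intro S
    by_contra hlt
    push Not at hlt
    set N := S.biUnion D with hN
    have hev : ∀ᶠ ε in 𝓝[>] (0:ℝ), ∀ k c, k ∈ S → c ∉ N → M y k + ε ≤ W k c + y c := by
      rw [eventually_all]; intro k
      rw [eventually_all]; intro c
      by_cases h : k ∈ S ∧ c ∉ N
      · have : M y k < W k c + y c := by
          refine lt_of_le_of_ne (hMle y k c) fun he => h.2 ?_
          rw [hN, Finset.mem_biUnion]
          exact ⟨k, h.1, by simp [hD, he]⟩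
        have : ∀ᶠ ε in 𝓝[>] (0:ℝ), ε < W k c + y c - M y k :=
          nhdsWithin_le_nhds (eventually_lt_nhds (by linarith))
        filter_upwards [this] with ε hε _ _
        linarith
      · filter_upwards with ε h1 h2
        exact absurd ⟨h1, h2⟩ h
    obtain ⟨ε, hε, hε0⟩ := (hev.and self_mem_nhdsWithin).exists
    have hε0 : 0 < ε := hε0
    set y' : Fin n → ℝ := fun c => y c + if c ∈ N then ε else 0 with hy'
    have hg := hglob y'
    have h1 : ∀ k ∈ (Finset.univ : Finset (Fin n)), M y k + (if k ∈ S then ε else 0) ≤ M y' k := by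
      intro k _
      apply hMge
      intro c
      have h5 := hMle y k c
      simp only [hy']
      by_cases hk : k ∈ S
      · by_cases hc : c ∈ N
        · simp [hk, hc]; linarith
        · have := hε k c hk hc
          simp [hk, hc]; linarith
      · simp only [hk, if_false]
        split_ifs <;> linarith
    have h2 := Finset.sum_le_sum h1
    have e1 : ∑ k, (if k ∈ S then ε else 0) = S.card * ε := by simp
    have e2 : ∑ k, (if k ∈ N then ε else 0) = N.card * ε := by simp
    have hlt' : (N.card : ℝ) + 1 ≤ S.card := by exact_mod_cast hlt
    simp only [hG, hy', Finset.sum_add_distrib] at hg h2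
    rw [e1] at h2
    rw [e2] at hg
    nlinarith
  obtain ⟨f, hfi, hf⟩ := (Finset.all_card_le_biUnion_card_iff_exists_injective D).1 hall
  refine ⟨Equiv.ofBijective f (Finite.injective_iff_bijective.1 hfi), y, fun k c => ?_⟩
  have := hf k
  simp only [hD, Finset.mem_filter, Finset.mem_univ, true_and] at this
  simp only [Equiv.ofBijective_apply]
  rw [this]
  exact hMle y k c

theorem match_exists {n : ℕ} (hn : 0 < n) (B : Fin n → Finset (Fin n)) (μ : Equiv.Perm (Fin n))
    (hμ : ∀ k, μ k ∈ B k) (lam : Fin n → Fin n → ℝ) (hlam : ∀ k c, 0 < lam k c) :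
    ∃ (σ : Equiv.Perm (Fin n)) (x : Fin n → ℝ), (∀ c, 0 < x c) ∧ (∀ k, σ k ∈ B k) ∧
      ∀ k, ∀ c ∈ B k, lam k (σ k) * x (σ k) ≤ lam k c * x c := by
  classical
  set L : Fin n → Fin n → ℝ := fun k c => Real.log (lam k c) with hL
  obtain ⟨C, hC0, hC⟩ : ∃ C : ℝ, 0 ≤ C ∧ ∀ k c, |L k c| ≤ C := by
    refine ⟨∑ k, ∑ c, |L k c|, Finset.sum_nonneg fun _ _ => Finset.sum_nonneg fun _ _ => abs_nonneg _,
      fun k c => ?_⟩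
    calc |L k c| ≤ ∑ c, |L k c| :=
          Finset.single_le_sum (f := fun c => |L k c|) (fun _ _ => abs_nonneg _) (Finset.mem_univ c)
      _ ≤ _ := Finset.single_le_sum (f := fun k => ∑ c, |L k c|)
          (fun _ _ => Finset.sum_nonneg fun _ _ => abs_nonneg _) (Finset.mem_univ k)
  set Q : ℝ := 2 * n * C + 1 with hQ
  have hQ0 : 0 < Q := by positivity
  obtain ⟨σ, y, h⟩ := ql_exists hn (fun k c => L k c + if c ∈ B k then 0 else Q)
  have hσ : ∀ k, σ k ∈ B k := by
    by_contra hcon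
    push Not at hcon
    obtain ⟨k0, hk0⟩ := hcon
    have h1 := Finset.sum_le_sum fun k (_ : k ∈ Finset.univ) => h k (μ k)
    simp only [hμ, if_true, Finset.sum_add_distrib, Equiv.sum_comp σ y, Equiv.sum_comp μ y] at h1
    have h2 : Q ≤ ∑ k, (if σ k ∈ B k then 0 else Q) := by
      have := Finset.single_le_sum (f := fun k => if σ k ∈ B k then 0 else Q)
        (fun k _ => by (try dsimp only); split_ifs <;> linarith) (Finset.mem_univ k0)
      simpa [hk0] using this
    have h3 : -(n * C) ≤ ∑ k, L k (σ k) := by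
      have := Finset.sum_le_sum fun k (_ : k ∈ Finset.univ) => (abs_le.1 (hC k (σ k))).1
      simpa using this
    have h4 : ∑ k, L k (μ k) ≤ n * C := by
      have := Finset.sum_le_sum fun k (_ : k ∈ Finset.univ) => (abs_le.1 (hC k (μ k))).2
      simpa using this
    simp at h1
    linarith
  refine ⟨σ, fun c => Real.exp (y c), fun c => Real.exp_pos _, hσ, fun k c hc => ?_⟩
  have := h k c
  simp only [hσ k, hc, if_true, add_zero] at this
  have h5 := Real.exp_le_exp.2 this
  simpa [hL, Real.exp_add, Real.exp_log (hlam _ _)] using h5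

/-- Envy-free for everybody but `i`, who sits at `a`. -/
def EFo {n : ℕ} (w : Fin n → ℝ → Fin n → ℝ) (i a : Fin n) (t : Fin n → ℝ)
    (μ : Equiv.Perm (Fin n)) : Prop :=
  μ i = a ∧ ∀ k, k ≠ i → ∀ c, w k (t c) c ≤ w k (t (μ k)) (μ k)

open Filter Topology in
theorem cut_prop {n : ℕ} (hn : 0 < n) (w : Fin n → ℝ → Fin n → ℝ)
    (hanti : ∀ k c, StrictAnti fun p => w k p c)
    (hcont : ∀ k c, Continuous fun p => w k p c)
    (hR : ∀ k p c, ∃ l : ℝ, 0 < l ∧ ∀ᶠ x in 𝓝[>] (0:ℝ), w k (p + x) c = w k p c - l * x)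
    (hL : ∀ k p c, ∃ l : ℝ, 0 < l ∧ ∀ᶠ x in 𝓝[>] (0:ℝ), w k (p - x) c = w k p c + l * x)
    (m : ℝ) (i a : Fin n) (t : Fin n → ℝ) (μ : Equiv.Perm (Fin n)) (htm : ∑ c, t c = m)
    (hEF : EFo w i a t μ)
    (hmin : ∀ s σ, ∑ c, s c = m → EFo w i a s σ → t a ≤ s a)
    (U : Finset (Fin n)) (hU : U.Nonempty) (haU : a ∉ U) :
    ∃ k, μ k ∈ U ∧ ∃ o, o ∉ U ∧ w k (t o) o = w k (t (μ k)) (μ k) := by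
  classical
  by_contra hcon
  push Not at hcon
  obtain ⟨hμi, hEF⟩ := hEF
  choose lR hlR hlR' using hR
  choose lL hlL hlL' using hL
  set B : Fin n → Finset (Fin n) := fun k => Finset.univ.filter fun c =>
    (k = i → c = a) ∧ (c ∈ U ↔ μ k ∈ U) ∧ w k (t c) c = w k (t (μ k)) (μ k) with hB
  have hμB : ∀ k, μ k ∈ B k := fun k => by
    simp only [hB, Finset.mem_filter, Finset.mem_univ, true_and, and_true, iff_self]
    rintro rfl; exact hμi
  obtain ⟨σ, x, hx, hσB, hσ⟩ := match_exists hn B μ hμB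
    (fun k c => if c ∈ U then lR k (t c) c else (lL k (t c) c)⁻¹)
    (fun k c => by (try dsimp only); split_ifs; exacts [hlR _ _ _, inv_pos.2 (hlL _ _ _)])
  have hBm : ∀ k c, c ∈ B k ↔ (k = i → c = a) ∧ (c ∈ U ↔ μ k ∈ U) ∧
      w k (t c) c = w k (t (μ k)) (μ k) := fun k c => by simp [hB]
  set α := ∑ c ∈ Uᶜ, (x c)⁻¹ with hα
  set β := ∑ c ∈ U, x c with hβ
  have hα0 : 0 < α := Finset.sum_pos (fun c _ => inv_pos.2 (hx c)) ⟨a, by simpa using haU⟩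
  have hβ0 : 0 < β := Finset.sum_pos (fun c _ => hx c) hU
  set s : ℝ → Fin n → ℝ := fun ε c => if c ∈ U then t c + ε * α * x c else t c - ε * β * (x c)⁻¹
    with hs
  have hsum : ∀ ε, ∑ c, s ε c = m := by
    intro ε
    rw [← Finset.sum_add_sum_compl U]
    have e1 : ∑ c ∈ U, s ε c = ∑ c ∈ U, t c + ε * α * β := by
      rw [hβ, Finset.mul_sum, ← Finset.sum_add_distrib]
      exact Finset.sum_congr rfl fun c hc => by simp [hs, hc]
    have e2 : ∑ c ∈ Uᶜ, s ε c = ∑ c ∈ Uᶜ, t c - ε * β * α := by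
      rw [hα, Finset.mul_sum, ← Finset.sum_sub_distrib]
      exact Finset.sum_congr rfl fun c hc => by
        have : c ∉ U := by simpa using hc
        simp [hs, this]
    rw [e1, e2, ← htm, ← Finset.sum_add_sum_compl U t]; ring
  have htend : ∀ z : ℝ, 0 < z → Tendsto (fun ε : ℝ => ε * z) (𝓝[>] 0) (𝓝[>] 0) := by
    intro z hz
    refine tendsto_nhdsWithin_iff.2 ⟨?_, ?_⟩
    · have : Tendsto (fun ε : ℝ => ε * z) (𝓝 0) (𝓝 (0 * z)) := tendsto_id.mul_const z
      rw [zero_mul] at this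
      exact this.mono_left nhdsWithin_le_nhds
    · filter_upwards [self_mem_nhdsWithin] with ε hε
      exact mul_pos hε hz
  have hscont : ∀ c, Continuous fun ε => s ε c := by
    intro c
    by_cases hc : c ∈ U <;> simp only [hs, hc, if_true, if_false] <;> fun_prop
  have hs0 : ∀ c, s 0 c = t c := fun c => by simp [hs]
  have hev : ∀ᶠ ε in 𝓝[>] (0:ℝ), ∀ k c, k ≠ i → w k (s ε c) c ≤ w k (s ε (σ k)) (σ k) := by
    rw [eventually_all]; intro k
    rw [eventually_all]; intro c
    by_cases hk : k = i
    · filter_upwards with ε h; exact absurd hk h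
    have hb := (hBm k (σ k)).1 (hσB k)
    by_cases hc : c ∈ B k
    · have hcb := (hBm k c).1 hc
      have hl := hσ k c hc
      by_cases hmu : μ k ∈ U
      · have h1 : σ k ∈ U := hb.2.1.2 hmu
        have h2 : c ∈ U := hcb.2.1.2 hmu
        have r1 := (htend (α * x c) (mul_pos hα0 (hx c))).eventually (hlR' k (t c) c)
        have r2 := (htend (α * x (σ k)) (mul_pos hα0 (hx _))).eventually (hlR' k (t (σ k)) (σ k))
        simp only [h1, h2, if_true] at hl
        filter_upwards [r1, r2, self_mem_nhdsWithin] with ε e1 e2 hε _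
        have hε : 0 < ε := hε
        simp only [hs, h1, h2, if_true, mul_assoc]
        rw [e1, e2, hb.2.2, hcb.2.2]
        have := mul_le_mul_of_nonneg_left hl (mul_pos hε hα0).le
        nlinarith
      · have h1 : σ k ∉ U := fun h => hmu (hb.2.1.1 h)
        have h2 : c ∉ U := fun h => hmu (hcb.2.1.1 h)
        have r1 := (htend (β * (x c)⁻¹) (mul_pos hβ0 (inv_pos.2 (hx c)))).eventually
          (hlL' k (t c) c)
        have r2 := (htend (β * (x (σ k))⁻¹) (mul_pos hβ0 (inv_pos.2 (hx _)))).eventually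
          (hlL' k (t (σ k)) (σ k))
        simp only [h1, h2, if_false] at hl
        have hl2 : lL k (t c) c * (x c)⁻¹ ≤ lL k (t (σ k)) (σ k) * (x (σ k))⁻¹ := by
          have := inv_anti₀ (mul_pos (inv_pos.2 (hlL k (t (σ k)) (σ k))) (hx (σ k))) hl
          simpa [mul_inv, mul_comm] using this
        filter_upwards [r1, r2, self_mem_nhdsWithin] with ε e1 e2 hε _
        have hε : 0 < ε := hε
        simp only [hs, h1, h2, if_false, mul_assoc]
        rw [e1, e2, hb.2.2, hcb.2.2]
        have := mul_le_mul_of_nonneg_left hl2 (mul_pos hε hβ0).le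
        nlinarith
    · by_cases hx2 : μ k ∉ U ∧ c ∈ U
      · have h1 : σ k ∉ U := fun h => hx2.1 (hb.2.1.1 h)
        filter_upwards [self_mem_nhdsWithin] with ε hε _
        have hε : 0 < ε := hε
        have a1 : t c ≤ s ε c := by
          simp only [hs, hx2.2, if_true]
          have := mul_pos (mul_pos hε hα0) (hx c)
          linarith
        have a2 : s ε (σ k) ≤ t (σ k) := by
          simp only [hs, h1, if_false]
          have := mul_pos (mul_pos hε hβ0) (inv_pos.2 (hx (σ k)))
          linarith
        have b1 := (hanti k c).antitone a1
        have b2 := (hanti k (σ k)).antitone a2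
        have b3 := hEF k hk c
        have b4 := hb.2.2
        try simp only at b1 b2
        linarith
      · have hlt : w k (t c) c < w k (t (σ k)) (σ k) := by
          rw [hb.2.2]
          refine lt_of_le_of_ne (hEF k hk c) fun he => ?_
          by_cases hmu : μ k ∈ U
          · by_cases hcU : c ∈ U
            · exact hc ((hBm k c).2 ⟨fun h => absurd h hk, by simp [hmu, hcU], he⟩)
            · exact hcon k hmu c hcU he
          · have hcU : c ∉ U := fun h => hx2 ⟨hmu, h⟩
            exact hc ((hBm k c).2 ⟨fun h => absurd h hk, by simp [hmu, hcU], he⟩)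
        have c1 : Continuous fun ε => w k (s ε c) c := (hcont k c).comp (hscont c)
        have c2 : Continuous fun ε => w k (s ε (σ k)) (σ k) := (hcont k (σ k)).comp (hscont (σ k))
        have : ∀ᶠ ε in 𝓝 (0:ℝ), w k (s ε c) c < w k (s ε (σ k)) (σ k) :=
          c1.continuousAt.eventually_lt c2.continuousAt (by simpa only [hs0] using hlt)
        filter_upwards [nhdsWithin_le_nhds this] with ε h _
        exact h.le
  obtain ⟨ε, hε, hε0⟩ := (hev.and self_mem_nhdsWithin).exists
  have hε0 : 0 < ε := hε0
  have := hmin (s ε) σ (hsum ε) ⟨((hBm i (σ i)).1 (hσB i)).1 rfl, fun k hk c => hε k c hk⟩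
  simp only [hs, haU, if_false] at this
  have := mul_pos (mul_pos hε0 hβ0) (inv_pos.2 (hx a))
  linarith

theorem manip {n : ℕ} (hn : 0 < n) (w : Fin n → ℝ → Fin n → ℝ)
    (hanti : ∀ k c, StrictAnti fun p => w k p c)
    (m : ℝ) (i a : Fin n) (t : Fin n → ℝ) (μ : Equiv.Perm (Fin n)) (htm : ∑ c, t c = m)
    (hEF : EFo w i a t μ)
    (hcut : ∀ U : Finset (Fin n), U.Nonempty → a ∉ U →
      ∃ k, μ k ∈ U ∧ ∃ o, o ∉ U ∧ w k (t o) o = w k (t (μ k)) (μ k))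
    (e : Fin n) (ε : ℝ) (hε : 0 < ε) (s : Fin n → ℝ) (σ : Equiv.Perm (Fin n))
    (hsm : ∑ c, s c = m) (hs : EFo w i (σ i) s σ)
    (hi : ∀ c, (t c + if c = e then ε else 0) - s c ≤
      (t (σ i) + if σ i = e then ε else 0) - s (σ i)) :
    σ i = e ∧ s e ≤ t e + ε := by
  classical
  have hn' : (0:ℝ) < n := by exact_mod_cast hn
  have key : σ i = e := by
    by_contra hne
    simp only [hne, if_false, add_zero] at hi
    have h1 : ∑ c, ((t c + if c = e then ε else 0) - s c) ≤ ∑ c : Fin n, (t (σ i) - s (σ i)) :=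
      Finset.sum_le_sum fun c _ => hi c
    simp [Finset.sum_add_distrib, htm, hsm] at h1
    have hneg : s (σ i) < t (σ i) := by
      by_contra h; push Not at h
      have : (n:ℝ) * (t (σ i) - s (σ i)) ≤ 0 := mul_nonpos_of_nonneg_of_nonpos hn'.le (by linarith)
      linarith
    set P : Finset (Fin n) := Finset.univ.filter fun c => t c < s c with hP
    have hPm : ∀ c, c ∈ P ↔ t c < s c := fun c => by simp [hP]
    have hPne : P.Nonempty := by
      by_contra h
      rw [Finset.not_nonempty_iff_eq_empty] at h
      have : ∑ c, s c < ∑ c, t c := Finset.sum_lt_sum (fun c _ => by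
        by_contra h2; push Not at h2
        have := (hPm c).2 h2
        simp [h] at this) ⟨σ i, Finset.mem_univ _, hneg⟩
      linarith
    have hsub : ∀ k, σ k ∈ P → μ k ∈ P := by
      intro k hk
      have hki : k ≠ i := by
        rintro rfl
        have := (hPm _).1 hk; linarith
      rw [hPm] at hk ⊢
      by_contra h; push Not at h
      have b1 := hs.2 k hki (μ k)
      have b2 := hEF.2 k hki (σ k)
      have b3 := (hanti k (σ k)) hk
      have b4 := (hanti k (μ k)).antitone h
      try simp only at b3 b4
      linarith
    have heq : P.map σ.symm.toEmbedding = P.map μ.symm.toEmbedding := by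
      apply Finset.eq_of_subset_of_card_le
      · intro k hk
        simp only [Finset.mem_map_equiv, Equiv.symm_symm] at hk ⊢
        exact hsub k hk
      · simp
    have hiff : ∀ k, σ k ∈ P ↔ μ k ∈ P := fun k => by
      have : k ∈ P.map σ.symm.toEmbedding ↔ k ∈ P.map μ.symm.toEmbedding := by rw [heq]
      simpa only [Finset.mem_map_equiv, Equiv.symm_symm] using this
    have haP : a ∉ P := by
      intro h
      rw [← hEF.1, ← hiff, hPm] at h
      linarith
    obtain ⟨k, hk, o, ho, hko⟩ := hcut P hPne haP
    have hki : k ≠ i := by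
      rintro rfl
      rw [hEF.1] at hk; exact haP hk
    have hσk := (hiff k).2 hk
    rw [hPm] at hσk ho
    push Not at ho
    have b1 := hs.2 k hki o
    have b2 := hEF.2 k hki (σ k)
    have b3 := (hanti k (σ k)) hσk
    have b4 := (hanti k o).antitone ho
    try simp only at b3 b4
    linarith
  refine ⟨key, ?_⟩
  rw [key] at hi
  simp only [if_true] at hi
  have h1 : ∑ c, (t c - s c) ≤ ∑ c : Fin n, (t e + ε - s e) :=
    Finset.sum_le_sum fun c _ => by
      have := hi c
      split_ifs at this <;> linarith
  simp [htm, hsm] at h1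
  have : s e ≤ t e + ε := le_of_mul_le_mul_left (by linarith) hn'
  linarith

theorem lower_bd {n : ℕ} (w : Fin n → ℝ → Fin n → ℝ) (K : ℝ) (hK : 1 ≤ K)
    (hw1 : ∀ k p q c, p ≤ q → q - p ≤ w k p c - w k q c)
    (hw2 : ∀ k p q c, p ≤ q → w k p c - w k q c ≤ K * (q - p))
    (m : ℝ) (i a : Fin n) (r t : Fin n → ℝ) (μ ν : Equiv.Perm (Fin n))
    (hrm : ∑ c, r c = m) (htm : ∑ c, t c = m)
    (hr : EFo w i a r μ) (ht : EFo w i a t ν)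
    (hcut : ∀ U : Finset (Fin n), U.Nonempty → a ∉ U →
      ∃ k, ν k ∈ U ∧ ∃ o, o ∉ U ∧ w k (t o) o = w k (t (ν k)) (ν k))
    (X : ℝ) (hX : 0 ≤ X) (hXa : r a - X ≤ t a) (d : Fin n) :
    t d ≤ r d + n * K ^ n * X := by
  classical
  have edge : ∀ k c Y, 0 ≤ Y → k ≠ i → w k (t (μ k)) (μ k) ≤ w k (t c) c → r c - Y ≤ t c →
      r (μ k) - K * Y ≤ t (μ k) := by
    intro k c Y hY hk h1 h2
    have h3 := hr.2 k hk c
    by_contra hlt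
    push Not at hlt
    have hKY : 0 ≤ K * Y := by positivity
    have h4 := hw1 k (t (μ k)) (r (μ k)) (μ k) (by linarith)
    rcases le_total (t c) (r c) with h5 | h5
    · have h6 := hw2 k _ _ c h5
      have : K * (r c - t c) ≤ K * Y := mul_le_mul_of_nonneg_left (by linarith) (by linarith)
      linarith
    · have h6 := hw1 k _ _ c h5
      linarith
  set S : ℕ → Finset (Fin n) := fun j => Finset.univ.filter fun c => r c - K ^ j * X ≤ t c with hS
  have hSm : ∀ j c, c ∈ S j ↔ r c - K ^ j * X ≤ t c := fun j c => by simp [hS]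
  have hmono : ∀ j, S j ⊆ S (j+1) := by
    intro j c hc
    rw [hSm] at hc ⊢
    have : K ^ j * X ≤ K ^ (j+1) * X := by
      apply mul_le_mul_of_nonneg_right _ hX
      exact pow_le_pow_right₀ hK (by omega)
    linarith
  have haS : ∀ j, a ∈ S j := by
    intro j
    induction j with
    | zero => rw [hSm]; simpa using hXa
    | succ j ih => exact hmono j ih
  have hstep : ∀ j, S j ≠ Finset.univ → ∃ e, e ∉ S j ∧ e ∈ S (j+1) := by
    intro j hj
    have hY : 0 ≤ K ^ j * X := by positivity
    have hUne : ((S j)ᶜ).Nonempty := by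
      rw [Finset.nonempty_iff_ne_empty]
      simpa using hj
    have haU : a ∉ (S j)ᶜ := by simpa using haS j
    obtain ⟨k, hk, o, ho, hko⟩ := hcut _ hUne haU
    have hki : k ≠ i := by
      rintro rfl
      rw [ht.1] at hk; exact haU hk
    have ho' : o ∈ S j := by simpa using ho
    by_cases he : μ k ∈ S j
    · have : ∃ k', ν k' ∉ (S j)ᶜ ∧ μ k' ∈ (S j)ᶜ := by
        by_contra hcon
        push Not at hcon
        have heq : ((S j)ᶜ).map μ.symm.toEmbedding = ((S j)ᶜ).map ν.symm.toEmbedding := by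
          apply Finset.eq_of_subset_of_card_le
          · intro k hk
            simp only [Finset.mem_map_equiv, Equiv.symm_symm] at hk ⊢
            by_contra h
            exact hcon k h hk
          · simp
        have : k ∈ ((S j)ᶜ).map μ.symm.toEmbedding := by
          rw [heq]; simpa only [Finset.mem_map_equiv, Equiv.symm_symm] using hk
        simp only [Finset.mem_map_equiv, Equiv.symm_symm, Finset.mem_compl] at this
        exact this he
      obtain ⟨k', h1, h2⟩ := this
      have hki' : k' ≠ i := by
        rintro rfl
        rw [hr.1] at h2; exact haU h2
      refine ⟨μ k', by simpa using h2, ?_⟩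
      have h1' : ν k' ∈ S j := by simpa using h1
      rw [hSm] at h1' ⊢
      have := edge k' (ν k') _ hY hki' (ht.2 k' hki' _) h1'
      rw [pow_succ']; linarith
    · refine ⟨μ k, he, ?_⟩
      rw [hSm] at ho' ⊢
      have := edge k o _ hY hki (by rw [hko]; exact ht.2 k hki _) ho'
      rw [pow_succ']; linarith
  have hcard : ∀ j, S j = Finset.univ ∨ j ≤ (S j).card := by
    intro j
    induction j with
    | zero => right; simp
    | succ j ih =>
      by_cases hj : S j = Finset.univ
      · left
        exact Finset.univ_subset_iff.1 (hj ▸ hmono j)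
      · right
        obtain ⟨e, he1, he2⟩ := hstep j hj
        have := Finset.card_lt_card (Finset.ssubset_iff_subset_ne.2
          ⟨hmono j, fun h => he1 (h ▸ he2)⟩)
        have := ih.resolve_left hj
        omega
  have hall : ∀ c, c ∈ S n := by
    rcases hcard n with h | h
    · simp [h]
    · have : S n = Finset.univ := by
        rw [← Finset.card_eq_iff_eq_univ]
        have := Finset.card_le_univ (S n)
        simp at this ⊢
        omega
      simp [this]
  have h1 : t d - r d + K ^ n * X ≤ ∑ c, (t c - r c + K ^ n * X) :=
    Finset.single_le_sum (f := fun c => t c - r c + K ^ n * X)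
      (fun c _ => by have := (hSm n c).1 (hall c); (try dsimp only); linarith) (Finset.mem_univ d)
  simp [Finset.sum_add_distrib, htm, hrm] at h1
  have : 0 ≤ K ^ n * X := by positivity
  linarith

theorem min_exists {n : ℕ} (w : Fin n → ℝ → Fin n → ℝ)
    (hcont : ∀ k c, Continuous fun p => w k p c)
    (hw1 : ∀ k p q c, p ≤ q → q - p ≤ w k p c - w k q c)
    (m : ℝ) (i a : Fin n) (r : Fin n → ℝ) (μ : Equiv.Perm (Fin n))
    (hrm : ∑ c, r c = m) (hr : EFo w i a r μ) :
    ∃ (t : Fin n → ℝ) (ν : Equiv.Perm (Fin n)), ∑ c, t c = m ∧ EFo w i a t ν ∧ t a ≤ r a ∧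
      ∀ s σ, ∑ c, s c = m → EFo w i a s σ → t a ≤ s a := by
  classical
  set E : Set (Fin n → ℝ) := {t | ∑ c, t c = m ∧ t a ≤ r a ∧ ∃ ν, EFo w i a t ν} with hE
  have hclosed : IsClosed E := by
    have : E = {t | ∑ c, t c = m} ∩ {t | t a ≤ r a} ∩ ⋃ ν : Equiv.Perm (Fin n), {t | EFo w i a t ν} := by
      ext t; simp [hE, and_assoc]
    rw [this]
    refine IsClosed.inter (IsClosed.inter ?_ ?_) ?_
    · exact isClosed_eq (by fun_prop) continuous_const
    · exact isClosed_le (by fun_prop) continuous_const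
    · refine isClosed_iUnion_of_finite fun ν => ?_
      simp only [EFo, Set.ofPred_and, Set.ofPred_forall]
      refine IsClosed.inter isClosed_const ?_
      refine isClosed_iInter fun k => isClosed_iInter fun _ => isClosed_iInter fun c => ?_
      exact isClosed_le ((hcont k c).comp (continuous_apply c))
        ((hcont k (ν k)).comp (continuous_apply (ν k)))
  set T : ℝ := |r a| + ∑ k, ∑ c, (|r a| + |w k (r a) c - w k (r a) a|) with hT
  have hTge : ∀ k c, |r a| + |w k (r a) c - w k (r a) a| ≤ T := by
    intro k c
    have h1 : |r a| + |w k (r a) c - w k (r a) a| ≤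
        ∑ c, (|r a| + |w k (r a) c - w k (r a) a|) :=
      Finset.single_le_sum (f := fun c => |r a| + |w k (r a) c - w k (r a) a|)
        (fun _ _ => by positivity) (Finset.mem_univ c)
    have h2 : ∑ c, (|r a| + |w k (r a) c - w k (r a) a|) ≤
        ∑ k, ∑ c, (|r a| + |w k (r a) c - w k (r a) a|) :=
      Finset.single_le_sum (f := fun k => ∑ c, (|r a| + |w k (r a) c - w k (r a) a|))
        (fun _ _ => by positivity) (Finset.mem_univ k)
    have := abs_nonneg (r a)
    linarith
  have hub : ∀ t ∈ E, ∀ c, t c ≤ T := by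
    rintro t ⟨-, h2, ν, hν⟩ c
    by_cases hc : ν.symm c = i
    · have hca : c = a := by rw [← hν.1, ← hc]; simp
      have := hTge i a
      have := le_abs_self (r a)
      have := abs_nonneg (w i (r a) a - w i (r a) a)
      rw [hca]; linarith
    · set k := ν.symm c
      have hk : ν k = c := by simp [k]
      have h3 := hν.2 k hc a
      rw [hk] at h3
      have h4 := hw1 k _ _ a h2
      have h5 := hTge k c
      have h6 := le_abs_self (r a)
      have h7 := le_abs_self (w k (r a) c - w k (r a) a)
      have h9 := abs_nonneg (w k (r a) c - w k (r a) a)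
      by_contra hlt
      push Not at hlt
      have h8 := hw1 k (r a) (t c) c (by linarith)
      linarith
  have hcompact : IsCompact E := by
    refine (isCompact_Icc (a := fun _ : Fin n => m + T - n * T) (b := fun _ => T)).of_isClosed_subset
      hclosed fun t ht => Set.mem_Icc.2 ⟨fun c => ?_, hub t ht⟩
    have h1 : T - t c ≤ ∑ c, (T - t c) :=
      Finset.single_le_sum (f := fun c => T - t c)
        (fun c _ => by have := hub t ht c; (try dsimp only); linarith) (Finset.mem_univ c)
    simp [ht.1] at h1
    dsimp only
    linarith
  obtain ⟨t, ht, htmin⟩ := hcompact.exists_isMinOn ⟨r, hrm, le_refl _, μ, hr⟩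
    (continuous_apply a).continuousOn
  obtain ⟨h1, h2, ν, hν⟩ := ht
  refine ⟨t, ν, h1, hν, h2, fun s σ hs hσ => ?_⟩
  rcases le_total (s a) (r a) with h | h
  · exact htmin (show s ∈ E from ⟨hs, h, σ, hσ⟩)
  · exact h2.trans h

open Filter Topology in
theorem bud_props (v b ρ K : ℝ) (hρ : 0 ≤ ρ) (hρK : 1 + ρ ≤ K) (g : ℝ → ℝ)
    (hg : ∀ p, g p = v - p - ρ * max 0 (p - b)) :
    (∀ p q, p ≤ q → q - p ≤ g p - g q) ∧ (∀ p q, p ≤ q → g p - g q ≤ K * (q - p)) ∧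
    Continuous g ∧
    (∀ p, ∃ l : ℝ, 0 < l ∧ ∀ᶠ x in 𝓝[>] (0:ℝ), g (p + x) = g p - l * x) ∧
    (∀ p, ∃ l : ℝ, 0 < l ∧ ∀ᶠ x in 𝓝[>] (0:ℝ), g (p - x) = g p + l * x) := by
  refine ⟨?_, ?_, ?_, ?_, ?_⟩
  · intro p q h
    rw [hg, hg]
    have : max 0 (p - b) ≤ max 0 (q - b) := max_le_max le_rfl (by linarith)
    nlinarith
  · intro p q h
    rw [hg, hg]
    have : max 0 (q - b) ≤ max 0 (p - b) + (q - p) := by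
      apply max_le
      · have := le_max_left 0 (p - b); linarith
      · have := le_max_right 0 (p - b); linarith
    nlinarith
  · rw [funext hg]; fun_prop
  · intro p
    by_cases h : b ≤ p
    · refine ⟨1 + ρ, by linarith, ?_⟩
      filter_upwards [self_mem_nhdsWithin] with x hx
      have hx : 0 < x := hx
      rw [hg, hg, max_eq_right (by linarith), max_eq_right (by linarith)]; ring
    · push Not at h
      refine ⟨1, one_pos, ?_⟩
      have : ∀ᶠ x in 𝓝[>] (0:ℝ), x < b - p :=
        nhdsWithin_le_nhds (eventually_lt_nhds (by linarith))
      filter_upwards [this] with x hx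
      rw [hg, hg, max_eq_left (by linarith), max_eq_left (by linarith)]; ring
  · intro p
    by_cases h : p ≤ b
    · refine ⟨1, one_pos, ?_⟩
      filter_upwards [self_mem_nhdsWithin] with x hx
      have hx : 0 < x := hx
      rw [hg, hg, max_eq_left (by linarith), max_eq_left (by linarith)]; ring
    · push Not at h
      refine ⟨1 + ρ, by linarith, ?_⟩
      have : ∀ᶠ x in 𝓝[>] (0:ℝ), x < p - b :=
        nhdsWithin_le_nhds (eventually_lt_nhds (by linarith))
      filter_upwards [this] with x hx
      rw [hg, hg, max_eq_right (by linarith), max_eq_right (by linarith)]; ring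


/-- Strong Manipulation Theorem: there are `ω₁, ω₂ ∈ (0, 1)`,
depending only on `n` and `ρ̄`, such that for every budget-constrained reported
profile, every envy-free allocation `z = (r, μ)` for it, every agent `i` with
true continuous money-monotone preference `ui` (satisfying compensation), and
every `j` with `u_i(z_j) > u_i(z_i)`, where `η > 0` solves
`u_i(r_{μ(j)} + η, μ(j)) = u_i(z_i)`, agent `i` has a quasi-linear report `v'`
guaranteeing at every envy-free allocation `(t, σ)` of the amended profile
utility at least
`min { u_i(r_{μ(i)} − ω₁η, μ(i)), u_i(r_{μ(j)} + ω₂η, μ(j)) }`. -/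
theorem stmt_13 (n : ℕ) (ρbar : ℝ) (hρbar : 0 ≤ ρbar) :
    ∃ ω₁ ∈ Set.Ioo (0:ℝ) 1, ∃ ω₂ ∈ Set.Ioo (0:ℝ) 1,
    ∀ (v : Fin n → Fin n → ℝ) (b ρ : Fin n → ℝ),
    (∀ k, 0 ≤ b k) → (∀ k, 0 ≤ ρ k) → (∀ k, ρ k ≤ ρbar) →
    ∀ (w : Fin n → ℝ → Fin n → ℝ),
    (∀ k p a, w k p a = v k a - p - ρ k * max 0 (p - b k)) →
    ∀ (m : ℝ) (r : Fin n → ℝ) (μ : Equiv.Perm (Fin n)),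
    (∑ a, r a = m) →
    (∀ k l : Fin n, w k (r (μ l)) (μ l) ≤ w k (r (μ k)) (μ k)) →
    ∀ (i : Fin n) (ui : ℝ → Fin n → ℝ),
    (∀ a, Continuous fun p => ui p a) →
    (∀ a, StrictAnti fun p => ui p a) →
    (∀ a c : Fin n, ∀ p : ℝ, ∃ q : ℝ, ui p a = ui q c) →
    ∀ j : Fin n, ui (r (μ i)) (μ i) < ui (r (μ j)) (μ j) →
    ∀ η : ℝ, 0 < η → ui (r (μ j) + η) (μ j) = ui (r (μ i)) (μ i) →
    ∃ v' : Fin n → ℝ, ∀ (t : Fin n → ℝ) (σ : Equiv.Perm (Fin n)),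
      (∑ a, t a = m) →
      (∀ k l : Fin n,
        (if k = i then v' (σ l) - t (σ l) else w k (t (σ l)) (σ l)) ≤
          (if k = i then v' (σ k) - t (σ k) else w k (t (σ k)) (σ k))) →
      min (ui (r (μ i) - ω₁ * η) (μ i)) (ui (r (μ j) + ω₂ * η) (μ j)) ≤
        ui (t (σ i)) (σ i) := by
  set K : ℝ := 1 + ρbar with hK
  have hK1 : 1 ≤ K := by linarith
  have hKn : 1 ≤ K ^ n := one_le_pow₀ hK1
  have hn0 : (0:ℝ) ≤ n := Nat.cast_nonneg n
  have hden : 0 < 4 * (n + 1) * K ^ n := by positivity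
  set ω : ℝ := 1 / (4 * (n + 1) * K ^ n) with hω
  have hω0 : 0 < ω := by positivity
  have hωe : 4 * (n + 1) * K ^ n * ω = 1 := by rw [hω]; field_simp
  have hnK : 0 ≤ n * K ^ n := by positivity
  have hω1 : ω < 1 := by
    have : 1 < 4 * (n + 1) * K ^ n := by nlinarith
    rw [hω, div_lt_one hden]; exact this
  refine ⟨ω, ⟨hω0, hω1⟩, 1/2, ⟨by norm_num, by norm_num⟩, ?_⟩
  intro v b ρ _ hρ0 hρb w hw m r μ hrm hEF i ui _ hui _ j _ η hη _
  have hn : 0 < n := Fin.pos i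
  have P := fun k c => bud_props (v k c) (b k) (ρ k) K (hρ0 k) (by have := hρb k; linarith)
    (fun p => w k p c) (fun p => hw k p c)
  have hw1 : ∀ k p q c, p ≤ q → q - p ≤ w k p c - w k q c := fun k p q c => (P k c).1 p q
  have hw2 : ∀ k p q c, p ≤ q → w k p c - w k q c ≤ K * (q - p) := fun k p q c => (P k c).2.1 p q
  have hcont : ∀ k c, Continuous fun p => w k p c := fun k c => (P k c).2.2.1
  have hanti : ∀ k c, StrictAnti fun p => w k p c := fun k c p q h => by
    have := hw1 k p q c h.le
    (try dsimp only); linarith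
  have hr : EFo w i (μ i) r μ := ⟨rfl, fun k _ c => by
    have := hEF k (μ.symm c)
    simpa using this⟩
  obtain ⟨t, ν, htm, hν, htr, hmin⟩ := min_exists w hcont hw1 m i (μ i) r μ hrm hr
  have hcut := cut_prop hn w hanti hcont (fun k p c => (P k c).2.2.2.1 p)
    (fun k p c => (P k c).2.2.2.2 p) m i (μ i) t ν htm hν hmin
  have hωη : 0 < ω * η := by positivity
  have man : ∀ e : Fin n, ∃ v' : Fin n → ℝ, ∀ (s : Fin n → ℝ) (σ : Equiv.Perm (Fin n)),
      (∑ a, s a = m) →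
      (∀ k l : Fin n,
        (if k = i then v' (σ l) - s (σ l) else w k (s (σ l)) (σ l)) ≤
          (if k = i then v' (σ k) - s (σ k) else w k (s (σ k)) (σ k))) →
      σ i = e ∧ s e ≤ t e + ω * η := by
    intro e
    refine ⟨fun c => t c + if c = e then ω * η else 0, fun s σ hs hE => ?_⟩
    refine manip hn w hanti m i (μ i) t ν htm hν hcut e (ω * η) hωη s σ hs ⟨rfl, ?_⟩ ?_
    · intro k hk c
      have := hE k (σ.symm c)
      simpa [hk] using this
    · intro c
      have := hE i (σ.symm c)
      simpa only [if_true, Equiv.apply_symm_apply] using this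
  by_cases hcase : t (μ i) ≤ r (μ i) - 2 * (ω * η)
  · obtain ⟨v', hv'⟩ := man (μ i)
    refine ⟨v', fun s σ hs hE => ?_⟩
    obtain ⟨h1, h2⟩ := hv' s σ hs hE
    rw [h1]
    exact (min_le_left _ _).trans ((hui (μ i)).antitone (by linarith))
  · push Not at hcase
    obtain ⟨v', hv'⟩ := man (μ j)
    refine ⟨v', fun s σ hs hE => ?_⟩
    obtain ⟨h1, h2⟩ := hv' s σ hs hE
    rw [h1]
    refine (min_le_right _ _).trans ((hui (μ j)).antitone ?_)
    have h3 := lower_bd w K hK1 hw1 hw2 m i (μ i) r t μ ν hrm htm hr hν hcut (2 * (ω * η))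
      (by linarith) hcase.le (μ j)
    have h4 : 4 * (n * K ^ n * (ω * η)) + 4 * (K ^ n * (ω * η)) = η := by
      have : (4 * (n + 1) * K ^ n * ω) * η = η := by rw [hωe, one_mul]
      linarith
    have h5 : ω * η ≤ K ^ n * (ω * η) := le_mul_of_one_le_left hωη.le hKn
    linarith
end
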